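/- arXiv:2307.13245 — 2 statements merged into one kernel-verified Lean document; each statement's English description precedes it below -/
import Mathlib

section
/- Let K satisfy the kernel assumptions, let f^in be a nonnegative function in X_{0,1}, and for each ε ∈ (0,1) let f^ε = (f_i^ε)_{i≥1} be a solution of the discrete RBK system with coefficients a^ε_{i,j} := ε·K(εi, εj) and initial data f_i^{0,ε} := ε^{-1} ∫_{Λ_i^ε} f^in(x) dx; set f_ε(x,t) := Σ_{i≥1} f_i^ε(t)·1_{Λ_i^ε}(x). Then for every T ∈ (0,∞) there exist a nonnegative function f ∈ L^∞(0,T; L¹(0,∞)) and a sequence ε_n → 0 in (0,1) such that f_{ε_n} → f in C([0,T]; w-L¹(0,∞)), i.e. for every φ ∈ L^∞(0,∞), sup_{t∈[0,T]} |∫₀^∞ (f_{ε_n}(x,t) − f(x,t)) φ(x) dx| → 0 as n → ∞. -/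
open MeasureTheory

/-- The cell `Λ_i^ε = [(i-1/2)ε, (i+1/2)ε)`. -/
noncomputable def cell (ε : ℝ) (i : ℕ) : Set ℝ :=
  Set.Ico (((i : ℝ) - 1/2) * ε) (((i : ℝ) + 1/2) * ε)

/-- The step function `f_ε(x) = Σ_{i≥1} g_i 1_{Λ_i^ε}(x)`. -/
noncomputable def stepFn (ε : ℝ) (g : ℕ → ℝ) (x : ℝ) : ℝ :=
  ∑' i : ℕ, g (i + 1) * (cell ε (i + 1)).indicator (fun _ => (1:ℝ)) x

/-- `g` is a solution of the discrete RBK coagulation system with coagulation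
coefficients `a` and initial data `g0`: the functions `g i` (for `i ≥ 1`) are nonnegative,
start from `g0 i`, solve the DRBK equations (gain minus loss, both series converging),
have mass bounded by the (finite) initial mass, number of particles bounded by the initial
number, and nonincreasing tail moments. -/
def IsDRBKSol (a : ℕ → ℕ → ℝ) (g0 : ℕ → ℝ) (g : ℕ → ℝ → ℝ) : Prop :=
  (∀ i : ℕ, 1 ≤ i → ∀ t : ℝ, 0 ≤ t → 0 ≤ g i t) ∧
  (∀ i : ℕ, 1 ≤ i → g i 0 = g0 i) ∧
  (∀ i : ℕ, 1 ≤ i → ∀ t : ℝ, 0 ≤ t →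
    Summable (fun j : ℕ => a (i + (j + 1)) (j + 1) * g (i + (j + 1)) t * g (j + 1) t) ∧
    Summable (fun j : ℕ => a i (j + 1) * g i t * g (j + 1) t) ∧
    HasDerivWithinAt (g i)
      ((∑' j : ℕ, a (i + (j + 1)) (j + 1) * g (i + (j + 1)) t * g (j + 1) t) -
        ∑' j : ℕ, a i (j + 1) * g i t * g (j + 1) t) (Set.Ici 0) t) ∧
  Summable (fun i : ℕ => ((i : ℝ) + 1) * g0 (i + 1)) ∧
  (∀ t : ℝ, 0 ≤ t → Summable (fun i : ℕ => ((i : ℝ) + 1) * g (i + 1) t)) ∧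
  (∀ t : ℝ, 0 ≤ t →
    ∑' i : ℕ, ((i : ℝ) + 1) * g (i + 1) t ≤ ∑' i : ℕ, ((i : ℝ) + 1) * g0 (i + 1)) ∧
  (∀ t : ℝ, 0 ≤ t → ∑' i : ℕ, g (i + 1) t ≤ ∑' i : ℕ, g0 (i + 1)) ∧
  (∀ m : ℕ, ∀ t₁ t₂ : ℝ, 0 ≤ t₁ → t₁ ≤ t₂ →
    ∑' k : ℕ, ((m + 1 + k : ℕ) : ℝ) * g (m + 1 + k) t₂ ≤
      ∑' k : ℕ, ((m + 1 + k : ℕ) : ℝ) * g (m + 1 + k) t₁)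

lemma rbk_reindex (M : ℕ) (c : ℕ → ℕ → ℕ → ℝ) :
    ∑ i ∈ Finset.Icc 1 M, ∑ x ∈ Finset.Icc 1 M, ∑ y ∈ Finset.Icc 1 M,
      (if x = y + i then c x y i else 0) =
    ∑ x ∈ Finset.Icc 1 M, ∑ y ∈ Finset.Icc 1 M, (if y < x then c x y (x - y) else 0) := by
  rw [Finset.sum_comm]
  refine Finset.sum_congr rfl fun x hx => ?_
  rw [Finset.sum_comm]
  refine Finset.sum_congr rfl fun y hy => ?_
  rw [Finset.mem_Icc] at hx hy
  by_cases hxy : y < x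
  · rw [Finset.sum_eq_single (x - y)]
    · rw [if_pos (by omega), if_pos hxy]
    · intro b hb hne
      rw [if_neg (by omega)]
    · intro h
      exact absurd (Finset.mem_Icc.2 ⟨by omega, by omega⟩) h
  · rw [if_neg hxy]
    refine Finset.sum_eq_zero fun i hi => ?_
    rw [Finset.mem_Icc] at hi
    rw [if_neg (by omega)]

lemma rbk_sym (M : ℕ) (b : ℕ → ℕ → ℝ) :
    ∑ x ∈ Finset.Icc 1 M, ∑ y ∈ Finset.Icc 1 M, b x y =
    ∑ x ∈ Finset.Icc 1 M, ∑ y ∈ Finset.Icc 1 M, (if y < x then b x y + b y x else 0)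
      + ∑ x ∈ Finset.Icc 1 M, b x x := by
  have h1 : ∀ x ∈ Finset.Icc 1 M, b x x =
      ∑ y ∈ Finset.Icc 1 M, (if y = x then b x y else 0) := by
    intro x hx
    rw [Finset.sum_ite_eq' (Finset.Icc 1 M) x (fun y => b x y), if_pos hx]
  rw [Finset.sum_congr rfl h1]
  have h2 : ∑ x ∈ Finset.Icc 1 M, ∑ y ∈ Finset.Icc 1 M, (if y < x then b x y + b y x else 0)
      = ∑ x ∈ Finset.Icc 1 M, ∑ y ∈ Finset.Icc 1 M, (if y < x then b x y else 0)
       + ∑ x ∈ Finset.Icc 1 M, ∑ y ∈ Finset.Icc 1 M, (if x < y then b x y else 0) := by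
    rw [Finset.sum_comm (f := fun x y => if x < y then b x y else 0),
      ← Finset.sum_add_distrib]
    refine Finset.sum_congr rfl fun x _ => ?_
    rw [← Finset.sum_add_distrib]
    refine Finset.sum_congr rfl fun y _ => ?_
    split_ifs <;> simp
  rw [h2, ← Finset.sum_add_distrib, ← Finset.sum_add_distrib]
  refine Finset.sum_congr rfl fun x _ => ?_
  rw [← Finset.sum_add_distrib, ← Finset.sum_add_distrib]
  refine Finset.sum_congr rfl fun y _ => ?_
  rcases lt_trichotomy y x with h | h | h
  · simp [h, h.ne, not_lt.2 h.le]
  · simp [h]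
  · simp [h, h.ne', not_lt.2 h.le]

/-- right derivative of the positive part -/
lemma rbk_posPart_deriv {u : ℝ → ℝ} {d t B : ℝ} (hu : HasDerivWithinAt u d (Set.Ici t) t)
    (h1 : u t ≤ 0 → 0 ≤ B) (h2 : 0 ≤ u t → d ≤ B) :
    ∃ d', HasDerivWithinAt (fun s => max (u s) 0) d' (Set.Ici t) t ∧ d' ≤ B := by
  rcases lt_trichotomy (u t) 0 with h | h | h
  · refine ⟨0, ?_, h1 h.le⟩
    have : (fun s => max (u s) 0) =ᶠ[nhdsWithin t (Set.Ici t)] fun _ => 0 := by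
      filter_upwards [hu.continuousWithinAt.eventually (gt_mem_nhds h)] with s hs
      exact max_eq_right (le_of_lt hs)
    exact (hasDerivWithinAt_const t (Set.Ici t) (0:ℝ)).congr_of_eventuallyEq this
      (max_eq_right h.le)
  · refine ⟨max d 0, ?_, max_le (h2 h.ge) (h1 h.le)⟩
    rw [hasDerivWithinAt_iff_tendsto_slope] at hu ⊢
    have h3 := hu.max (tendsto_const_nhds (x := (0:ℝ)))
    refine h3.congr' ?_
    filter_upwards [self_mem_nhdsWithin] with s hs
    have hs' : t < s := lt_of_le_of_ne hs.1 (fun h => hs.2 h.symm)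
    simp only [slope_def_field, h, max_self, sub_zero]
    rw [← max_div_div_right (sub_pos.2 hs').le, zero_div]
  · refine ⟨d, ?_, h2 h.le⟩
    have : (fun s => max (u s) 0) =ᶠ[nhdsWithin t (Set.Ici t)] u := by
      filter_upwards [hu.continuousWithinAt.eventually (lt_mem_nhds h)] with s hs
      exact max_eq_left (le_of_lt hs)
    exact hu.congr_of_eventuallyEq this (max_eq_left h.le)

/-- Kernel tail bound -/
lemma rbk_kernel_tail
    (K : ℝ → ℝ → ℝ) (r : ℝ → ℝ) (α : ℝ → ℝ → ℝ) (A : ℝ) (hA : 0 < A)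
    (hK_symm : ∀ x y : ℝ, 0 < x → 0 < y → K x y = K y x)
    (hr_nonneg : ∀ x : ℝ, 0 < x → 0 ≤ r x)
    (hK_form : ∀ x y : ℝ, 0 < x → 0 < y → K x y = r x * r y + α x y)
    (hα_bound : ∀ x y : ℝ, 1 ≤ x → 1 ≤ y → α x y ≤ A * r x * r y)
    (ω : ℝ → ℝ → ℝ)
    (hω_bound : ∀ R : ℝ, 1 ≤ R → ∀ y : ℝ, 0 < y → ∀ x : ℝ, 0 < x → x ≤ R → K x y / y ≤ ω R y)
    (hω_lim : ∀ R : ℝ, 1 ≤ R → Filter.Tendsto (ω R) Filter.atTop (nhds 0))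
    (Ω : ℝ → ℝ)
    (hΩ_bound : ∀ R : ℝ, 1 ≤ R → ∀ x : ℝ, R ≤ x → r x / x ≤ Ω R)
    (hΩ_lim : Filter.Tendsto Ω Filter.atTop (nhds 0)) (κ : ℝ) (hκ : 0 < κ) :
    ∃ X : ℝ, 1 ≤ X ∧ ∀ x y : ℝ, X ≤ x → 0 < y → y ≤ x → K x y ≤ κ * (x * (1 + y)) := by
  have hl : Filter.Tendsto (fun R => (1 + A) * (Ω R * Ω R)) Filter.atTop (nhds 0) := by
    simpa using (hΩ_lim.mul hΩ_lim).const_mul (1 + A)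
  obtain ⟨R, hR1, hR⟩ := ((Filter.eventually_ge_atTop (1:ℝ)).and (hl.eventually (gt_mem_nhds hκ))).exists
  obtain ⟨X, hX⟩ := Filter.eventually_atTop.1 ((hω_lim R hR1).eventually (gt_mem_nhds hκ))
  refine ⟨max X 1, le_max_right _ _, fun x y hx hy hyx => ?_⟩
  have hx1 : 1 ≤ x := (le_max_right _ _).trans hx
  have hx0 : 0 < x := by linarith
  by_cases hyR : y ≤ R
  · rw [hK_symm x y hx0 hy]
    have h1 := hω_bound R hR1 x hx0 y hy hyR
    have h2 := hX x ((le_max_left _ _).trans hx)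
    have h3 : K y x ≤ κ * x := by
      rw [← div_le_iff₀ hx0]; linarith
    have : 0 ≤ κ * (x * y) := by positivity
    nlinarith
  · push Not at hyR
    have h1 := hΩ_bound R hR1 x (hyR.le.trans hyx)
    have h2 := hΩ_bound R hR1 y hyR.le
    rw [div_le_iff₀ hx0] at h1
    rw [div_le_iff₀ hy] at h2
    have h3 := hα_bound x y hx1 (by linarith)
    rw [hK_form x y hx0 hy]
    have h4 : r x * r y ≤ (Ω R * x) * (Ω R * y) :=
      mul_le_mul h1 h2 (hr_nonneg y hy) ((hr_nonneg x hx0).trans h1)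
    have h5 : r x * r y + α x y ≤ (1 + A) * (r x * r y) := by linarith
    have h6 : (1 + A) * (r x * r y) ≤ (1+A) * ((Ω R * x) * (Ω R * y)) := by gcongr
    have h7 : (1+A) * ((Ω R * x) * (Ω R * y)) = ((1 + A) * (Ω R * Ω R)) * (x * y) := by ring
    have h8 : ((1 + A) * (Ω R * Ω R)) * (x * y) ≤ κ * (x * y) := by
      gcongr
    nlinarith

/-- Kernel local bound -/
lemma rbk_kernel_loc
    (K : ℝ → ℝ → ℝ)
    (hK_cont : ContinuousOn (fun p : ℝ × ℝ => K p.1 p.2) (Set.Ioi 0 ×ˢ Set.Ioi 0))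
    (η R : ℝ) (hη : 0 < η) :
    ∃ C : ℝ, 0 ≤ C ∧ ∀ x y : ℝ, η ≤ x → x ≤ R → η ≤ y → y ≤ R → K x y ≤ C := by
  have hc : IsCompact (Set.Icc η R ×ˢ Set.Icc η R) := isCompact_Icc.prod isCompact_Icc
  obtain ⟨C, hC⟩ := hc.exists_bound_of_continuousOn (hK_cont.mono (by
    intro p hp
    exact ⟨lt_of_lt_of_le hη hp.1.1, lt_of_lt_of_le hη hp.2.1⟩))
  refine ⟨max C 0, le_max_right _ _, fun x y h1 h2 h3 h4 => ?_⟩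
  have := hC (x, y) ⟨⟨h1, h2⟩, ⟨h3, h4⟩⟩
  exact (le_abs_self _).trans (this.trans (le_max_left _ _))

/-- Rescaled solution data. -/
structure RSol (K : ℝ → ℝ → ℝ) (ε N : ℝ) (F : ℕ → ℝ → ℝ) : Prop where
  nonneg : ∀ i, 1 ≤ i → ∀ t, 0 ≤ t → 0 ≤ F i t
  num : ∀ t, 0 ≤ t → ∀ L, ∑ i ∈ Finset.Icc 1 L, F i t ≤ N
  mass : ∀ t, 0 ≤ t → ∀ L : ℕ, ∑ i ∈ Finset.Icc 1 L, ε * ((i:ℕ):ℝ) * F i t ≤ N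
  der : ∀ i, 1 ≤ i → ∀ t, 0 ≤ t → ∃ G Lo : ℝ,
    HasSum (fun j : ℕ => K (ε * ((i + (j+1) : ℕ):ℝ)) (ε * ((j+1 : ℕ):ℝ)) *
      (F (i + (j+1)) t * F (j+1) t)) G ∧
    HasSum (fun j : ℕ => K (ε * (i:ℝ)) (ε * ((j+1 : ℕ):ℝ)) * (F i t * F (j+1) t)) Lo ∧
    HasDerivWithinAt (F i) (G - Lo) (Set.Ici 0) t

lemma rbk_tail_sum {K : ℝ → ℝ → ℝ} {ε N : ℝ} {F : ℕ → ℝ → ℝ} (hF : RSol K ε N F)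
    (hε : 0 < ε) {κ X : ℝ} (hκ : 0 < κ)
    (hX : ∀ x y : ℝ, X ≤ x → 0 < y → y ≤ x → K x y ≤ κ * (x * (1 + y)))
    (t : ℝ) (ht : 0 ≤ t) (L : ℕ) :
    ∑ x ∈ Finset.Icc 1 L, ∑ y ∈ Finset.Icc 1 L,
      (if X ≤ ε * (x:ℝ) ∧ y ≤ x then K (ε * (x:ℝ)) (ε * (y:ℝ)) * (F x t * F y t) else 0)
      ≤ κ * (N * (2 * N)) := by
  have hN : 0 ≤ N := by simpa using hF.num t ht 0
  have h1 : ∑ x ∈ Finset.Icc 1 L, ∑ y ∈ Finset.Icc 1 L,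
      (if X ≤ ε * (x:ℝ) ∧ y ≤ x then K (ε * (x:ℝ)) (ε * (y:ℝ)) * (F x t * F y t) else 0)
      ≤ ∑ x ∈ Finset.Icc 1 L, ∑ y ∈ Finset.Icc 1 L,
        κ * ((ε * (x:ℝ) * F x t) * (F y t + ε * (y:ℝ) * F y t)) := by
    refine Finset.sum_le_sum fun x hx => Finset.sum_le_sum fun y hy => ?_
    rw [Finset.mem_Icc] at hx hy
    have hFx := hF.nonneg x hx.1 t ht
    have hFy := hF.nonneg y hy.1 t ht
    have hx0 : 0 < ε * (x:ℝ) := mul_pos hε (by exact_mod_cast hx.1)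
    have hy0 : 0 < ε * (y:ℝ) := mul_pos hε (by exact_mod_cast hy.1)
    split_ifs with h
    · have hyx : ε * (y:ℝ) ≤ ε * (x:ℝ) := by
        have : (y:ℝ) ≤ x := by exact_mod_cast h.2
        gcongr
      have := mul_le_mul_of_nonneg_right (hX _ _ h.1 hy0 hyx) (mul_nonneg hFx hFy)
      refine this.trans (le_of_eq (by ring))
    · positivity
  refine h1.trans ?_
  have h2 : ∑ x ∈ Finset.Icc 1 L, ∑ y ∈ Finset.Icc 1 L,
        κ * ((ε * (x:ℝ) * F x t) * (F y t + ε * (y:ℝ) * F y t)) =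
      κ * ((∑ x ∈ Finset.Icc 1 L, ε * (x:ℝ) * F x t) *
        (∑ y ∈ Finset.Icc 1 L, F y t + ∑ y ∈ Finset.Icc 1 L, ε * (y:ℝ) * F y t)) := by
    rw [← Finset.sum_add_distrib, Finset.sum_mul_sum, Finset.mul_sum]
    refine Finset.sum_congr rfl fun x _ => ?_
    rw [Finset.mul_sum]
  rw [h2]
  have h3 := hF.mass t ht L
  have h4 := hF.num t ht L
  have h5 : 0 ≤ ∑ y ∈ Finset.Icc 1 L, F y t + ∑ y ∈ Finset.Icc 1 L, ε * (y:ℝ) * F y t := by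
    refine add_nonneg (Finset.sum_nonneg fun y hy => hF.nonneg y (Finset.mem_Icc.1 hy).1 t ht)
      (Finset.sum_nonneg fun y hy => mul_nonneg (by positivity)
        (hF.nonneg y (Finset.mem_Icc.1 hy).1 t ht))
  refine mul_le_mul_of_nonneg_left ?_ hκ.le
  exact mul_le_mul h3 (by linarith) h5 hN

/-- Finite form of the equation, with small remainders. -/
lemma rbk_finite_form (M : ℕ) (c : ℕ → ℕ → ℝ) (κ : ℝ)
    (hc0 : ∀ x y, 1 ≤ x → 1 ≤ y → 0 ≤ c x y)
    (hcs : ∀ x y, 1 ≤ x → 1 ≤ y → c x y = c y x)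
    (hκ : ∀ L, ∑ x ∈ Finset.Icc 1 L, ∑ y ∈ Finset.Icc 1 L,
      (if M < x ∧ y ≤ x then c x y else 0) ≤ κ)
    (G Lo : ℕ → ℝ)
    (hG : ∀ i ∈ Finset.Icc 1 M, HasSum (fun j : ℕ => c (i + (j+1)) (j+1)) (G i))
    (hLo : ∀ i ∈ Finset.Icc 1 M, HasSum (fun j : ℕ => c i (j+1)) (Lo i)) :
    ∃ τ τ' : ℕ → ℝ, (∀ i ∈ Finset.Icc 1 M, 0 ≤ τ i) ∧ (∀ i ∈ Finset.Icc 1 M, 0 ≤ τ' i) ∧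
      ∑ i ∈ Finset.Icc 1 M, τ i ≤ κ ∧ ∑ i ∈ Finset.Icc 1 M, τ' i ≤ κ ∧
      ∀ i ∈ Finset.Icc 1 M, G i - Lo i =
        (∑ x ∈ Finset.Icc 1 M, ∑ y ∈ Finset.Icc 1 M, (if x = y + i then c x y else 0))
        - (∑ y ∈ Finset.Icc 1 M, c i y) + τ i - τ' i := by
  have hshift : ∀ (g : ℕ → ℝ) (J : ℕ), ∑ j ∈ Finset.range J, g (j+1) = ∑ y ∈ Finset.Icc 1 J, g y := by
    intro g J
    rw [Finset.range_eq_Ico, Finset.sum_Ico_add' g 0 J 1]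
    rfl
  -- gain partial sums
  have hGfin : ∀ i, 1 ≤ i → ∀ J, ∑ x ∈ Finset.Icc 1 J, ∑ y ∈ Finset.Icc 1 J,
      (if x = y + i then c x y else 0) ≤ ∑ j ∈ Finset.range J, c (i + (j+1)) (j+1) := by
    intro i hi J
    rw [hshift (fun y => c (i + y) y) J, Finset.sum_comm]
    refine Finset.sum_le_sum fun y hy => ?_
    rw [Finset.sum_ite_eq' (Finset.Icc 1 J) (y+i) (fun x => c x y)]
    rw [Finset.mem_Icc] at hy
    split_ifs
    · rw [add_comm]
    · exact hc0 _ _ (by omega) (by omega)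
  have hGfin2 : ∀ i ∈ Finset.Icc 1 M, ∀ J, ∑ j ∈ Finset.range J, c (i + (j+1)) (j+1) ≤
      ∑ x ∈ Finset.Icc 1 (M+J), ∑ y ∈ Finset.Icc 1 (M+J), (if x = y + i then c x y else 0) := by
    intro i hi J
    rw [Finset.mem_Icc] at hi
    rw [hshift (fun y => c (i + y) y) J, Finset.sum_comm]
    have : ∑ y ∈ Finset.Icc 1 J, c (i+y) y ≤ ∑ y ∈ Finset.Icc 1 J,
        ∑ x ∈ Finset.Icc 1 (M+J), (if x = y + i then c x y else 0) := by
      refine Finset.sum_le_sum fun y hy => ?_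
      rw [Finset.sum_ite_eq' (Finset.Icc 1 (M+J)) (y+i) (fun x => c x y)]
      rw [Finset.mem_Icc] at hy
      rw [if_pos (Finset.mem_Icc.2 ⟨by omega, by omega⟩), add_comm]
    refine this.trans (Finset.sum_le_sum_of_subset_of_nonneg ?_ ?_)
    · exact Finset.Icc_subset_Icc le_rfl (by omega)
    · intro y hy _
      refine Finset.sum_nonneg fun x hx => ?_
      rw [Finset.mem_Icc] at hx hy
      split_ifs
      · exact hc0 _ _ hx.1 hy.1
      · exact le_rfl
  refine ⟨fun i => G i - ∑ x ∈ Finset.Icc 1 M, ∑ y ∈ Finset.Icc 1 M, (if x = y + i then c x y else 0),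
    fun i => Lo i - ∑ y ∈ Finset.Icc 1 M, c i y, ?_, ?_, ?_, ?_, ?_⟩
  · intro i hi
    have hi1 := (Finset.mem_Icc.1 hi).1
    have := sum_le_hasSum (Finset.range M) (fun j _ => hc0 _ _ (by omega) (by omega)) (hG i hi)
    linarith [hGfin i hi1 M]
  · intro i hi
    have hi1 := (Finset.mem_Icc.1 hi).1
    have := sum_le_hasSum (Finset.range M) (fun j _ => hc0 _ _ (by omega) (by omega)) (hLo i hi)
    rw [hshift (fun y => c i y) M] at this
    linarith
  · rw [Finset.sum_sub_distrib]
    have hlim : Filter.Tendsto (fun J => ∑ i ∈ Finset.Icc 1 M, ∑ j ∈ Finset.range J, c (i + (j+1)) (j+1))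
        Filter.atTop (nhds (∑ i ∈ Finset.Icc 1 M, G i)) :=
      tendsto_finsetSum _ fun i hi => (hG i hi).tendsto_sum_nat
    have hb : ∀ J, ∑ i ∈ Finset.Icc 1 M, ∑ j ∈ Finset.range J, c (i + (j+1)) (j+1) ≤
        κ + ∑ i ∈ Finset.Icc 1 M, ∑ x ∈ Finset.Icc 1 M, ∑ y ∈ Finset.Icc 1 M, (if x = y + i then c x y else 0) := by
      intro J
      refine (Finset.sum_le_sum fun i hi => hGfin2 i hi J).trans ?_
      set L := M + J with hL
      have hsplit : ∀ i ∈ Finset.Icc 1 M, ∑ x ∈ Finset.Icc 1 L, ∑ y ∈ Finset.Icc 1 L, (if x = y + i then c x y else 0)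
        = ∑ x ∈ Finset.Icc 1 L, ∑ y ∈ Finset.Icc 1 L, (if x = y + i then (if M < x then c x y else 0) else 0)
          + ∑ x ∈ Finset.Icc 1 M, ∑ y ∈ Finset.Icc 1 M, (if x = y + i then c x y else 0) := by
        intro i hi
        rw [Finset.mem_Icc] at hi
        have e1 : ∑ x ∈ Finset.Icc 1 M, ∑ y ∈ Finset.Icc 1 M, (if x = y + i then c x y else 0)
          = ∑ x ∈ Finset.Icc 1 L, ∑ y ∈ Finset.Icc 1 L, (if x = y + i then (if x ≤ M then c x y else 0) else 0) := by
          have e2 : ∀ x ∈ Finset.Icc 1 M, ∑ y ∈ Finset.Icc 1 M, (if x = y + i then c x y else 0) =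
             ∑ y ∈ Finset.Icc 1 L, (if x = y + i then (if x ≤ M then c x y else 0) else 0) := by
            intro x hx
            rw [Finset.mem_Icc] at hx
            simp only [if_pos hx.2]
            refine Finset.sum_subset (Finset.Icc_subset_Icc le_rfl (by omega)) ?_
            intro y hy hy'
            rw [Finset.mem_Icc] at hy hy'
            rw [if_neg (by omega)]
          rw [Finset.sum_congr rfl e2]
          refine Finset.sum_subset (Finset.Icc_subset_Icc le_rfl (by omega)) ?_
          intro x hx hx'
          rw [Finset.mem_Icc] at hx hx'
          refine Finset.sum_eq_zero fun y _ => ?_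
          rw [if_neg (by omega : ¬ x ≤ M)]
          simp
        rw [e1, ← Finset.sum_add_distrib]
        refine Finset.sum_congr rfl fun x _ => ?_
        rw [← Finset.sum_add_distrib]
        refine Finset.sum_congr rfl fun y _ => ?_
        by_cases hx : x ≤ M
        · simp [hx, not_lt.2 hx]
        · simp [hx, not_le.1 hx]
      rw [Finset.sum_congr rfl hsplit, Finset.sum_add_distrib]
      refine add_le_add ?_ le_rfl
      have e3 : ∑ i ∈ Finset.Icc 1 M, ∑ x ∈ Finset.Icc 1 L, ∑ y ∈ Finset.Icc 1 L, (if x = y + i then (if M < x then c x y else 0) else 0)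
        ≤ ∑ i ∈ Finset.Icc 1 L, ∑ x ∈ Finset.Icc 1 L, ∑ y ∈ Finset.Icc 1 L, (if x = y + i then (if M < x then c x y else 0) else 0) := by
        refine Finset.sum_le_sum_of_subset_of_nonneg (Finset.Icc_subset_Icc le_rfl (by omega)) ?_
        intro i _ _
        refine Finset.sum_nonneg fun x hx => Finset.sum_nonneg fun y hy => ?_
        rw [Finset.mem_Icc] at hx hy
        split_ifs
        · exact hc0 _ _ hx.1 hy.1
        · exact le_rfl
        · exact le_rfl
      refine e3.trans ?_
      rw [rbk_reindex L (fun x y _ => if M < x then c x y else 0)]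
      refine le_trans ?_ (hκ L)
      refine Finset.sum_le_sum fun x hx => Finset.sum_le_sum fun y hy => ?_
      rw [Finset.mem_Icc] at hx hy
      have := hc0 x y hx.1 hy.1
      by_cases h1 : y < x
      · by_cases h2 : M < x
        · simp [h1, h2, h1.le]
        · simp [h1, h2]
      · rw [if_neg h1]
        split_ifs
        · exact this
        · exact le_rfl
    have := le_of_tendsto' hlim hb
    linarith
  · rw [Finset.sum_sub_distrib]
    have hlim : Filter.Tendsto (fun J => ∑ i ∈ Finset.Icc 1 M, ∑ j ∈ Finset.range J, c i (j+1))
        Filter.atTop (nhds (∑ i ∈ Finset.Icc 1 M, Lo i)) :=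
      tendsto_finsetSum _ fun i hi => (hLo i hi).tendsto_sum_nat
    have hb : ∀ J, ∑ i ∈ Finset.Icc 1 M, ∑ j ∈ Finset.range J, c i (j+1) ≤
        κ + ∑ i ∈ Finset.Icc 1 M, ∑ y ∈ Finset.Icc 1 M, c i y := by
      intro J
      have e1 : ∀ i ∈ Finset.Icc 1 M, ∑ j ∈ Finset.range J, c i (j+1) ≤
          ∑ y ∈ Finset.Icc 1 (M+J), (if M < y then c i y else 0) + ∑ y ∈ Finset.Icc 1 M, c i y := by
        intro i hi
        rw [Finset.mem_Icc] at hi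
        rw [hshift (fun y => c i y) J]
        have e2 : ∑ y ∈ Finset.Icc 1 M, c i y = ∑ y ∈ Finset.Icc 1 (M+J), (if y ≤ M then c i y else 0) := by
          rw [← Finset.sum_filter]
          refine Finset.sum_congr ?_ fun _ _ => rfl
          ext y; simp only [Finset.mem_Icc, Finset.mem_filter]; omega
        rw [e2, ← Finset.sum_add_distrib]
        have e4 : ∀ y ∈ Finset.Icc 1 (M+J), ((if M < y then c i y else 0) + (if y ≤ M then c i y else 0)) = c i y := by
          intro y _
          by_cases hx : y ≤ M
          · simp [hx, not_lt.2 hx]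
          · simp [hx, not_le.1 hx]
        rw [Finset.sum_congr rfl e4]
        refine Finset.sum_le_sum_of_subset_of_nonneg (Finset.Icc_subset_Icc le_rfl (by omega)) ?_
        intro y hy _
        exact hc0 _ _ hi.1 (Finset.mem_Icc.1 hy).1
      refine (Finset.sum_le_sum e1).trans ?_
      rw [Finset.sum_add_distrib]
      refine add_le_add ?_ le_rfl
      refine le_trans ?_ (hκ (M+J))
      rw [Finset.sum_comm]
      refine Finset.sum_le_sum fun x hx => ?_
      rw [Finset.mem_Icc] at hx
      have e5 : ∑ i ∈ Finset.Icc 1 M, (if M < x then c i x else 0) ≤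
          ∑ i ∈ Finset.Icc 1 M, (if M < x ∧ i ≤ x then c x i else 0) := by
        refine Finset.sum_le_sum fun i hi => ?_
        rw [Finset.mem_Icc] at hi
        by_cases h2 : M < x
        · simp [h2, (by omega : i ≤ x), hcs i x hi.1 hx.1]
        · simp [h2]
      refine e5.trans (Finset.sum_le_sum_of_subset_of_nonneg (Finset.Icc_subset_Icc le_rfl (by omega)) ?_)
      intro y hy _
      split_ifs
      · exact hc0 _ _ hx.1 (Finset.mem_Icc.1 hy).1
      · exact le_rfl
    have := le_of_tendsto' hlim hb
    linarith
  · intro i hi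
    ring

lemma rbk_pair_y (M i : ℕ) (b : ℕ → ℕ → ℝ) (v : ℕ → ℝ) (a : ℝ) (ha : 0 ≤ a)
    (hv : ∀ y ∈ Finset.Icc 1 M, 0 ≤ v y)
    (hb : ∀ x ∈ Finset.Icc 1 M, ∀ y ∈ Finset.Icc 1 M, x = y + i → b x y ≤ a * v y) :
    ∑ x ∈ Finset.Icc 1 M, ∑ y ∈ Finset.Icc 1 M, (if x = y + i then b x y else 0)
      ≤ a * ∑ y ∈ Finset.Icc 1 M, v y := by
  rw [Finset.sum_comm, Finset.mul_sum]
  refine Finset.sum_le_sum fun y hy => ?_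
  rw [Finset.sum_ite_eq' (Finset.Icc 1 M) (y+i) (fun x => b x y)]
  split_ifs with h
  · exact hb _ h _ hy rfl
  · exact mul_nonneg ha (hv y hy)

lemma rbk_pair_x (M i : ℕ) (b : ℕ → ℕ → ℝ) (v : ℕ → ℝ) (a : ℝ) (ha : 0 ≤ a)
    (hv : ∀ y ∈ Finset.Icc 1 M, 0 ≤ v y)
    (hb : ∀ x ∈ Finset.Icc 1 M, ∀ y ∈ Finset.Icc 1 M, x = y + i → b x y ≤ a * v x) :
    ∑ x ∈ Finset.Icc 1 M, ∑ y ∈ Finset.Icc 1 M, (if x = y + i then b x y else 0)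
      ≤ a * ∑ y ∈ Finset.Icc 1 M, v y := by
  rw [Finset.mul_sum]
  refine Finset.sum_le_sum fun x hx => ?_
  by_cases h : x - i ∈ Finset.Icc 1 M ∧ i ≤ x
  · rw [Finset.sum_eq_single (x - i)]
    · rw [if_pos (by omega)]
      exact hb _ hx _ h.1 (by omega)
    · intro y _ hne
      rw [if_neg (by omega)]
    · intro hh; exact absurd h.1 hh
  · rw [Finset.sum_eq_zero]
    · exact mul_nonneg ha (hv x hx)
    · intro y hy
      rw [if_neg]
      rintro rfl
      exact h ⟨by simpa using hy, by omega⟩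

lemma rbk_count (M : ℕ) (ε η : ℝ) (hε : 0 < ε) (hη : 0 ≤ η) :
    ∑ i ∈ Finset.Icc 1 M, (if ε * (i:ℝ) < η then ε else 0) ≤ η := by
  rw [← Finset.sum_filter, Finset.sum_const, nsmul_eq_mul]
  have h1 : (Finset.filter (fun i : ℕ => ε * (i:ℝ) < η) (Finset.Icc 1 M)).card ≤ ⌊η/ε⌋₊ := by
    have : Finset.filter (fun i : ℕ => ε * (i:ℝ) < η) (Finset.Icc 1 M) ⊆ Finset.Icc 1 ⌊η/ε⌋₊ := by
      intro i hi
      rw [Finset.mem_filter, Finset.mem_Icc] at hi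
      rw [Finset.mem_Icc]
      refine ⟨hi.1.1, Nat.le_floor ?_⟩
      rw [le_div_iff₀ hε]; linarith [hi.2]
    simpa using Finset.card_le_card this
  have h2 : (⌊η/ε⌋₊ : ℝ) ≤ η/ε := Nat.floor_le (by positivity)
  have h3 : ((Finset.filter (fun i : ℕ => ε * (i:ℝ) < η) (Finset.Icc 1 M)).card : ℝ) ≤ η / ε :=
    le_trans (by exact_mod_cast h1) h2
  rwa [le_div_iff₀ hε] at h3

/-- interaction functional -/
noncomputable def rbkD (M : ℕ) (k : ℕ → ℕ → ℝ) (h : ℕ → ℝ) : ℝ :=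
  ∑ x ∈ Finset.Icc 1 M, ∑ y ∈ Finset.Icc 1 M, (if y < x then k x y * (h x * h y) else 0)

lemma rbk_alg1 (M : ℕ) (k : ℕ → ℕ → ℝ) (F h : ℕ → ℝ)
    (hk0 : ∀ x y, 1 ≤ x → 1 ≤ y → 0 ≤ k x y)
    (hks : ∀ x y, 1 ≤ x → 1 ≤ y → k x y = k y x)
    (hh0 : ∀ x, 1 ≤ x → 0 ≤ h x) (hF0 : ∀ x, 1 ≤ x → 0 ≤ F x) :
    ∑ i ∈ Finset.Icc 1 M, ∑ x ∈ Finset.Icc 1 M, ∑ y ∈ Finset.Icc 1 M,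
      (if x = y + i then k x y * (h x * F y + (F x - h x) * h y) else 0)
    - ∑ i ∈ Finset.Icc 1 M, ∑ y ∈ Finset.Icc 1 M, k i y * (h i * F y) ≤ - rbkD M k h := by
  rw [rbk_reindex M (fun x y _ => k x y * (h x * F y + (F x - h x) * h y)),
    rbk_sym M (fun x y => k x y * (h x * F y))]
  have hd : 0 ≤ ∑ x ∈ Finset.Icc 1 M, k x x * (h x * F x) :=
    Finset.sum_nonneg fun x hx => by
      have := (Finset.mem_Icc.1 hx).1
      exact mul_nonneg (hk0 _ _ this this) (mul_nonneg (hh0 _ this) (hF0 _ this))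
  have e : ∑ x ∈ Finset.Icc 1 M, ∑ y ∈ Finset.Icc 1 M,
      (if y < x then k x y * (h x * F y + (F x - h x) * h y) else 0)
      = ∑ x ∈ Finset.Icc 1 M, ∑ y ∈ Finset.Icc 1 M,
      (if y < x then k x y * (h x * F y) + k y x * (h y * F x) else 0) - rbkD M k h := by
    unfold rbkD
    rw [← Finset.sum_sub_distrib]
    refine Finset.sum_congr rfl fun x hx => ?_
    rw [← Finset.sum_sub_distrib]
    refine Finset.sum_congr rfl fun y hy => ?_
    rw [Finset.mem_Icc] at hx hy
    split_ifs
    · rw [hks y x hy.1 hx.1]; ring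
    · simp
  rw [e]; linarith

lemma rbk_alg2 (M : ℕ) (k : ℕ → ℕ → ℝ) (F h p : ℕ → ℝ) (P : ℕ → Prop) [DecidablePred P] (e : ℝ)
    (hk0 : ∀ x y, 1 ≤ x → 1 ≤ y → 0 ≤ k x y)
    (hh0 : ∀ x, 1 ≤ x → 0 ≤ h x) (hhp : ∀ x, 1 ≤ x → h x ≤ p x)
    (hpF : ∀ x, 1 ≤ x → p x ≤ F x)
    (he : ∑ i ∈ Finset.Icc 1 M, (if P i then ∑ x ∈ Finset.Icc 1 M, ∑ y ∈ Finset.Icc 1 M,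
      (if x = y + i then k x y * ((F x - p x) * (F y - h y) + (F x - h x) * (F y - p y)) else 0)
      else 0) ≤ e) :
    ∑ i ∈ Finset.Icc 1 M, (if P i then ∑ x ∈ Finset.Icc 1 M, ∑ y ∈ Finset.Icc 1 M,
      (if x = y + i then k x y * ((F x - h x) * (F y - h y)) else 0) else 0)
      ≤ rbkD M k p + e := by
  have e1 : rbkD M k p = ∑ i ∈ Finset.Icc 1 M, ∑ x ∈ Finset.Icc 1 M, ∑ y ∈ Finset.Icc 1 M,
      (if x = y + i then k x y * (p x * p y) else 0) := by
    rw [rbk_reindex M (fun x y _ => k x y * (p x * p y))]; rfl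
  rw [e1]
  refine le_trans ?_ (add_le_add le_rfl he)
  rw [← Finset.sum_add_distrib]
  refine Finset.sum_le_sum fun i _ => ?_
  have hnn : 0 ≤ ∑ x ∈ Finset.Icc 1 M, ∑ y ∈ Finset.Icc 1 M,
      (if x = y + i then k x y * (p x * p y) else 0) := by
    refine Finset.sum_nonneg fun x hx => Finset.sum_nonneg fun y hy => ?_
    rw [Finset.mem_Icc] at hx hy
    split_ifs
    · exact mul_nonneg (hk0 _ _ hx.1 hy.1) (mul_nonneg ((hh0 _ hx.1).trans (hhp _ hx.1))
        ((hh0 _ hy.1).trans (hhp _ hy.1)))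
    · exact le_rfl
  split_ifs
  · rw [← Finset.sum_add_distrib]
    refine Finset.sum_le_sum fun x hx => ?_
    rw [← Finset.sum_add_distrib]
    refine Finset.sum_le_sum fun y hy => ?_
    rw [Finset.mem_Icc] at hx hy
    split_ifs
    · rw [← mul_add]
      refine mul_le_mul_of_nonneg_left ?_ (hk0 _ _ hx.1 hy.1)
      have a1 := hh0 _ hx.1
      have a2 := hhp _ hx.1
      have a3 := hpF _ hx.1
      have b1 := hh0 _ hy.1
      have b2 := hhp _ hy.1
      have b3 := hpF _ hy.1
      nlinarith [mul_nonneg a1 b1, mul_nonneg a1 (sub_nonneg.2 b2), mul_nonneg b1 (sub_nonneg.2 a2),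
        mul_nonneg (sub_nonneg.2 a3) (sub_nonneg.2 b3)]
    · simp
  · linarith

/-- Pointwise bounds for the derivative of the positive parts. -/
lemma rbk_step (M : ℕ) (k : ℕ → ℕ → ℝ) (F E E' d τ τ' : ℕ → ℝ) (P : ℕ → Prop) [DecidablePred P]
    (κ : ℝ)
    (hk0 : ∀ x y, 1 ≤ x → 1 ≤ y → 0 ≤ k x y)
    (hks : ∀ x y, 1 ≤ x → 1 ≤ y → k x y = k y x)
    (hF0 : ∀ x, 1 ≤ x → 0 ≤ F x) (hE0 : ∀ x, 1 ≤ x → 0 ≤ E x)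
    (hτ : ∀ i ∈ Finset.Icc 1 M, 0 ≤ τ i) (hτ' : ∀ i ∈ Finset.Icc 1 M, 0 ≤ τ' i)
    (hτs : ∑ i ∈ Finset.Icc 1 M, τ i ≤ κ)
    (hd : ∀ i ∈ Finset.Icc 1 M, d i =
        (∑ x ∈ Finset.Icc 1 M, ∑ y ∈ Finset.Icc 1 M, (if x = y + i then k x y * (F x * F y) else 0))
        - (∑ y ∈ Finset.Icc 1 M, k i y * (F i * F y)) + τ i - τ' i)
    (h : ℕ → ℝ) (hh : ∀ i, h i = max (F i - E i) 0)
    (hE' : ∀ i ∈ Finset.Icc 1 M, ∑ x ∈ Finset.Icc 1 M, ∑ y ∈ Finset.Icc 1 M,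
      (if x = y + i then k x y * ((F x - h x) * (F y - h y)) else 0) ≤ E' i +
      (if P i then ∑ x ∈ Finset.Icc 1 M, ∑ y ∈ Finset.Icc 1 M,
      (if x = y + i then k x y * ((F x - h x) * (F y - h y)) else 0) else 0)) :
    ∃ B : ℕ → ℝ, (∀ i ∈ Finset.Icc 1 M, F i - E i ≤ 0 → 0 ≤ B i) ∧
      (∀ i ∈ Finset.Icc 1 M, 0 ≤ F i - E i → d i - E' i ≤ B i) ∧
      ∑ i ∈ Finset.Icc 1 M, B i ≤ - rbkD M k h + κ +
       ∑ i ∈ Finset.Icc 1 M, (if P i then ∑ x ∈ Finset.Icc 1 M, ∑ y ∈ Finset.Icc 1 M,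
      (if x = y + i then k x y * ((F x - h x) * (F y - h y)) else 0) else 0) := by
  have hh0 : ∀ x, 1 ≤ x → 0 ≤ h x := fun x _ => by rw [hh]; exact le_max_right _ _
  have hhF : ∀ x, 1 ≤ x → h x ≤ F x := fun x hx => by
    rw [hh]; exact max_le (by linarith [hE0 x hx]) (hF0 x hx)
  refine ⟨fun i => (∑ x ∈ Finset.Icc 1 M, ∑ y ∈ Finset.Icc 1 M,
      (if x = y + i then k x y * (h x * F y + (F x - h x) * h y) else 0)) +
      (if P i then ∑ x ∈ Finset.Icc 1 M, ∑ y ∈ Finset.Icc 1 M,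
      (if x = y + i then k x y * ((F x - h x) * (F y - h y)) else 0) else 0)
      - (∑ y ∈ Finset.Icc 1 M, k i y * (h i * F y)) + τ i, ?_, ?_, ?_⟩
  · intro i hi hFE
    have h0 : h i = 0 := by rw [hh]; exact max_eq_right hFE
    have e1 : 0 ≤ ∑ x ∈ Finset.Icc 1 M, ∑ y ∈ Finset.Icc 1 M,
      (if x = y + i then k x y * (h x * F y + (F x - h x) * h y) else 0) := by
      refine Finset.sum_nonneg fun x hx => Finset.sum_nonneg fun y hy => ?_
      rw [Finset.mem_Icc] at hx hy
      split_ifs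
      · exact mul_nonneg (hk0 _ _ hx.1 hy.1) (add_nonneg (mul_nonneg (hh0 _ hx.1) (hF0 _ hy.1))
          (mul_nonneg (sub_nonneg.2 (hhF _ hx.1)) (hh0 _ hy.1)))
      · exact le_rfl
    have e2 : 0 ≤ (if P i then ∑ x ∈ Finset.Icc 1 M, ∑ y ∈ Finset.Icc 1 M,
      (if x = y + i then k x y * ((F x - h x) * (F y - h y)) else 0) else 0) := by
      split_ifs
      · refine Finset.sum_nonneg fun x hx => Finset.sum_nonneg fun y hy => ?_
        rw [Finset.mem_Icc] at hx hy
        split_ifs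
        · exact mul_nonneg (hk0 _ _ hx.1 hy.1) 
            (mul_nonneg (sub_nonneg.2 (hhF _ hx.1)) (sub_nonneg.2 (hhF _ hy.1)))
        · exact le_rfl
      · exact le_rfl
    have e3 : ∑ y ∈ Finset.Icc 1 M, k i y * (h i * F y) = 0 := by simp [h0]
    have := hτ i hi
    simp only [e3]; linarith
  · intro i hi hFE
    have hi1 := (Finset.mem_Icc.1 hi).1
    rw [hd i hi]
    have e1 : ∑ x ∈ Finset.Icc 1 M, ∑ y ∈ Finset.Icc 1 M, (if x = y + i then k x y * (F x * F y) else 0)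
      = (∑ x ∈ Finset.Icc 1 M, ∑ y ∈ Finset.Icc 1 M,
      (if x = y + i then k x y * (h x * F y + (F x - h x) * h y) else 0)) + 
       ∑ x ∈ Finset.Icc 1 M, ∑ y ∈ Finset.Icc 1 M,
      (if x = y + i then k x y * ((F x - h x) * (F y - h y)) else 0) := by
      rw [← Finset.sum_add_distrib]
      refine Finset.sum_congr rfl fun x hx => ?_
      rw [← Finset.sum_add_distrib]
      refine Finset.sum_congr rfl fun y hy => ?_
      split_ifs
      · ring
      · simp
    have e2 : ∑ y ∈ Finset.Icc 1 M, k i y * (h i * F y) ≤ ∑ y ∈ Finset.Icc 1 M, k i y * (F i * F y) := by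
      refine Finset.sum_le_sum fun y hy => ?_
      have hy1 := (Finset.mem_Icc.1 hy).1
      exact mul_le_mul_of_nonneg_left (mul_le_mul_of_nonneg_right (hhF i hi1) (hF0 y hy1)) (hk0 _ _ hi1 hy1)
    have e3 := hE' i hi
    have e4 := hτ' i hi
    rw [e1]
    linarith
  · rw [Finset.sum_add_distrib, Finset.sum_sub_distrib, Finset.sum_add_distrib]
    have := rbk_alg1 M k F h hk0 hks hh0 hF0
    linarith

lemma rbk_deriv_finite {K : ℝ → ℝ → ℝ} {ε N : ℝ} {F : ℕ → ℝ → ℝ} (hF : RSol K ε N F)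
    (hK_symm : ∀ x y : ℝ, 0 < x → 0 < y → K x y = K y x)
    (hK_nonneg : ∀ x y : ℝ, 0 < x → 0 < y → 0 ≤ K x y)
    (hε : 0 < ε) {κ X : ℝ} (hκ : 0 < κ)
    (hX : ∀ x y : ℝ, X ≤ x → 0 < y → y ≤ x → K x y ≤ κ * (x * (1 + y)))
    (M : ℕ) (hM : X ≤ ε * M) (s : ℝ) (hs : 0 ≤ s) :
    ∃ d τ τ' : ℕ → ℝ, (∀ i ∈ Finset.Icc 1 M, HasDerivWithinAt (F i) (d i) (Set.Ici s) s) ∧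
      (∀ i ∈ Finset.Icc 1 M, 0 ≤ τ i) ∧ (∀ i ∈ Finset.Icc 1 M, 0 ≤ τ' i) ∧
      ∑ i ∈ Finset.Icc 1 M, τ i ≤ κ * (N * (2 * N)) ∧
      ∑ i ∈ Finset.Icc 1 M, τ' i ≤ κ * (N * (2 * N)) ∧
      ∀ i ∈ Finset.Icc 1 M, d i =
        (∑ x ∈ Finset.Icc 1 M, ∑ y ∈ Finset.Icc 1 M,
          (if x = y + i then K (ε * (x:ℝ)) (ε * (y:ℝ)) * (F x s * F y s) else 0))
        - (∑ y ∈ Finset.Icc 1 M, K (ε * (i:ℝ)) (ε * (y:ℝ)) * (F i s * F y s)) + τ i - τ' i := by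
  have hpos : ∀ x : ℕ, 1 ≤ x → 0 < ε * (x:ℝ) := fun x hx => mul_pos hε (by exact_mod_cast hx)
  choose! G Lo hG hLo hd using fun i (hi : 1 ≤ i) => hF.der i hi s hs
  obtain ⟨τ, τ', h1, h2, h3, h4, h5⟩ := rbk_finite_form M
    (fun x y => K (ε * (x:ℝ)) (ε * (y:ℝ)) * (F x s * F y s)) (κ * (N * (2 * N)))
    (fun x y hx hy => mul_nonneg (hK_nonneg _ _ (hpos x hx) (hpos y hy))
      (mul_nonneg (hF.nonneg x hx s hs) (hF.nonneg y hy s hs)))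
    (fun x y hx hy => by
      rw [hK_symm _ _ (hpos x hx) (hpos y hy)]; ring)
    (fun L => by
      refine le_trans ?_ (rbk_tail_sum hF hε hκ hX s hs L)
      refine Finset.sum_le_sum fun x hx => Finset.sum_le_sum fun y hy => ?_
      rw [Finset.mem_Icc] at hx hy
      by_cases h : M < x ∧ y ≤ x
      · have : X ≤ ε * (x:ℝ) := hM.trans (by
          have : (M:ℝ) ≤ x := by exact_mod_cast h.1.le
          gcongr)
        rw [if_pos h, if_pos ⟨this, h.2⟩]
      · rw [if_neg h]
        split_ifs
        · exact mul_nonneg (hK_nonneg _ _ (hpos x hx.1) (hpos y hy.1))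
            (mul_nonneg (hF.nonneg x hx.1 s hs) (hF.nonneg y hy.1 s hs))
        · exact le_rfl)
    G Lo (fun i hi => hG i (Finset.mem_Icc.1 hi).1) (fun i hi => hLo i (Finset.mem_Icc.1 hi).1)
  refine ⟨fun i => G i - Lo i, τ, τ', ?_, h1, h2, h3, h4, h5⟩
  intro i hi
  exact (hd i (Finset.mem_Icc.1 hi).1).mono (Set.Ici_subset_Ici.2 hs)

lemma rbk_static1 (M : ℕ) (k : ℕ → ℕ → ℝ) (F : ℕ → ℝ) (ε N C η R a : ℝ) (hε : 0 < ε)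
    (hC : 0 ≤ C) (ha : 0 ≤ a)
    (hF0 : ∀ x, 1 ≤ x → 0 ≤ F x) (hFN : ∑ x ∈ Finset.Icc 1 M, F x ≤ N)
    (hk0 : ∀ x y, 1 ≤ x → 1 ≤ y → 0 ≤ k x y)
    (hkC : ∀ x y : ℕ, 1 ≤ x → 1 ≤ y → η ≤ ε * x → ε * x ≤ R → η ≤ ε * y → ε * y ≤ R → k x y ≤ C)
    (h E : ℕ → ℝ) (hh : ∀ i, h i = max (F i - E i) 0)
    (hE : ∀ i : ℕ, E i = if η ≤ ε * i ∧ ε * i ≤ R then ε * a else 0) :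
    ∀ i ∈ Finset.Icc 1 M, ∑ x ∈ Finset.Icc 1 M, ∑ y ∈ Finset.Icc 1 M,
      (if x = y + i then k x y * ((F x - h x) * (F y - h y)) else 0) ≤ C * N * E i +
      (if ε * (i:ℝ) < η then ∑ x ∈ Finset.Icc 1 M, ∑ y ∈ Finset.Icc 1 M,
      (if x = y + i then k x y * ((F x - h x) * (F y - h y)) else 0) else 0) := by
  intro i hi
  have hN : 0 ≤ N := le_trans (Finset.sum_nonneg fun x hx => hF0 x (Finset.mem_Icc.1 hx).1) hFN
  have hE0 : ∀ x, 0 ≤ E x := fun x => by rw [hE]; split_ifs <;> positivity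
  have hg0 : ∀ x, 1 ≤ x → 0 ≤ F x - h x := fun x hx => by
    rw [hh, sub_nonneg]; exact max_le (by linarith [hE0 x]) (hF0 x hx)
  have hgE : ∀ x, F x - h x ≤ E x := fun x => by
    rw [hh]; linarith [le_max_left (F x - E x) 0]
  have hgF : ∀ x, F x - h x ≤ F x := fun x => by
    rw [hh]; linarith [le_max_right (F x - E x) 0]
  have hgz : ∀ x : ℕ, 1 ≤ x → ¬ (η ≤ ε * x ∧ ε * x ≤ R) → F x - h x = 0 := fun x hx hn => by
    have h1 := hgE x
    rw [hE, if_neg hn] at h1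
    exact le_antisymm h1 (hg0 x hx)
  by_cases hP : ε * (i:ℝ) < η
  · rw [if_pos hP]
    have : 0 ≤ C * N * E i := mul_nonneg (mul_nonneg hC hN) (hE0 i)
    linarith
  · rw [if_neg hP, add_zero]
    push Not at hP
    by_cases hR : ε * (i:ℝ) ≤ R
    · have hEi : E i = ε * a := by rw [hE, if_pos ⟨hP, hR⟩]
      rw [hEi]
      refine (rbk_pair_y M i _ F (C * (ε * a)) (by positivity)
        (fun y hy => hF0 y (Finset.mem_Icc.1 hy).1) ?_).trans ?_
      · intro x hx y hy hxy
        rw [Finset.mem_Icc] at hx hy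
        by_cases hnx : η ≤ ε * (x:ℝ) ∧ ε * (x:ℝ) ≤ R
        · by_cases hny : η ≤ ε * (y:ℝ) ∧ ε * (y:ℝ) ≤ R
          · have h1 := hkC x y hx.1 hy.1 hnx.1 hnx.2 hny.1 hny.2
            have h2 := hgE x
            rw [hE, if_pos hnx] at h2
            calc k x y * ((F x - h x) * (F y - h y)) ≤ C * ((ε * a) * F y) := by
                  refine mul_le_mul h1 (mul_le_mul h2 (hgF y) (hg0 y hy.1) (by positivity))
                    (mul_nonneg (hg0 x hx.1) (hg0 y hy.1)) hC
              _ = C * (ε * a) * F y := by ring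
          · rw [hgz y hy.1 hny]
            have := hF0 y hy.1
            simp only [mul_zero]; positivity
        · rw [hgz x hx.1 hnx]
          have := hF0 y hy.1
          simp only [zero_mul, mul_zero]; positivity
      · calc C * (ε * a) * ∑ y ∈ Finset.Icc 1 M, F y ≤ C * (ε * a) * N := by gcongr
          _ = C * N * (ε * a) := by ring
    · have : ∑ x ∈ Finset.Icc 1 M, ∑ y ∈ Finset.Icc 1 M,
          (if x = y + i then k x y * ((F x - h x) * (F y - h y)) else 0) = 0 := by
        refine Finset.sum_eq_zero fun x hx => Finset.sum_eq_zero fun y hy => ?_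
        rw [Finset.mem_Icc] at hx hy
        split_ifs with hxy
        · rw [hgz x hx.1]
          · simp
          · rintro ⟨_, h2⟩
            apply hR
            refine le_trans ?_ h2
            have : (i:ℝ) ≤ x := by exact_mod_cast (by omega : i ≤ x)
            gcongr
        · rfl
      rw [this]
      exact mul_nonneg (mul_nonneg hC hN) (hE0 i)

lemma rbk_static2 (M : ℕ) (k : ℕ → ℕ → ℝ) (F : ℕ → ℝ) (ε N C η η' R a : ℝ) (hε : 0 < ε)
    (hC : 0 ≤ C) (ha : 0 ≤ a) (hη : 0 < η) (hηη' : η ≤ η' / 2)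
    (hF0 : ∀ x, 1 ≤ x → 0 ≤ F x) (hFN : ∑ x ∈ Finset.Icc 1 M, F x ≤ N)
    (hk0 : ∀ x y, 1 ≤ x → 1 ≤ y → 0 ≤ k x y)
    (hkC : ∀ x y : ℕ, 1 ≤ x → 1 ≤ y → η'/2 ≤ ε * x → ε * x ≤ R → η'/2 ≤ ε * y → ε * y ≤ R →
      k x y ≤ C)
    (g gp : ℕ → ℝ) (hg0 : ∀ x, 1 ≤ x → 0 ≤ g x) (hgF : ∀ x, 1 ≤ x → g x ≤ F x)
    (hgR : ∀ x : ℕ, 1 ≤ x → R < ε * x → g x = 0)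
    (hgp0 : ∀ x, 1 ≤ x → 0 ≤ gp x) (hgpa : ∀ x, 1 ≤ x → gp x ≤ ε * a)
    (hgpz : ∀ x : ℕ, 1 ≤ x → ¬ (η' ≤ ε * x ∧ ε * x ≤ R) → gp x = 0) :
    ∑ i ∈ Finset.Icc 1 M, (if ε * (i:ℝ) < η then ∑ x ∈ Finset.Icc 1 M, ∑ y ∈ Finset.Icc 1 M,
      (if x = y + i then k x y * (gp x * g y + g x * gp y) else 0)
      else 0) ≤ 2 * C * N * a * η := by
  have hN : 0 ≤ N := le_trans (Finset.sum_nonneg fun x hx => hF0 x (Finset.mem_Icc.1 hx).1) hFN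
  have key : ∀ i ∈ Finset.Icc 1 M, ε * (i:ℝ) < η → ∑ x ∈ Finset.Icc 1 M, ∑ y ∈ Finset.Icc 1 M,
      (if x = y + i then k x y * (gp x * g y + g x * gp y) else 0) ≤ 2 * C * N * a * ε := by
    intro i hi hiη
    have e0 : ∑ x ∈ Finset.Icc 1 M, ∑ y ∈ Finset.Icc 1 M,
      (if x = y + i then k x y * (gp x * g y + g x * gp y) else 0) =
      ∑ x ∈ Finset.Icc 1 M, ∑ y ∈ Finset.Icc 1 M,
      (if x = y + i then k x y * (gp x * g y) else 0) +
      ∑ x ∈ Finset.Icc 1 M, ∑ y ∈ Finset.Icc 1 M,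
      (if x = y + i then k x y * (g x * gp y) else 0) := by
      rw [← Finset.sum_add_distrib]
      refine Finset.sum_congr rfl fun x hx => ?_
      rw [← Finset.sum_add_distrib]
      refine Finset.sum_congr rfl fun y hy => ?_
      split_ifs
      · ring
      · simp
    have hxyr : ∀ x y : ℕ, x = y + i → ε * (x:ℝ) = ε * y + ε * i := by
      rintro x y rfl; push_cast; ring
    have hi0 : 0 ≤ ε * (i:ℝ) := by positivity
    have e1 : ∑ x ∈ Finset.Icc 1 M, ∑ y ∈ Finset.Icc 1 M,
      (if x = y + i then k x y * (gp x * g y) else 0) ≤ C * (ε * a) * ∑ y ∈ Finset.Icc 1 M, F y := by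
      refine rbk_pair_y M i _ F (C * (ε * a)) (by positivity)
        (fun y hy => hF0 y (Finset.mem_Icc.1 hy).1) ?_
      intro x hx y hy hxy
      rw [Finset.mem_Icc] at hx hy
      have hF := hF0 y hy.1
      by_cases hnx : η' ≤ ε * (x:ℝ) ∧ ε * (x:ℝ) ≤ R
      · have hr := hxyr x y hxy
        have h1 := hkC x y hx.1 hy.1 (by linarith [hnx.1]) hnx.2 (by linarith [hnx.1]) (by linarith [hnx.2])
        calc k x y * (gp x * g y) ≤ C * ((ε * a) * F y) := by
              refine mul_le_mul h1 (mul_le_mul (hgpa x hx.1) (hgF y hy.1) (hg0 y hy.1) (by positivity))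
                    (mul_nonneg (hgp0 x hx.1) (hg0 y hy.1)) hC
          _ = C * (ε * a) * F y := by ring
      · rw [hgpz x hx.1 hnx]
        simp only [zero_mul, mul_zero]; positivity
    have e2 : ∑ x ∈ Finset.Icc 1 M, ∑ y ∈ Finset.Icc 1 M,
      (if x = y + i then k x y * (g x * gp y) else 0) ≤ C * (ε * a) * ∑ y ∈ Finset.Icc 1 M, F y := by
      refine rbk_pair_x M i _ F (C * (ε * a)) (by positivity)
        (fun y hy => hF0 y (Finset.mem_Icc.1 hy).1) ?_
      intro x hx y hy hxy
      rw [Finset.mem_Icc] at hx hy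
      have hF := hF0 x hx.1
      by_cases hny : η' ≤ ε * (y:ℝ) ∧ ε * (y:ℝ) ≤ R
      · by_cases hxR : R < ε * (x:ℝ)
        · rw [hgR x hx.1 hxR]
          simp only [zero_mul, mul_zero]; positivity
        · push Not at hxR
          have hr := hxyr x y hxy
          have h1 := hkC x y hx.1 hy.1 (by linarith [hny.1]) hxR (by linarith [hny.1]) hny.2
          calc k x y * (g x * gp y) ≤ C * (F x * (ε * a)) := by
                refine mul_le_mul h1 (mul_le_mul (hgF x hx.1) (hgpa y hy.1) (hgp0 y hy.1) hF)
                    (mul_nonneg (hg0 x hx.1) (hgp0 y hy.1)) hC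
            _ = C * (ε * a) * F x := by ring
      · rw [hgpz y hy.1 hny]
        simp only [mul_zero]; positivity
    rw [e0]
    have e3 : C * (ε * a) * ∑ y ∈ Finset.Icc 1 M, F y ≤ C * (ε * a) * N := by gcongr
    calc _ ≤ C * (ε * a) * N + C * (ε * a) * N := by linarith
      _ = 2 * C * N * a * ε := by ring
  calc _ ≤ ∑ i ∈ Finset.Icc 1 M, 2 * C * N * a * (if ε * (i:ℝ) < η then ε else 0) := by
        refine Finset.sum_le_sum fun i hi => ?_
        split_ifs with hP
        · exact key i hi hP
        · simp
    _ = 2 * C * N * a * ∑ i ∈ Finset.Icc 1 M, (if ε * (i:ℝ) < η then ε else 0) := by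
        rw [Finset.mul_sum]
    _ ≤ 2 * C * N * a * η := by
        refine mul_le_mul_of_nonneg_left (rbk_count M ε η hε hη.le) (by positivity)

noncomputable def rbkE (ε N R b C η : ℝ) (i : ℕ) (s : ℝ) : ℝ :=
  if η ≤ ε * (i:ℝ) ∧ ε * (i:ℝ) ≤ R then ε * (b * Real.exp (C * N * s)) else 0

noncomputable def rbkh (ε N R b C η : ℝ) (F : ℕ → ℝ → ℝ) (i : ℕ) (s : ℝ) : ℝ :=
  max (F i s - rbkE ε N R b C η i s) 0

lemma rbkE_nonneg {ε N R b C η : ℝ} (hε : 0 < ε) (hb : 0 ≤ b) (i : ℕ) (s : ℝ) :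
    0 ≤ rbkE ε N R b C η i s := by
  unfold rbkE; split_ifs <;> positivity

lemma rbkE_deriv {ε N R b C η : ℝ} (i : ℕ) (s : ℝ) :
    HasDerivAt (rbkE ε N R b C η i) (C * N * rbkE ε N R b C η i s) s := by
  have h1 : HasDerivAt (fun s : ℝ => C * N * s) (C * N) s := by
    simpa using (hasDerivAt_id s).const_mul (C * N)
  have h2 := (h1.exp.const_mul b).const_mul ε
  by_cases hc : η ≤ ε * (i:ℝ) ∧ ε * (i:ℝ) ≤ R
  · have e : rbkE ε N R b C η i = fun s => ε * (b * Real.exp (C * N * s)) := by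
      funext s; simp only [rbkE, if_pos hc]
    rw [e]
    exact h2.congr_deriv (by ring)
  · have e : rbkE ε N R b C η i = fun s => 0 := by
      funext s; simp only [rbkE, if_neg hc]
    rw [e]
    exact (hasDerivAt_const s (0:ℝ)).congr_deriv (by ring)

lemma rbk_level {K : ℝ → ℝ → ℝ} {ε N : ℝ} {F : ℕ → ℝ → ℝ} (hF : RSol K ε N F)
    (hK_symm : ∀ x y : ℝ, 0 < x → 0 < y → K x y = K y x)
    (hK_nonneg : ∀ x y : ℝ, 0 < x → 0 < y → 0 ≤ K x y)
    (hε : 0 < ε) {κ X : ℝ} (hκ : 0 < κ)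
    (hX : ∀ x y : ℝ, X ≤ x → 0 < y → y ≤ x → K x y ≤ κ * (x * (1 + y)))
    (M : ℕ) (hM : X ≤ ε * M) (s : ℝ) (hs : 0 ≤ s) (R b C η : ℝ) (hb : 0 ≤ b) (hC : 0 ≤ C)
    (hKC : ∀ x y : ℝ, η ≤ x → x ≤ R → η ≤ y → y ≤ R → K x y ≤ C) :
    ∃ D' : ℝ, HasDerivWithinAt
      (fun s => ∑ i ∈ Finset.Icc 1 M, rbkh ε N R b C η F i s) D' (Set.Ici s) s ∧
      D' ≤ - rbkD M (fun x y => K (ε * (x:ℝ)) (ε * (y:ℝ))) (fun i => rbkh ε N R b C η F i s)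
        + κ * (N * (2 * N)) +
        ∑ i ∈ Finset.Icc 1 M, (if ε * (i:ℝ) < η then
          ∑ x ∈ Finset.Icc 1 M, ∑ y ∈ Finset.Icc 1 M,
          (if x = y + i then K (ε * (x:ℝ)) (ε * (y:ℝ)) *
            ((F x s - rbkh ε N R b C η F x s) * (F y s - rbkh ε N R b C η F y s)) else 0) else 0) := by
  have hpos : ∀ x : ℕ, 1 ≤ x → 0 < ε * (x:ℝ) := fun x hx => mul_pos hε (by exact_mod_cast hx)
  obtain ⟨d, τ, τ', hd, h1, h2, h3, h4, h5⟩ :=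
    rbk_deriv_finite hF hK_symm hK_nonneg hε hκ hX M hM s hs
  have hst := rbk_static1 M (fun x y => K (ε * (x:ℝ)) (ε * (y:ℝ))) (fun i => F i s) ε N C η R
    (b * Real.exp (C * N * s)) hε hC (by positivity) (fun x hx => hF.nonneg x hx s hs)
    (hF.num s hs M) (fun x y hx hy => hK_nonneg _ _ (hpos x hx) (hpos y hy))
    (fun x y _ _ a1 a2 a3 a4 => hKC _ _ a1 a2 a3 a4)
    (fun i => rbkh ε N R b C η F i s) (fun i => rbkE ε N R b C η i s) (fun i => rfl) (fun i => rfl)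
  obtain ⟨B, hB1, hB2, hB3⟩ := rbk_step M (fun x y => K (ε * (x:ℝ)) (ε * (y:ℝ))) (fun i => F i s)
    (fun i => rbkE ε N R b C η i s) (fun i => C * N * rbkE ε N R b C η i s) d τ τ'
    (fun i => ε * (i:ℝ) < η) (κ * (N * (2 * N)))
    (fun x y hx hy => hK_nonneg _ _ (hpos x hx) (hpos y hy))
    (fun x y hx hy => hK_symm _ _ (hpos x hx) (hpos y hy)) (fun x hx => hF.nonneg x hx s hs)
    (fun x _ => rbkE_nonneg hε hb x s) h1 h2 h3 h5 (fun i => rbkh ε N R b C η F i s)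
    (fun i => rfl) hst
  have key : ∀ i ∈ Finset.Icc 1 M, ∃ d', HasDerivWithinAt
      (fun s => rbkh ε N R b C η F i s) d' (Set.Ici s) s ∧ d' ≤ B i := by
    intro i hi
    exact rbk_posPart_deriv ((hd i hi).sub (rbkE_deriv i s).hasDerivWithinAt) (hB1 i hi) (hB2 i hi)
  choose! d' hd' hd'B using key
  refine ⟨∑ i ∈ Finset.Icc 1 M, d' i, HasDerivWithinAt.fun_sum hd', ?_⟩
  exact (Finset.sum_le_sum hd'B).trans hB3

lemma rbk_seq {K : ℝ → ℝ → ℝ}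
    (hK_cont : ContinuousOn (fun p : ℝ × ℝ => K p.1 p.2) (Set.Ioi 0 ×ˢ Set.Ioi 0))
    (N T k0 e : ℝ) (hN : 0 ≤ N) (hk0 : 1 ≤ k0) (he : 0 < e) :
    ∃ η C : ℕ → ℝ, (∀ q, 0 < η q) ∧ (∀ q, η q ≤ 1 / k0) ∧ (∀ q, 0 ≤ C q) ∧
      (∀ q, ∀ x y : ℝ, η q / 2 ≤ x → x ≤ k0 → η q / 2 ≤ y → y ≤ k0 → K x y ≤ C q) ∧
      (∀ q, η (q+1) ≤ η q / 2) ∧ (∀ q, C q ≤ C (q+1)) ∧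
      (∀ q, 2 * C q * N * (k0 * Real.exp (C q * N * T)) * η (q+1) ≤ e) := by
  let S : ℝ × ℝ → Prop := fun p => 0 < p.1 ∧ p.1 ≤ 1 / k0 ∧ 0 ≤ p.2 ∧
    ∀ x y : ℝ, p.1 / 2 ≤ x → x ≤ k0 → p.1 / 2 ≤ y → y ≤ k0 → K x y ≤ p.2
  have h0 : ∃ p, S p := by
    have hp : (0:ℝ) < 1 / k0 := by positivity
    obtain ⟨C, hC, hC'⟩ := rbk_kernel_loc K hK_cont (1 / k0 / 2) k0 (by positivity)
    exact ⟨(1 / k0, C), hp, le_rfl, hC, hC'⟩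
  have hstep : ∀ p : {p // S p}, ∃ p' : {p // S p}, p'.1.1 ≤ p.1.1 / 2 ∧ p.1.2 ≤ p'.1.2 ∧
      2 * p.1.2 * N * (k0 * Real.exp (p.1.2 * N * T)) * p'.1.1 ≤ e := by
    rintro ⟨⟨η, C⟩, h1, h2, h3, h4⟩
    simp only at h1 h2 h3 h4 ⊢
    set Q := 2 * C * N * (k0 * Real.exp (C * N * T)) with hQ
    have hQ0 : 0 ≤ Q := by positivity
    let η' := min (η / 2) (e / (Q + 1))
    have hη' : 0 < η' := lt_min (by positivity) (by positivity)
    obtain ⟨C', hC, hC'⟩ := rbk_kernel_loc K hK_cont (η' / 2) k0 (by positivity)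
    refine ⟨⟨(η', max C C'), hη', ?_, h3.trans (le_max_left _ _), ?_⟩, min_le_left _ _,
      le_max_left _ _, ?_⟩
    · exact (min_le_left _ _).trans (by linarith)
    · intro x y a1 a2 a3 a4
      exact (hC' x y a1 a2 a3 a4).trans (le_max_right _ _)
    · calc Q * η' ≤ Q * (e / (Q + 1)) := by gcongr; exact min_le_right _ _
        _ ≤ (Q + 1) * (e / (Q + 1)) := by gcongr; linarith
        _ = e := by field_simp
  choose nx hnx using hstep
  obtain ⟨p0, hp0⟩ := h0
  let sq : ℕ → {p // S p} := fun q => Nat.rec ⟨p0, hp0⟩ (fun _ p => nx p) q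
  have hsq : ∀ q, sq (q+1) = nx (sq q) := fun q => rfl
  refine ⟨fun q => (sq q).1.1, fun q => (sq q).1.2, fun q => (sq q).2.1, fun q => (sq q).2.2.1,
    fun q => (sq q).2.2.2.1, fun q => (sq q).2.2.2.2, fun q => ?_, fun q => ?_, fun q => ?_⟩
  · simp only [hsq]; exact (hnx _).1
  · simp only [hsq]; exact (hnx _).2.1
  · simp only [hsq]; exact (hnx _).2.2

lemma rbk_cont {K : ℝ → ℝ → ℝ} {ε N : ℝ} {F : ℕ → ℝ → ℝ} (hF : RSol K ε N F) (i : ℕ) (hi : 1 ≤ i) :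
    ContinuousOn (F i) (Set.Ici 0) := by
  intro t ht
  obtain ⟨G, Lo, _, _, h⟩ := hF.der i hi t ht
  exact h.continuousWithinAt

lemma rbk_UI_core {K : ℝ → ℝ → ℝ} {ε N : ℝ} {F : ℕ → ℝ → ℝ} (hF : RSol K ε N F)
    (hK_symm : ∀ x y : ℝ, 0 < x → 0 < y → K x y = K y x)
    (hK_nonneg : ∀ x y : ℝ, 0 < x → 0 < y → 0 ≤ K x y)
    (hε : 0 < ε) {κ X : ℝ} (hκ : 0 < κ)
    (hX : ∀ x y : ℝ, X ≤ x → 0 < y → y ≤ x → K x y ≤ κ * (x * (1 + y)))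
    (M : ℕ) (hM : X ≤ ε * M) (T k0 e : ℝ) (hT : 0 < T) (hk0 : 1 ≤ k0) (he : 0 < e)
    (hκe : κ * (N * (2 * N)) ≤ e) (η C b : ℕ → ℝ)
    (hη : ∀ q, 0 < η q) (hC : ∀ q, 0 ≤ C q)
    (hKC : ∀ q, ∀ x y : ℝ, η q / 2 ≤ x → x ≤ k0 → η q / 2 ≤ y → y ≤ k0 → K x y ≤ C q)
    (hη2 : ∀ q, η (q+1) ≤ η q / 2) (hCm : ∀ q, C q ≤ C (q+1))
    (hηe : ∀ q, 2 * C q * N * (k0 * Real.exp (C q * N * T)) * η (q+1) ≤ e)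
    (hb : ∀ q, b q = if q = 0 then 0 else k0) (n : ℕ) (t : ℝ) (ht : t ∈ Set.Icc 0 T) :
    ((n:ℝ)+1) * ∑ i ∈ Finset.Icc 1 M, rbkh ε N k0 (b n) (C n) (η n) F i t ≤
      (∑ q ∈ Finset.range (n+1), ∑ i ∈ Finset.Icc 1 M, rbkh ε N k0 (b q) (C q) (η q) F i 0)
      + 2 * e * ((n:ℝ)+1) * t := by
  have hN : 0 ≤ N := by simpa using hF.num 0 le_rfl 0
  have hpos : ∀ x : ℕ, 1 ≤ x → 0 < ε * (x:ℝ) := fun x hx => mul_pos hε (by exact_mod_cast hx)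
  have hb0 : ∀ q, 0 ≤ b q := fun q => by rw [hb]; split_ifs <;> linarith
  have hbk : ∀ q, b q ≤ k0 := fun q => by rw [hb]; split_ifs <;> linarith
  have hbm : ∀ q, b q ≤ b (q+1) := fun q => by rw [hb (q+1)]; simpa using hbk q
  have hKC' : ∀ q, ∀ x y : ℝ, η q ≤ x → x ≤ k0 → η q ≤ y → y ≤ k0 → K x y ≤ C q :=
    fun q x y h1 h2 h3 h4 => hKC q x y (by linarith [hη q]) h2 (by linarith [hη q]) h4
  -- basic facts
  have hEm : ∀ q i s, 0 ≤ s → rbkE ε N k0 (b q) (C q) (η q) i s ≤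
      rbkE ε N k0 (b (q+1)) (C (q+1)) (η (q+1)) i s := by
    intro q i s hs
    by_cases hc : η q ≤ ε * (i:ℝ) ∧ ε * (i:ℝ) ≤ k0
    · have hc' : η (q+1) ≤ ε * (i:ℝ) ∧ ε * (i:ℝ) ≤ k0 := ⟨by linarith [hη2 q, hη q], hc.2⟩
      simp only [rbkE, if_pos hc, if_pos hc']
      have := hb0 q; have := hbm q; have := hCm q; have := hb0 (q+1)
      gcongr
    · have := rbkE_nonneg (N := N) (R := k0) (C := C (q+1)) (η := η (q+1)) hε (hb0 (q+1)) i s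
      simpa only [rbkE, if_neg hc] using this
  have hhm : ∀ q i s, 0 ≤ s → rbkh ε N k0 (b (q+1)) (C (q+1)) (η (q+1)) F i s ≤
      rbkh ε N k0 (b q) (C q) (η q) F i s := by
    intro q i s hs
    exact max_le_max (by linarith [hEm q i s hs]) le_rfl
  have hh0 : ∀ q i s, 0 ≤ rbkh ε N k0 (b q) (C q) (η q) F i s := fun q i s => le_max_right _ _
  have hhF : ∀ q i s, 1 ≤ i → 0 ≤ s → rbkh ε N k0 (b q) (C q) (η q) F i s ≤ F i s := by
    intro q i s hi hs
    exact max_le (by linarith [rbkE_nonneg (N := N) (R := k0) (C := C q) (η := η q) hε (hb0 q) i s])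
      (hF.nonneg i hi s hs)
  have hgE : ∀ q i s, F i s - rbkh ε N k0 (b q) (C q) (η q) F i s ≤
      rbkE ε N k0 (b q) (C q) (η q) i s := by
    intro q i s
    have : F i s - rbkE ε N k0 (b q) (C q) (η q) i s ≤ rbkh ε N k0 (b q) (C q) (η q) F i s :=
      le_max_left _ _
    linarith
  -- derivative bound
  have hder : ∀ s ∈ Set.Ico 0 T, ∃ D' : ℝ, HasDerivWithinAt (fun s => ∑ q ∈ Finset.range (n+1),
      ∑ i ∈ Finset.Icc 1 M, rbkh ε N k0 (b q) (C q) (η q) F i s) D' (Set.Ici s) s ∧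
      D' ≤ 2 * e * ((n:ℝ)+1) := by
    intro s hs
    set k : ℕ → ℕ → ℝ := fun x y => K (ε * (x:ℝ)) (ε * (y:ℝ)) with hk
    set Dq : ℕ → ℝ := fun q => rbkD M k (fun i => rbkh ε N k0 (b q) (C q) (η q) F i s) with hDq
    set Pq : ℕ → ℝ := fun q => ∑ i ∈ Finset.Icc 1 M, (if ε * (i:ℝ) < η q then
          ∑ x ∈ Finset.Icc 1 M, ∑ y ∈ Finset.Icc 1 M,
          (if x = y + i then k x y *
            ((F x s - rbkh ε N k0 (b q) (C q) (η q) F x s) *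
             (F y s - rbkh ε N k0 (b q) (C q) (η q) F y s)) else 0) else 0) with hPq
    have hk00 : ∀ x y : ℕ, 1 ≤ x → 1 ≤ y → 0 ≤ k x y := fun x y hx hy =>
      hK_nonneg _ _ (hpos x hx) (hpos y hy)
    have h1 : ∀ q, ∃ D' : ℝ, HasDerivWithinAt
      (fun s => ∑ i ∈ Finset.Icc 1 M, rbkh ε N k0 (b q) (C q) (η q) F i s) D' (Set.Ici s) s ∧
      D' ≤ - Dq q + κ * (N * (2 * N)) + Pq q := fun q =>
      rbk_level hF hK_symm hK_nonneg hε hκ hX M hM s hs.1 k0 (b q) (C q) (η q) (hb0 q) (hC q) (hKC' q)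
    choose D' hD' hD'' using h1
    refine ⟨∑ q ∈ Finset.range (n+1), D' q, HasDerivWithinAt.fun_sum (fun q _ => hD' q), ?_⟩
    have hP0 : Pq 0 = 0 := by
      simp only [hPq]
      refine Finset.sum_eq_zero fun i hi => ?_
      split_ifs
      · refine Finset.sum_eq_zero fun x hx => Finset.sum_eq_zero fun y hy => ?_
        have : F x s - rbkh ε N k0 (b 0) (C 0) (η 0) F x s = 0 := by
          have hE : rbkE ε N k0 (b 0) (C 0) (η 0) x s = 0 := by
            simp [rbkE, hb 0]
          simp only [rbkh, hE, sub_zero]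
          rw [max_eq_left (hF.nonneg x (Finset.mem_Icc.1 hx).1 s hs.1), sub_self]
        rw [this]; simp
      · rfl
    have hPs : ∀ q, Pq (q+1) ≤ Dq q + e := by
      intro q
      refine rbk_alg2 M k (fun i => F i s)
        (fun i => rbkh ε N k0 (b (q+1)) (C (q+1)) (η (q+1)) F i s)
        (fun i => rbkh ε N k0 (b q) (C q) (η q) F i s) (fun i => ε * (i:ℝ) < η (q+1)) e hk00
        (fun x _ => hh0 _ _ _) (fun x _ => hhm q x s hs.1) (fun x hx => hhF q x s hx hs.1) ?_
      refine le_trans (rbk_static2 M k (fun i => F i s) ε N (C q) (η (q+1)) (η q) k0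
        (k0 * Real.exp (C q * N * T)) hε (hC q) (by positivity) (hη _) (hη2 q)
        (fun x hx => hF.nonneg x hx s hs.1) (hF.num s hs.1 M) hk00
        (fun x y _ _ a1 a2 a3 a4 => hKC q _ _ a1 a2 a3 a4)
        (fun i => F i s - rbkh ε N k0 (b (q+1)) (C (q+1)) (η (q+1)) F i s)
        (fun i => F i s - rbkh ε N k0 (b q) (C q) (η q) F i s)
        (fun x hx => sub_nonneg.2 (hhF _ x s hx hs.1)) (fun x hx => by linarith [hh0 (q+1) x s])
        ?_ (fun x hx => sub_nonneg.2 (hhF _ x s hx hs.1)) ?_ ?_) (hηe q)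
      · intro x hx hxR
        refine le_antisymm ?_ (sub_nonneg.2 (hhF _ x s hx hs.1))
        have := hgE (q+1) x s
        simp only [rbkE, if_neg (fun h : η (q+1) ≤ ε * (x:ℝ) ∧ ε * (x:ℝ) ≤ k0 => not_lt.2 h.2 hxR)] at this
        exact this
      · intro x hx
        refine (hgE q x s).trans ?_
        unfold rbkE
        have hsT := hs.2.le
        have := hC q; have := hbk q; have := hb0 q
        split_ifs
        · gcongr
        · positivity
      · intro x hx hxn
        refine le_antisymm ?_ (sub_nonneg.2 (hhF _ x s hx hs.1))
        have := hgE q x s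
        simp only [rbkE, if_neg hxn] at this
        exact this
    have hDn : ∀ q, 0 ≤ Dq q := by
      intro q
      simp only [hDq, rbkD]
      refine Finset.sum_nonneg fun x hx => Finset.sum_nonneg fun y hy => ?_
      split_ifs
      · exact mul_nonneg (hk00 _ _ (Finset.mem_Icc.1 hx).1 (Finset.mem_Icc.1 hy).1)
          (mul_nonneg (hh0 _ _ _) (hh0 _ _ _))
      · exact le_rfl
    have hind : ∀ m : ℕ, ∑ q ∈ Finset.range (m+1), D' q ≤ 2 * e * ((m:ℝ)+1) - Dq m := by
      intro m
      induction m with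
      | zero =>
        have := hD'' 0
        rw [hP0] at this
        simp only [zero_add, Finset.range_one, Finset.sum_singleton, Nat.cast_zero]
        linarith
      | succ m ih =>
        rw [Finset.sum_range_succ]
        have := hD'' (m+1)
        have := hPs m
        push_cast
        linarith
    linarith [hind n, hDn n]
  choose! D' hD' hDb using hder
  have hcont : ContinuousOn (fun s => ∑ q ∈ Finset.range (n+1),
      ∑ i ∈ Finset.Icc 1 M, rbkh ε N k0 (b q) (C q) (η q) F i s) (Set.Icc 0 T) := by
    refine continuousOn_finsetSum _ fun q _ => continuousOn_finsetSum _ fun i hi => ?_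
    have h1 := (rbk_cont hF i (Finset.mem_Icc.1 hi).1).mono
      (fun x (hx : x ∈ Set.Icc 0 T) => (hx.1 : x ∈ Set.Ici 0))
    have h2 : Continuous (rbkE ε N k0 (b q) (C q) (η q) i) :=
      continuous_iff_continuousAt.2 fun s => (rbkE_deriv i s).continuousAt
    exact ContinuousOn.sup (h1.sub h2.continuousOn) continuousOn_const
  have hfin := image_le_of_deriv_right_le_deriv_boundary hcont hD'
    (B := fun s => (∑ q ∈ Finset.range (n+1), ∑ i ∈ Finset.Icc 1 M,
      rbkh ε N k0 (b q) (C q) (η q) F i 0) + 2 * e * ((n:ℝ)+1) * s)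
    (B' := fun _ => 2 * e * ((n:ℝ)+1)) (by simp) (by fun_prop)
    (fun x _ => by
      simpa using (((hasDerivAt_id x).const_mul (2 * e * ((n:ℝ)+1))).const_add
        (∑ q ∈ Finset.range (n+1), ∑ i ∈ Finset.Icc 1 M,
          rbkh ε N k0 (b q) (C q) (η q) F i 0)).hasDerivWithinAt) hDb ht
  refine le_trans ?_ hfin
  have hmono : ∀ m q : ℕ, q ≤ m → ∀ i, rbkh ε N k0 (b m) (C m) (η m) F i t ≤
      rbkh ε N k0 (b q) (C q) (η q) F i t := by
    intro m q hqm i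
    induction m, hqm using Nat.le_induction with
    | base => exact le_rfl
    | succ m _ ih => exact (hhm m i t ht.1).trans ih
  calc ((n:ℝ)+1) * ∑ i ∈ Finset.Icc 1 M, rbkh ε N k0 (b n) (C n) (η n) F i t
      = ∑ q ∈ Finset.range (n+1), ∑ i ∈ Finset.Icc 1 M, rbkh ε N k0 (b n) (C n) (η n) F i t := by
        rw [Finset.sum_const, Finset.card_range, nsmul_eq_mul]; push_cast; ring
    _ ≤ _ := Finset.sum_le_sum fun q hq => Finset.sum_le_sum fun i _ =>
        hmono n q (by simpa [Nat.lt_succ_iff] using hq) i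

/-- Uniform integrability, uniformly in ε and t. -/
theorem rbk_UI {K : ℝ → ℝ → ℝ} {N : ℝ} {F : ℝ → ℕ → ℝ → ℝ}
    (hF : ∀ ε, 0 < ε → ε < 1 → RSol K ε N (F ε))
    (hK_cont : ContinuousOn (fun p : ℝ × ℝ => K p.1 p.2) (Set.Ioi 0 ×ˢ Set.Ioi 0))
    (hK_symm : ∀ x y : ℝ, 0 < x → 0 < y → K x y = K y x)
    (hK_nonneg : ∀ x y : ℝ, 0 < x → 0 < y → 0 ≤ K x y)
    (htail : ∀ κ : ℝ, 0 < κ → ∃ X : ℝ, 1 ≤ X ∧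
      ∀ x y : ℝ, X ≤ x → 0 < y → y ≤ x → K x y ≤ κ * (x * (1 + y)))
    (hinit : ∀ κ : ℝ, 0 < κ → ∃ k0 : ℝ, 1 ≤ k0 ∧ ∀ η, 0 < η → η ≤ 1 / k0 → ∀ ε, 0 < ε → ε < 1 →
      ∀ M : ℕ, ∑ i ∈ Finset.Icc 1 M,
        max (F ε i 0 - (if η ≤ ε * (i:ℝ) ∧ ε * (i:ℝ) ≤ k0 then ε * k0 else 0)) 0 ≤ κ)
    (T : ℝ) (hT : 0 < T) (δ : ℝ) (hδ : 0 < δ) :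
    ∃ A R : ℝ, 0 ≤ A ∧ 0 ≤ R ∧ ∀ ε, 0 < ε → ε < 1 → ∀ t ∈ Set.Icc 0 T, ∀ m : ℕ,
      ∑ i ∈ Finset.Icc 1 m, max (F ε i t - (if ε * (i:ℝ) ≤ R then ε * A else 0)) 0 ≤ δ := by
  have hN : 0 ≤ N := by simpa using (hF (1/2) (by norm_num) (by norm_num)).num 0 le_rfl 0
  obtain ⟨n, hn⟩ := exists_nat_gt (N / (δ / 3))
  obtain ⟨k0, hk0, hinit⟩ := hinit (δ / 3) (by positivity)
  set e := δ / (6 * T) with he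
  have he0 : 0 < e := by positivity
  obtain ⟨η, C, hη, hηk, hC, hKC, hη2, hCm, hηe⟩ := rbk_seq hK_cont N T k0 e hN hk0 he0
  let b : ℕ → ℝ := fun q => if q = 0 then 0 else k0
  obtain ⟨X, hX1, hX⟩ := htail (e / (N * (2 * N) + 1)) (by positivity)
  refine ⟨k0 * Real.exp (C n * N * T), k0, by positivity, by positivity, ?_⟩
  intro ε hε hε1 t ht m
  obtain ⟨M0, hM0⟩ := exists_nat_gt (X / ε)
  have hM : X ≤ ε * ((max m M0 : ℕ):ℝ) := by
    rw [div_lt_iff₀ hε] at hM0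
    have : (M0:ℝ) ≤ ((max m M0 : ℕ):ℝ) := by exact_mod_cast le_max_right _ _
    nlinarith
  have hn1 : (0:ℝ) < (n:ℝ) + 1 := by positivity
  have core := rbk_UI_core (hF ε hε hε1) hK_symm hK_nonneg hε (by positivity) hX (max m M0) hM T k0 e hT
    hk0 he0 (by
      rw [div_mul_eq_mul_div, div_le_iff₀ (by positivity)]
      nlinarith) η C b hη hC hKC hη2 hCm hηe (fun q => rfl) n t ht
  have hE0 : ∀ q i, rbkE ε N k0 (b (q+1)) (C (q+1)) (η (q+1)) i 0 =
      (if η (q+1) ≤ ε * (i:ℝ) ∧ ε * (i:ℝ) ≤ k0 then ε * k0 else 0) := by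
    intro q i; simp [rbkE, b]
  have hinit0 : (∑ q ∈ Finset.range (n+1), ∑ i ∈ Finset.Icc 1 (max m M0),
      rbkh ε N k0 (b q) (C q) (η q) (F ε) i 0) ≤ N + (n:ℝ) * (δ / 3) := by
    rw [Finset.sum_range_succ', add_comm]
    refine add_le_add ?_ ?_
    · refine le_trans (Finset.sum_le_sum fun i hi => ?_) ((hF ε hε hε1).num 0 le_rfl (max m M0))
      refine max_le ?_ ((hF ε hε hε1).nonneg i (Finset.mem_Icc.1 hi).1 0 le_rfl)
      simp [rbkE, b]
    · calc _ ≤ ∑ q ∈ Finset.range n, δ / 3 := by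
            refine Finset.sum_le_sum fun q _ => ?_
            refine le_trans (le_of_eq ?_) (hinit (η (q+1)) (hη _) (hηk _) ε hε hε1 (max m M0))
            refine Finset.sum_congr rfl fun i _ => ?_
            rw [rbkh, hE0]
        _ = _ := by simp
  have hbig : ∑ i ∈ Finset.Icc 1 (max m M0), rbkh ε N k0 (b n) (C n) (η n) (F ε) i t ≤ δ := by
    have h2 : 2 * e * ((n:ℝ)+1) * t ≤ ((n:ℝ)+1) * (δ / 3) := by
      have : 2 * e * t ≤ δ / 3 := by
        calc 2 * e * t ≤ 2 * e * T := by have := ht.2; gcongr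
          _ = δ / 3 := by rw [he]; field_simp; norm_num
      nlinarith
    rw [div_lt_iff₀ (by positivity)] at hn
    have h3 : ((n:ℝ)+1) * ∑ i ∈ Finset.Icc 1 (max m M0), rbkh ε N k0 (b n) (C n) (η n) (F ε) i t
        ≤ ((n:ℝ)+1) * δ := by nlinarith
    exact le_of_mul_le_mul_left h3 hn1
  refine le_trans ?_ hbig
  refine le_trans (Finset.sum_le_sum (g := fun i => rbkh ε N k0 (b n) (C n) (η n) (F ε) i t) fun i hi => ?_)
    (Finset.sum_le_sum_of_subset_of_nonneg (Finset.Icc_subset_Icc le_rfl (le_max_left _ _))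
      fun i _ _ => le_max_right _ _)
  refine max_le_max ?_ le_rfl
  refine sub_le_sub le_rfl ?_
  unfold rbkE
  have hb : b n ≤ k0 := by simp only [b]; split_ifs <;> linarith
  have hb0 : 0 ≤ b n := by simp only [b]; split_ifs <;> linarith
  have := ht.2; have := hC n
  by_cases hc : ε * (i:ℝ) ≤ k0
  · rw [if_pos hc]
    split_ifs
    · gcongr
    · positivity
  · rw [if_neg hc, if_neg (fun h => hc h.2)]

noncomputable def rbkψ (σ ε : ℝ) (i : ℕ) : ℝ :=
  (if ε * (i:ℝ) < σ then 1 else 0) + (if ε * (i:ℝ) < 2 * σ then 1 else 0)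

lemma rbk_EC_alg (M : ℕ) (k : ℕ → ℕ → ℝ) (F w : ℕ → ℝ) (Tx : ℕ → ℕ → ℝ) (C N κ ε σ : ℝ)
    (hC : 0 ≤ C)
    (hk0 : ∀ x y, 1 ≤ x → 1 ≤ y → 0 ≤ k x y)
    (hks : ∀ x y, 1 ≤ x → 1 ≤ y → k x y = k y x)
    (hF0 : ∀ x, 1 ≤ x → 0 ≤ F x) (hFN : ∑ x ∈ Finset.Icc 1 M, F x ≤ N)
    (hT0 : ∀ x y, 1 ≤ x → 1 ≤ y → 0 ≤ Tx x y)
    (hTs : ∑ x ∈ Finset.Icc 1 M, ∑ y ∈ Finset.Icc 1 M, Tx x y ≤ κ)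
    (hk : ∀ x y : ℕ, 1 ≤ x → 1 ≤ y → y ≤ x → σ ≤ ε * y → k x y * (F x * F y) ≤ C * (F x * F y) + Tx x y)
    (hw1 : ∀ x y : ℕ, 1 ≤ y → y < x → ε * y < σ → w (x - y) ≤ w x + w y)
    (hw2 : ∀ x y : ℕ, w (x - y) - w x - w y ≤ 9)
    (hw3 : ∀ x : ℕ, 1 ≤ x → ε * x < σ → 0 ≤ w x) (hw4 : ∀ x, -1 ≤ w x) :
    ∑ i ∈ Finset.Icc 1 M, w i * ((∑ x ∈ Finset.Icc 1 M, ∑ y ∈ Finset.Icc 1 M,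
          (if x = y + i then k x y * (F x * F y) else 0))
        - (∑ y ∈ Finset.Icc 1 M, k i y * (F i * F y))) ≤ 10 * (C * (N * N) + κ) := by
  have e1 : ∑ i ∈ Finset.Icc 1 M, w i * ((∑ x ∈ Finset.Icc 1 M, ∑ y ∈ Finset.Icc 1 M,
          (if x = y + i then k x y * (F x * F y) else 0))
        - (∑ y ∈ Finset.Icc 1 M, k i y * (F i * F y))) =
      ∑ i ∈ Finset.Icc 1 M, ∑ x ∈ Finset.Icc 1 M, ∑ y ∈ Finset.Icc 1 M,
          (if x = y + i then w i * (k x y * (F x * F y)) else 0)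
      - ∑ i ∈ Finset.Icc 1 M, ∑ y ∈ Finset.Icc 1 M, w i * (k i y * (F i * F y)) := by
    rw [← Finset.sum_sub_distrib]
    refine Finset.sum_congr rfl fun i _ => ?_
    rw [mul_sub, Finset.mul_sum, Finset.mul_sum]
    congr 1
    refine Finset.sum_congr rfl fun x _ => ?_
    rw [Finset.mul_sum]
    refine Finset.sum_congr rfl fun y _ => ?_
    split_ifs <;> simp
  rw [e1, rbk_reindex M (fun x y i => w i * (k x y * (F x * F y))),
    rbk_sym M (fun i y => w i * (k i y * (F i * F y)))]
  have hN : 0 ≤ N := le_trans (Finset.sum_nonneg fun x hx => hF0 x (Finset.mem_Icc.1 hx).1) hFN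
  have hb : ∀ x y, 1 ≤ x → 1 ≤ y → 0 ≤ C * (F x * F y) + Tx x y := fun x y hx hy => by
    have := hF0 x hx; have := hF0 y hy; have := hT0 x y hx hy; positivity
  have hsum : ∑ x ∈ Finset.Icc 1 M, ∑ y ∈ Finset.Icc 1 M, (C * (F x * F y) + Tx x y) ≤
      C * (N * N) + κ := by
    simp only [Finset.sum_add_distrib]
    refine add_le_add ?_ hTs
    have : ∑ x ∈ Finset.Icc 1 M, ∑ y ∈ Finset.Icc 1 M, C * (F x * F y) =
        C * ((∑ x ∈ Finset.Icc 1 M, F x) * (∑ x ∈ Finset.Icc 1 M, F x)) := by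
      rw [Finset.sum_mul_sum, Finset.mul_sum]
      exact Finset.sum_congr rfl fun x _ => by rw [Finset.mul_sum]
    rw [this]
    have h0 : 0 ≤ ∑ x ∈ Finset.Icc 1 M, F x :=
      Finset.sum_nonneg fun x hx => hF0 x (Finset.mem_Icc.1 hx).1
    gcongr
  have h1 : ∑ x ∈ Finset.Icc 1 M, ∑ y ∈ Finset.Icc 1 M,
        (if y < x then w (x - y) * (k x y * (F x * F y)) else 0)
      - ∑ x ∈ Finset.Icc 1 M, ∑ y ∈ Finset.Icc 1 M,
        (if y < x then w x * (k x y * (F x * F y)) + w y * (k y x * (F y * F x)) else 0)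
      ≤ 9 * ∑ x ∈ Finset.Icc 1 M, ∑ y ∈ Finset.Icc 1 M, (C * (F x * F y) + Tx x y) := by
    rw [← Finset.sum_sub_distrib, Finset.mul_sum]
    refine Finset.sum_le_sum fun x hx => ?_
    rw [← Finset.sum_sub_distrib, Finset.mul_sum]
    refine Finset.sum_le_sum fun y hy => ?_
    rw [Finset.mem_Icc] at hx hy
    have hbb := hb x y hx.1 hy.1
    split_ifs with hyx
    · rw [hks y x hy.1 hx.1]
      have hkF : 0 ≤ k x y * (F x * F y) :=
        mul_nonneg (hk0 _ _ hx.1 hy.1) (mul_nonneg (hF0 _ hx.1) (hF0 _ hy.1))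
      have e : w (x - y) * (k x y * (F x * F y)) - (w x * (k x y * (F x * F y)) +
        w y * (k x y * (F y * F x))) = (w (x - y) - w x - w y) * (k x y * (F x * F y)) := by ring
      rw [e]
      by_cases hs : ε * (y:ℝ) < σ
      · have := hw1 x y hy.1 hyx hs
        have : (w (x - y) - w x - w y) * (k x y * (F x * F y)) ≤ 0 :=
          mul_nonpos_of_nonpos_of_nonneg (by linarith) hkF
        linarith
      · push Not at hs
        have h2 := hk x y hx.1 hy.1 hyx.le hs
        calc _ ≤ 9 * (k x y * (F x * F y)) := by gcongr; exact hw2 x y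
          _ ≤ _ := by linarith
    · linarith
  have h2 : - ∑ x ∈ Finset.Icc 1 M, w x * (k x x * (F x * F x)) ≤
      ∑ x ∈ Finset.Icc 1 M, ∑ y ∈ Finset.Icc 1 M, (C * (F x * F y) + Tx x y) := by
    rw [← Finset.sum_neg_distrib]
    refine Finset.sum_le_sum fun x hx => ?_
    have hx' := (Finset.mem_Icc.1 hx).1
    refine le_trans ?_ (Finset.single_le_sum (f := fun y => C * (F x * F y) + Tx x y)
      (fun y hy => hb x y hx' (Finset.mem_Icc.1 hy).1) hx)
    have hkF : 0 ≤ k x x * (F x * F x) :=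
      mul_nonneg (hk0 _ _ hx' hx') (mul_nonneg (hF0 _ hx') (hF0 _ hx'))
    have hbb := hb x x hx' hx'
    by_cases hs : ε * (x:ℝ) < σ
    · have := mul_nonneg (hw3 x hx' hs) hkF
      linarith
    · push Not at hs
      have := hk x x hx' hx' le_rfl hs
      have := hw4 x
      nlinarith
  linarith

lemma rbk_EC_core {K : ℝ → ℝ → ℝ} {ε N : ℝ} {F : ℕ → ℝ → ℝ} (hF : RSol K ε N F)
    (hK_symm : ∀ x y : ℝ, 0 < x → 0 < y → K x y = K y x)
    (hK_nonneg : ∀ x y : ℝ, 0 < x → 0 < y → 0 ≤ K x y)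
    (hε : 0 < ε) {κ X : ℝ} (hκ : 0 < κ)
    (hX : ∀ x y : ℝ, X ≤ x → 0 < y → y ≤ x → K x y ≤ κ * (x * (1 + y)))
    (M : ℕ) (hM : X ≤ ε * M) (σ C : ℝ) (hC : 0 ≤ C)
    (hKC : ∀ x y : ℝ, σ ≤ x → x ≤ X → σ ≤ y → y ≤ X → K x y ≤ C)
    (φ : ℕ → ℝ) (hφ : ∀ i, |φ i| ≤ 1) (s t : ℝ) (hs : 0 ≤ s) (hst : s ≤ t) :
    ∑ i ∈ Finset.Icc 1 M, φ i * (F i t - F i s) ≤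
      (10 * (C * (N * N) + κ * (N * (2 * N))) + 14 * (κ * (N * (2 * N)))) * (t - s)
      + 3 * ∑ i ∈ Finset.Icc 1 M, rbkψ σ ε i * F i s := by
  have hpos : ∀ x : ℕ, 1 ≤ x → 0 < ε * (x:ℝ) := fun x hx => mul_pos hε (by exact_mod_cast hx)
  set w : ℕ → ℝ := fun i => φ i + 3 * rbkψ σ ε i with hw
  set Q := 10 * (C * (N * N) + κ * (N * (2 * N))) + 14 * (κ * (N * (2 * N))) with hQ
  have hφ1 : ∀ i, -1 ≤ φ i := fun i => (abs_le.1 (hφ i)).1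
  have hφ2 : ∀ i, φ i ≤ 1 := fun i => (abs_le.1 (hφ i)).2
  have hψ0 : ∀ i, 0 ≤ rbkψ σ ε i := fun i => by unfold rbkψ; split_ifs <;> norm_num
  have hψ2 : ∀ i, rbkψ σ ε i ≤ 2 := fun i => by unfold rbkψ; split_ifs <;> norm_num
  have hw4 : ∀ i, -1 ≤ w i := fun i => by simp only [hw]; linarith [hφ1 i, hψ0 i]
  have hw7 : ∀ i, w i ≤ 7 := fun i => by simp only [hw]; linarith [hφ2 i, hψ2 i]
  have hder : ∀ x ∈ Set.Ico s t, ∃ D', HasDerivWithinAt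
      (fun τ => ∑ i ∈ Finset.Icc 1 M, w i * F i τ) D' (Set.Ici x) x ∧ D' ≤ Q := by
    intro p hp
    have hp0 : 0 ≤ p := hs.trans hp.1
    obtain ⟨d, τ, τ', hd, h1, h2, h3, h4, h5⟩ :=
      rbk_deriv_finite hF hK_symm hK_nonneg hε hκ hX M hM p hp0
    refine ⟨∑ i ∈ Finset.Icc 1 M, w i * d i,
      HasDerivWithinAt.fun_sum fun i hi => (hd i hi).const_mul (w i), ?_⟩
    have hk00 : ∀ x y : ℕ, 1 ≤ x → 1 ≤ y → 0 ≤ K (ε * (x:ℝ)) (ε * (y:ℝ)) := fun x y hx hy =>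
      hK_nonneg _ _ (hpos x hx) (hpos y hy)
    have halg := rbk_EC_alg M (fun x y => K (ε * (x:ℝ)) (ε * (y:ℝ))) (fun i => F i p) w
      (fun x y => if X ≤ ε * (x:ℝ) ∧ y ≤ x then K (ε * (x:ℝ)) (ε * (y:ℝ)) * (F x p * F y p) else 0)
      C N (κ * (N * (2 * N))) ε σ hC hk00
      (fun x y hx hy => hK_symm _ _ (hpos x hx) (hpos y hy)) (fun x hx => hF.nonneg x hx p hp0)
      (hF.num p hp0 M) (by
        intro x y hx hy
        have := mul_nonneg (hk00 x y hx hy) (mul_nonneg (hF.nonneg x hx p hp0) (hF.nonneg y hy p hp0))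
        split_ifs
        · exact this
        · exact le_rfl) (rbk_tail_sum hF hε hκ hX p hp0 M) (by
        intro x y hx hy hyx hσy
        have hFF := mul_nonneg (hF.nonneg x hx p hp0) (hF.nonneg y hy p hp0)
        have hyx' : ε * (y:ℝ) ≤ ε * (x:ℝ) := by
          have : (y:ℝ) ≤ x := by exact_mod_cast hyx
          gcongr
        by_cases hXx : X ≤ ε * (x:ℝ)
        · rw [if_pos ⟨hXx, hyx⟩]
          have := mul_nonneg hC hFF
          linarith
        · rw [if_neg (fun h => hXx h.1), add_zero]
          push Not at hXx
          exact mul_le_mul_of_nonneg_right (hKC _ _ (hσy.trans hyx') hXx.le hσy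
            (hyx'.trans hXx.le)) hFF) (by
        intro x y hy hyx hyσ
        have hc : ((x - y : ℕ):ℝ) = (x:ℝ) - y := Nat.cast_sub hyx.le
        simp only [hw]
        have : rbkψ σ ε (x - y) ≤ rbkψ σ ε x + 1 ∧ rbkψ σ ε y = 2 := by
          constructor
          · unfold rbkψ
            rw [hc, mul_sub]
            split_ifs <;> first | (exfalso; linarith) | norm_num
          · unfold rbkψ
            have := hpos y hy
            rw [if_pos hyσ, if_pos (by linarith)]; norm_num
        linarith [hφ1 x, hφ1 y, hφ2 (x - y), this.1, this.2])
      (fun x y => by linarith [hw7 (x - y), hw4 x, hw4 y]) (by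
        intro x hx hxσ
        have := hpos x hx
        have : rbkψ σ ε x = 2 := by
          unfold rbkψ
          rw [if_pos hxσ, if_pos (by linarith)]; norm_num
        simp only [hw]; linarith [hφ1 x]) hw4
    have h6 : ∑ i ∈ Finset.Icc 1 M, w i * d i = ∑ i ∈ Finset.Icc 1 M, w i *
        ((∑ x ∈ Finset.Icc 1 M, ∑ y ∈ Finset.Icc 1 M,
          (if x = y + i then K (ε * (x:ℝ)) (ε * (y:ℝ)) * (F x p * F y p) else 0))
        - (∑ y ∈ Finset.Icc 1 M, K (ε * (i:ℝ)) (ε * (y:ℝ)) * (F i p * F y p)))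
        + ∑ i ∈ Finset.Icc 1 M, w i * (τ i - τ' i) := by
      rw [← Finset.sum_add_distrib]
      refine Finset.sum_congr rfl fun i hi => ?_
      rw [h5 i hi]; ring
    have h7 : ∑ i ∈ Finset.Icc 1 M, w i * (τ i - τ' i) ≤ ∑ i ∈ Finset.Icc 1 M, (7 * τ i + 7 * τ' i) := by
      refine Finset.sum_le_sum fun i hi => ?_
      have := h1 i hi; have := h2 i hi; have := hw4 i; have := hw7 i
      nlinarith
    rw [Finset.sum_add_distrib, ← Finset.mul_sum, ← Finset.mul_sum] at h7
    rw [h6]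
    linarith
  choose! D' hD' hDb using hder
  have hcont : ContinuousOn (fun τ => ∑ i ∈ Finset.Icc 1 M, w i * F i τ) (Set.Icc s t) := by
    refine continuousOn_finsetSum _ fun i hi => continuousOn_const.mul ?_
    exact (rbk_cont hF i (Finset.mem_Icc.1 hi).1).mono
      (fun x (hx : x ∈ Set.Icc s t) => (hs.trans hx.1 : x ∈ Set.Ici 0))
  have hfin := image_le_of_deriv_right_le_deriv_boundary hcont hD'
    (B := fun τ => (∑ i ∈ Finset.Icc 1 M, w i * F i s) + Q * (τ - s))
    (B' := fun _ => Q) (by simp) (by fun_prop)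
    (fun x _ => by
      simpa using ((((hasDerivAt_id x).sub_const s).const_mul Q).const_add
        (∑ i ∈ Finset.Icc 1 M, w i * F i s)).hasDerivWithinAt) hDb ⟨hst, le_rfl⟩
  have e1 : ∀ τ, ∑ i ∈ Finset.Icc 1 M, w i * F i τ = ∑ i ∈ Finset.Icc 1 M, φ i * F i τ +
      3 * ∑ i ∈ Finset.Icc 1 M, rbkψ σ ε i * F i τ := by
    intro τ
    rw [Finset.mul_sum, ← Finset.sum_add_distrib]
    exact Finset.sum_congr rfl fun i _ => by simp only [hw]; ring
  have e2 : ∑ i ∈ Finset.Icc 1 M, φ i * (F i t - F i s) =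
      ∑ i ∈ Finset.Icc 1 M, φ i * F i t - ∑ i ∈ Finset.Icc 1 M, φ i * F i s := by
    rw [← Finset.sum_sub_distrib]
    exact Finset.sum_congr rfl fun i _ => by ring
  have h8 : 0 ≤ ∑ i ∈ Finset.Icc 1 M, rbkψ σ ε i * F i t :=
    Finset.sum_nonneg fun i hi => mul_nonneg (hψ0 i)
      (hF.nonneg i (Finset.mem_Icc.1 hi).1 t (hs.trans hst))
  simp only [e1] at hfin
  rw [e2]
  linarith

/-- Equicontinuity, uniformly in ε. -/
theorem rbk_EC {K : ℝ → ℝ → ℝ} {N : ℝ} {F : ℝ → ℕ → ℝ → ℝ}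
    (hF : ∀ ε, 0 < ε → ε < 1 → RSol K ε N (F ε))
    (hK_cont : ContinuousOn (fun p : ℝ × ℝ => K p.1 p.2) (Set.Ioi 0 ×ˢ Set.Ioi 0))
    (hK_symm : ∀ x y : ℝ, 0 < x → 0 < y → K x y = K y x)
    (hK_nonneg : ∀ x y : ℝ, 0 < x → 0 < y → 0 ≤ K x y)
    (htail : ∀ κ : ℝ, 0 < κ → ∃ X : ℝ, 1 ≤ X ∧
      ∀ x y : ℝ, X ≤ x → 0 < y → y ≤ x → K x y ≤ κ * (x * (1 + y)))
    (T : ℝ)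
    (hUI : ∀ δ : ℝ, 0 < δ → ∃ A R : ℝ, 0 ≤ A ∧ 0 ≤ R ∧ ∀ ε, 0 < ε → ε < 1 →
      ∀ t ∈ Set.Icc 0 T, ∀ m : ℕ,
      ∑ i ∈ Finset.Icc 1 m, max (F ε i t - (if ε * (i:ℝ) ≤ R then ε * A else 0)) 0 ≤ δ)
    (δ : ℝ) (hδ : 0 < δ) :
    ∃ C : ℝ, 0 ≤ C ∧ ∀ ε, 0 < ε → ε < 1 → ∃ M0 : ℕ, ∀ M : ℕ, M0 ≤ M → ∀ s t : ℝ, 0 ≤ s → s ≤ t →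
      t ≤ T → ∀ φ : ℕ → ℝ, (∀ i, |φ i| ≤ 1) →
      |∑ i ∈ Finset.Icc 1 M, φ i * (F ε i t - F ε i s)| ≤ C * (t - s) + δ := by
  have hN : 0 ≤ N := by simpa using (hF (1/2) (by norm_num) (by norm_num)).num 0 le_rfl 0
  obtain ⟨A, R, hA, hR, hUI⟩ := hUI (δ / 12) (by positivity)
  obtain ⟨X, hX1, hX⟩ := htail 1 one_pos
  let σ := δ / (24 * (A + 1))
  have hσ : 0 < σ := by positivity
  obtain ⟨C, hC, hKC⟩ := rbk_kernel_loc K hK_cont σ X hσ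
  refine ⟨10 * (C * (N * N) + 1 * (N * (2 * N))) + 14 * (1 * (N * (2 * N))), by positivity, ?_⟩
  intro ε hε hε1
  obtain ⟨M0, hM0⟩ := exists_nat_gt (X / ε)
  refine ⟨M0, fun M hM s t hs hst htT φ hφ => ?_⟩
  have hMX : X ≤ ε * (M:ℝ) := by
    rw [div_lt_iff₀ hε] at hM0
    have : (M0:ℝ) ≤ (M:ℝ) := by exact_mod_cast hM
    nlinarith
  have hψ : 3 * ∑ i ∈ Finset.Icc 1 M, rbkψ σ ε i * F ε i s ≤ δ := by
    have h1 : ∑ i ∈ Finset.Icc 1 M, rbkψ σ ε i * F ε i s ≤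
        ∑ i ∈ Finset.Icc 1 M, (2 * max (F ε i s - (if ε * (i:ℝ) ≤ R then ε * A else 0)) 0
          + 2 * A * (if ε * (i:ℝ) < 2 * σ then ε else 0)) := by
      refine Finset.sum_le_sum fun i hi => ?_
      have hi1 := (Finset.mem_Icc.1 hi).1
      have hFi := (hF ε hε hε1).nonneg i hi1 s hs
      have hp : 0 < ε * (i:ℝ) := mul_pos hε (by exact_mod_cast hi1)
      have hm1 := le_max_left (F ε i s - (if ε * (i:ℝ) ≤ R then ε * A else 0)) 0
      have hm0 := le_max_right (F ε i s - (if ε * (i:ℝ) ≤ R then ε * A else 0)) 0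
      have hm2 : F ε i s ≤ max (F ε i s - (if ε * (i:ℝ) ≤ R then ε * A else 0)) 0 + ε * A := by
        have : (if ε * (i:ℝ) ≤ R then ε * A else 0) ≤ ε * A := by
          split_ifs
          · exact le_rfl
          · positivity
        linarith
      unfold rbkψ
      by_cases h2 : ε * (i:ℝ) < 2 * σ
      · rw [if_pos h2, if_pos h2]
        split_ifs at * <;> nlinarith
      · rw [if_neg h2, if_neg h2, if_neg (by linarith)]
        linarith
    rw [Finset.sum_add_distrib, ← Finset.mul_sum, ← Finset.mul_sum] at h1
    have h2 := hUI ε hε hε1 s ⟨hs, hst.trans htT⟩ M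
    have h3 := rbk_count M ε (2 * σ) hε (by positivity)
    have h4 : 2 * A * ∑ i ∈ Finset.Icc 1 M, (if ε * (i:ℝ) < 2 * σ then ε else 0) ≤ 2 * A * (2 * σ) := by
      gcongr
    have h5 : A * σ ≤ δ / 24 := by
      have : (A + 1) * σ = δ / 24 := by simp only [σ]; field_simp
      nlinarith
    linarith
  have key : ∀ φ : ℕ → ℝ, (∀ i, |φ i| ≤ 1) → ∑ i ∈ Finset.Icc 1 M, φ i * (F ε i t - F ε i s) ≤
      (10 * (C * (N * N) + 1 * (N * (2 * N))) + 14 * (1 * (N * (2 * N)))) * (t - s) + δ := by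
    intro φ hφ
    have := rbk_EC_core (hF ε hε hε1) hK_symm hK_nonneg hε one_pos hX M hMX σ C hC hKC φ hφ s t hs hst
    linarith
  rw [abs_le]
  have h1 := key φ hφ
  have h2 := key (fun i => - φ i) (fun i => by rw [abs_neg]; exact hφ i)
  simp only [neg_mul, Finset.sum_neg_distrib] at h2
  exact ⟨by linarith, h1⟩

lemma rbk_setfn_density (μ ρ : Measure ℝ) [SigmaFinite μ] [IsFiniteMeasure ρ] (hρμ : ρ ≪ μ)
    (L : Set ℝ → ℝ) (h0 : ∀ E, MeasurableSet E → 0 ≤ L E)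
    (hadd : ∀ E E', MeasurableSet E → MeasurableSet E' → Disjoint E E' → L (E ∪ E') = L E + L E')
    (hUI : ∀ δ : ℝ, 0 < δ → ∃ η : ℝ, 0 < η ∧ ∀ E, MeasurableSet E → ρ.real E ≤ η → L E ≤ δ) :
    ∃ g : ℝ → ℝ, (∀ x, 0 ≤ g x) ∧ Integrable g μ ∧
      ∀ E, MeasurableSet E → ∫ x in E, g x ∂μ = L E := by
  have hempty : L ∅ = 0 := by
    have := hadd ∅ ∅ MeasurableSet.empty MeasurableSet.empty (by simp)
    simp at this; exact this
  have hfinadd : ∀ (f : ℕ → Set ℝ), (∀ i, MeasurableSet (f i)) → Pairwise (Function.onFun Disjoint f) →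
      ∀ n, L (⋃ i, f i) = ∑ i ∈ Finset.range n, L (f i) + L (⋃ i ∈ Set.Ici n, f i) := by
    intro f hf hd n
    induction n with
    | zero => simp
    | succ n ih =>
      rw [ih, Finset.sum_range_succ, add_assoc]
      congr 1
      have hs : (⋃ i ∈ Set.Ici n, f i) = f n ∪ ⋃ i ∈ Set.Ici (n+1), f i := by
        ext x
        simp only [Set.mem_iUnion, Set.mem_Ici, exists_prop, Set.mem_union]
        constructor
        · rintro ⟨i, hi, hx⟩
          rcases hi.eq_or_lt with h | h
          · exact Or.inl (h ▸ hx)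
          · exact Or.inr ⟨i, h, hx⟩
        · rintro (hx | ⟨i, hi, hx⟩)
          · exact ⟨n, le_rfl, hx⟩
          · exact ⟨i, by omega, hx⟩
      rw [hs]
      refine hadd _ _ (hf n) (MeasurableSet.biUnion (Set.to_countable _) fun i _ => hf i) ?_
      rw [Set.disjoint_iUnion₂_right]
      intro i hi
      exact hd (by have : n + 1 ≤ i := hi; omega)
  have hsum : ∀ (f : ℕ → Set ℝ), (∀ i, MeasurableSet (f i)) → Pairwise (Function.onFun Disjoint f) →
      HasSum (fun i => L (f i)) (L (⋃ i, f i)) := by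
    intro f hf hd
    rw [hasSum_iff_tendsto_nat_of_nonneg (fun i => h0 _ (hf i))]
    have ht := tendsto_measure_biUnion_Ici_zero_of_pairwise_disjoint (μ := ρ)
      (fun i => (hf i).nullMeasurableSet) hd
    have ht' : Filter.Tendsto (fun n => ρ.real (⋃ i ∈ Set.Ici n, f i)) Filter.atTop (nhds 0) := by
      have := (ENNReal.tendsto_toReal (ENNReal.zero_ne_top)).comp ht
      simpa [measureReal_def, Function.comp_def] using this
    have hL : Filter.Tendsto (fun n => L (⋃ i ∈ Set.Ici n, f i)) Filter.atTop (nhds 0) := by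
      rw [Metric.tendsto_atTop]
      intro δ hδ
      obtain ⟨η, hη, hU⟩ := hUI (δ / 2) (by positivity)
      obtain ⟨n0, hn0⟩ := (Metric.tendsto_atTop.1 ht') η hη
      refine ⟨n0, fun n hn => ?_⟩
      have hm : MeasurableSet (⋃ i ∈ Set.Ici n, f i) :=
        MeasurableSet.biUnion (Set.to_countable _) fun i _ => hf i
      have h1 := hn0 n hn
      rw [Real.dist_eq, sub_zero, abs_of_nonneg measureReal_nonneg] at h1
      have h2 := hU _ hm h1.le
      rw [Real.dist_eq, sub_zero, abs_of_nonneg (h0 _ hm)]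
      linarith
    have : (fun n => ∑ i ∈ Finset.range n, L (f i)) =
        fun n => L (⋃ i, f i) - L (⋃ i ∈ Set.Ici n, f i) := by
      funext n; rw [hfinadd f hf hd n]; ring
    rw [this]
    simpa using hL.const_sub (L (⋃ i, f i))
  let m : Measure ℝ := Measure.ofMeasurable (fun E _ => ENNReal.ofReal (L E)) (by simp [hempty]) (by
    intro f hf hd
    have h := hsum f hf hd
    rw [← h.tsum_eq, ENNReal.ofReal_tsum_of_nonneg (fun i => h0 _ (hf i)) h.summable])
  have hm : ∀ E, MeasurableSet E → m E = ENNReal.ofReal (L E) := fun E hE =>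
    Measure.ofMeasurable_apply E hE
  haveI : IsFiniteMeasure m := ⟨by rw [hm _ MeasurableSet.univ]; exact ENNReal.ofReal_lt_top⟩
  have hac : m ≪ μ := by
    refine Measure.AbsolutelyContinuous.trans ?_ hρμ
    refine Measure.AbsolutelyContinuous.mk fun E hE hE0 => ?_
    rw [hm E hE, ENNReal.ofReal_eq_zero]
    refine le_of_forall_pos_le_add fun δ hδ => ?_
    obtain ⟨η, hη, hU⟩ := hUI δ hδ
    have := hU E hE (by simp [measureReal_def, hE0, hη.le])
    linarith
  refine ⟨fun x => (m.rnDeriv μ x).toReal, fun x => ENNReal.toReal_nonneg,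
    Measure.integrable_toReal_rnDeriv, fun E hE => ?_⟩
  rw [Measure.setIntegral_toReal_rnDeriv hac, measureReal_def, hm E hE,
    ENNReal.toReal_ofReal (h0 E hE)]

/-- uniform Cauchy subsequence on all measurable sets -/
lemma rbk_subseq (ρ : Measure ℝ) [IsFiniteMeasure ρ] (T N : ℝ) (hT : 0 < T)
    (I : ℕ → ℝ → Set ℝ → ℝ)
    (hI0 : ∀ n, ∀ t ∈ Set.Icc 0 T, ∀ E, MeasurableSet E → 0 ≤ I n t E)
    (hIN : ∀ n, ∀ t ∈ Set.Icc 0 T, ∀ E, MeasurableSet E → I n t E ≤ N)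
    (hadd : ∀ n, ∀ t ∈ Set.Icc 0 T, ∀ E E', MeasurableSet E → MeasurableSet E' → Disjoint E E' →
      I n t (E ∪ E') = I n t E + I n t E')
    (hUI : ∀ δ : ℝ, 0 < δ → ∃ η : ℝ, 0 < η ∧ ∀ n, ∀ t ∈ Set.Icc 0 T, ∀ E, MeasurableSet E →
      ρ.real E ≤ η → I n t E ≤ δ)
    (hEC : ∀ δ : ℝ, 0 < δ → ∃ C : ℝ, 0 ≤ C ∧ ∀ n, ∀ s t : ℝ, 0 ≤ s → s ≤ t → t ≤ T →
      ∀ E, MeasurableSet E → |I n t E - I n s E| ≤ C * (t - s) + δ) :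
    ∃ sub : ℕ → ℕ, StrictMono sub ∧ ∀ E, MeasurableSet E → ∀ δ : ℝ, 0 < δ → ∃ n0, ∀ n, n0 ≤ n →
      ∀ n', n0 ≤ n' → ∀ t ∈ Set.Icc 0 T, |I (sub n) t E - I (sub n') t E| ≤ δ := by
  obtain ⟨𝒜, h𝒜c, h𝒜⟩ := exists_countable_measureDense (μ := ρ)
  haveI := h𝒜c.to_subtype
  let tm : ℕ × ℕ → ℝ := fun p => min (T * p.2 / (p.1 + 1)) T
  have htm : ∀ p, tm p ∈ Set.Icc 0 T := fun p => ⟨le_min (by positivity) hT.le, min_le_right _ _⟩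
  let v : ℕ → (𝒜 × (ℕ × ℕ)) → ℝ := fun n p => I n (tm p.2) p.1
  have hcomp : IsCompact (Set.pi Set.univ (fun _ : 𝒜 × (ℕ × ℕ) => Set.Icc (0:ℝ) N)) :=
    isCompact_univ_pi fun _ => isCompact_Icc
  obtain ⟨a, _, sub, hsub, hlim⟩ := hcomp.tendsto_subseq (x := v) (by
    intro n p _
    exact ⟨hI0 n _ (htm _) _ (h𝒜.measurable _ p.1.2), hIN n _ (htm _) _ (h𝒜.measurable _ p.1.2)⟩)
  rw [tendsto_pi_nhds] at hlim
  refine ⟨sub, hsub, fun E hE δ hδ => ?_⟩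
  set d := δ / 9 with hd
  have hd0 : 0 < d := by positivity
  obtain ⟨η, hη, hU⟩ := hUI d hd0
  obtain ⟨C, hC, hEC⟩ := hEC d hd0
  obtain ⟨S, hS𝒜, hSE⟩ := h𝒜.approx E hE (measure_ne_top _ _) η hη
  have hSm := h𝒜.measurable S hS𝒜
  have hSE' : ρ.real (symmDiff E S) ≤ η := by
    rw [measureReal_def]
    exact ENNReal.toReal_le_of_le_ofReal hη.le hSE.le
  have hES : ∀ n, ∀ t ∈ Set.Icc 0 T, |I n t E - I n t S| ≤ d := by
    intro n t ht
    have h1 : I n t (E ∩ S) + I n t (E \ S) = I n t E := by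
      rw [← hadd n t ht _ _ (hE.inter hSm) (hE.diff hSm) (Set.disjoint_sdiff_inter.symm),
        Set.inter_union_diff]
    have h2 : I n t (S ∩ E) + I n t (S \ E) = I n t S := by
      rw [← hadd n t ht _ _ (hSm.inter hE) (hSm.diff hE) (Set.disjoint_sdiff_inter.symm),
        Set.inter_union_diff]
    rw [Set.inter_comm S E] at h2
    have h3 := hU n t ht (E \ S) (hE.diff hSm)
      ((measureReal_mono (by rw [Set.symmDiff_def]; exact Set.subset_union_left)).trans hSE')
    have h4 := hU n t ht (S \ E) (hSm.diff hE)
      ((measureReal_mono (by rw [Set.symmDiff_def]; exact Set.subset_union_right)).trans hSE')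
    have h5 := hI0 n t ht (E \ S) (hE.diff hSm)
    have h6 := hI0 n t ht (S \ E) (hSm.diff hE)
    rw [abs_le]; constructor <;> linarith
  obtain ⟨m, hm⟩ := exists_nat_gt (C * T / d)
  have hm' : C * (T / ((m:ℝ) + 1)) ≤ d := by
    rw [div_lt_iff₀ hd0] at hm
    rw [mul_div_assoc', div_le_iff₀ (by positivity)]
    nlinarith
  have hcau : ∀ j : ℕ, ∃ n0, ∀ n, n0 ≤ n → ∀ n', n0 ≤ n' →
      |I (sub n) (tm (m, j)) S - I (sub n') (tm (m, j)) S| ≤ d := by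
    intro j
    have h1 := (hlim (⟨S, hS𝒜⟩, (m, j))).cauchySeq
    obtain ⟨n0, hn0⟩ := Metric.cauchySeq_iff.1 h1 d hd0
    refine ⟨n0, fun n hn n' hn' => ?_⟩
    have := hn0 n hn n' hn'
    rw [Real.dist_eq] at this
    exact this.le
  choose n0 hn0 using hcau
  refine ⟨(Finset.range (m + 2)).sup n0, fun n hn n' hn' t ht => ?_⟩
  set j := ⌊t * ((m:ℝ) + 1) / T⌋₊ with hj
  have hm1 : (0:ℝ) < (m:ℝ) + 1 := by positivity
  have hjm : j ≤ m + 1 := by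
    have : t * ((m:ℝ) + 1) / T ≤ ((m + 1 : ℕ):ℝ) := by
      rw [div_le_iff₀ hT]; push_cast
      nlinarith [ht.2]
    exact Nat.floor_le_of_le this
  have hle1 : T * j / ((m:ℝ) + 1) ≤ t := by
    have := Nat.floor_le (show 0 ≤ t * ((m:ℝ) + 1) / T by have := ht.1; positivity)
    rw [le_div_iff₀ hT] at this
    rw [div_le_iff₀ hm1]; linarith
  have hle2 : t ≤ T * j / ((m:ℝ) + 1) + T / ((m:ℝ) + 1) := by
    have := (Nat.lt_floor_add_one (t * ((m:ℝ) + 1) / T)).le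
    rw [div_le_iff₀ hT] at this
    rw [← add_div, le_div_iff₀ hm1]; linarith
  have htmj : tm (m, j) = T * j / ((m:ℝ) + 1) := min_eq_left (hle1.trans ht.2)
  have hst : tm (m, j) ≤ t := by rw [htmj]; exact hle1
  have htime : ∀ n, |I n t S - I n (tm (m, j)) S| ≤ 2 * d := by
    intro n
    refine (hEC n (tm (m, j)) t (htm _).1 hst ht.2 S hSm).trans ?_
    have : C * (t - tm (m, j)) ≤ C * (T / ((m:ℝ) + 1)) := by
      gcongr; rw [htmj]; linarith
    linarith
  have hmem : j ∈ Finset.range (m + 2) := by rw [Finset.mem_range]; omega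
  have h1 := hn0 j n ((Finset.le_sup hmem).trans hn) n' ((Finset.le_sup hmem).trans hn')
  have h2 := hES (sub n) t ht
  have h3 := hES (sub n') t ht
  have h4 := htime (sub n)
  have h5 := htime (sub n')
  rw [abs_le] at *
  constructor <;> linarith [h1.1, h1.2, h2.1, h2.2, h3.1, h3.2, h4.1, h4.2, h5.1, h5.2]

lemma rbk_test_fn (μ : Measure ℝ) (T N : ℝ) (hN : 0 ≤ N) (w : ℕ → ℝ → ℝ → ℝ)
    (hw : ∀ n, ∀ t ∈ Set.Icc 0 T, Integrable (w n t) μ)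
    (hwN : ∀ n, ∀ t ∈ Set.Icc 0 T, ∫ x, |w n t x| ∂μ ≤ N)
    (hset : ∀ E, MeasurableSet E → ∀ δ : ℝ, 0 < δ → ∃ n0, ∀ n, n0 ≤ n →
      ∀ t ∈ Set.Icc 0 T, |∫ x in E, w n t x ∂μ| ≤ δ)
    (φ : ℝ → ℝ) (hφ : Measurable φ) (B : ℝ) (hB : ∀ x, |φ x| ≤ B) (δ : ℝ) (hδ : 0 < δ) :
    ∃ n0, ∀ n, n0 ≤ n → ∀ t ∈ Set.Icc 0 T, |∫ x, w n t x * φ x ∂μ| ≤ δ := by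
  obtain ⟨k, hk⟩ := exists_nat_gt (N / (δ / 2))
  rw [div_lt_iff₀ (by positivity)] at hk
  have hk0 : (0:ℝ) < (k:ℝ) + 1 := by positivity
  let fl : ℝ → ℤ := fun x => ⌊((k:ℝ) + 1) * φ x⌋
  have hflm : Measurable fl := Int.measurable_floor.comp (measurable_const.mul hφ)
  let J : ℤ := ⌈((k:ℝ) + 1) * B⌉ + 1
  have hflJ : ∀ x, fl x ∈ Finset.Icc (-J) J := by
    intro x
    have h1 := abs_le.1 (hB x)
    have h2 := Int.le_ceil (((k:ℝ) + 1) * B)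
    have h3 := Int.floor_le (((k:ℝ) + 1) * φ x)
    have h4 := Int.lt_floor_add_one (((k:ℝ) + 1) * φ x)
    rw [Finset.mem_Icc]
    constructor
    · have : ((-J : ℤ):ℝ) ≤ ((fl x : ℤ) : ℝ) := by
        simp only [fl, J]; push_cast
        nlinarith [h1.1]
      exact_mod_cast this
    · have : ((fl x : ℤ):ℝ) ≤ ((J : ℤ) : ℝ) := by
        simp only [fl, J]; push_cast
        nlinarith [h1.2]
      exact_mod_cast this
  let E : ℤ → Set ℝ := fun j => fl ⁻¹' {j}
  have hE : ∀ j, MeasurableSet (E j) := fun j => hflm (measurableSet_singleton j)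
  set Z := ∑ j ∈ Finset.Icc (-J) J, |(j:ℝ) / ((k:ℝ) + 1)| with hZ
  have hZ0 : 0 ≤ Z := Finset.sum_nonneg fun _ _ => abs_nonneg _
  choose n0 hn0 using fun j => hset (E j) (hE j) (δ / 2 / (Z + 1)) (by positivity)
  refine ⟨(Finset.Icc (-J) J).sup n0, fun n hn t ht => ?_⟩
  have hwi := hw n t ht
  have hpt : ∀ x, w n t x * φ x = w n t x * (φ x - (fl x : ℝ) / ((k:ℝ) + 1)) +
      ∑ j ∈ Finset.Icc (-J) J, ((j:ℝ) / ((k:ℝ) + 1)) * (E j).indicator (w n t) x := by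
    intro x
    have : ∑ j ∈ Finset.Icc (-J) J, ((j:ℝ) / ((k:ℝ) + 1)) * (E j).indicator (w n t) x =
        (fl x : ℝ) / ((k:ℝ) + 1) * w n t x := by
      rw [Finset.sum_eq_single_of_mem (fl x) (hflJ x)]
      · rw [Set.indicator_of_mem (show x ∈ E (fl x) from rfl)]
      · intro j _ hj
        rw [Set.indicator_of_notMem (fun h : x ∈ E j => hj (Eq.symm h)), mul_zero]
    rw [this]; ring
  have hdiff : ∀ x, |φ x - (fl x : ℝ) / ((k:ℝ) + 1)| ≤ 1 / ((k:ℝ) + 1) := by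
    intro x
    have h3 := Int.floor_le (((k:ℝ) + 1) * φ x)
    have h4 := Int.lt_floor_add_one (((k:ℝ) + 1) * φ x)
    have e : φ x - (fl x : ℝ) / ((k:ℝ) + 1) = (((k:ℝ) + 1) * φ x - fl x) / ((k:ℝ) + 1) := by
      field_simp
    rw [e, abs_div, abs_of_pos hk0]
    gcongr
    rw [abs_le]
    simp only [fl]
    constructor <;> linarith
  have hm1 : Measurable (fun x => φ x - (fl x : ℝ) / ((k:ℝ) + 1)) := by
    have : Measurable (fun x => (fl x : ℝ)) := (measurable_from_top (f := fun z : ℤ => (z:ℝ))).comp hflm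
    exact hφ.sub (this.div_const _)
  have hi1 : Integrable (fun x => w n t x * (φ x - (fl x : ℝ) / ((k:ℝ) + 1))) μ := by
    refine hwi.mul_bdd (c := 1 / ((k:ℝ) + 1)) hm1.aestronglyMeasurable (Filter.Eventually.of_forall fun x => ?_)
    exact hdiff x
  have hi2 : ∀ j ∈ Finset.Icc (-J) J,
      Integrable (fun x => ((j:ℝ) / ((k:ℝ) + 1)) * (E j).indicator (w n t) x) μ := fun j _ =>
    (hwi.indicator (hE j)).const_mul _
  have hi3 : Integrable (fun x => ∑ j ∈ Finset.Icc (-J) J,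
      ((j:ℝ) / ((k:ℝ) + 1)) * (E j).indicator (w n t) x) μ := integrable_finsetSum _ hi2
  simp_rw [hpt]
  rw [integral_add hi1 hi3, integral_finsetSum _ hi2]
  have hA : |∫ x, w n t x * (φ x - (fl x : ℝ) / ((k:ℝ) + 1)) ∂μ| ≤ δ / 2 := by
    calc _ ≤ ∫ x, |w n t x * (φ x - (fl x : ℝ) / ((k:ℝ) + 1))| ∂μ := abs_integral_le_integral_abs
      _ ≤ ∫ x, |w n t x| * (1 / ((k:ℝ) + 1)) ∂μ := by
        refine integral_mono hi1.abs (hwi.abs.mul_const _) fun x => ?_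
        simp only [abs_mul]
        gcongr
        exact hdiff x
      _ = (∫ x, |w n t x| ∂μ) * (1 / ((k:ℝ) + 1)) := integral_mul_const _ _
      _ ≤ N * (1 / ((k:ℝ) + 1)) := by gcongr; exact hwN n t ht
      _ ≤ δ / 2 := by
        rw [mul_one_div, div_le_iff₀ hk0]; nlinarith
  have hBd : |∑ j ∈ Finset.Icc (-J) J, ∫ x, ((j:ℝ) / ((k:ℝ) + 1)) * (E j).indicator (w n t) x ∂μ|
      ≤ δ / 2 := by
    calc _ ≤ ∑ j ∈ Finset.Icc (-J) J, |∫ x, ((j:ℝ) / ((k:ℝ) + 1)) * (E j).indicator (w n t) x ∂μ| :=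
          Finset.abs_sum_le_sum_abs _ _
      _ ≤ ∑ j ∈ Finset.Icc (-J) J, |(j:ℝ) / ((k:ℝ) + 1)| * (δ / 2 / (Z + 1)) := by
        refine Finset.sum_le_sum fun j hj => ?_
        rw [integral_const_mul, integral_indicator (hE j), abs_mul]
        gcongr
        exact hn0 j n ((Finset.le_sup hj).trans hn) t ht
      _ = Z * (δ / 2 / (Z + 1)) := by rw [← Finset.sum_mul]
      _ ≤ (Z + 1) * (δ / 2 / (Z + 1)) := by gcongr; linarith
      _ = δ / 2 := by field_simp
  calc _ ≤ _ := abs_add_le _ _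
    _ ≤ δ := by linarith

theorem rbk_compact (μ ρ : Measure ℝ) [SigmaFinite μ] [IsFiniteMeasure ρ] (hρμ : ρ ≪ μ)
    (T N : ℝ) (hT : 0 < T) (u : ℕ → ℝ → ℝ → ℝ)
    (h0 : ∀ n, ∀ t ∈ Set.Icc 0 T, ∀ x, 0 ≤ u n t x)
    (hintg : ∀ n, ∀ t ∈ Set.Icc 0 T, Integrable (u n t) μ)
    (hN : ∀ n, ∀ t ∈ Set.Icc 0 T, ∫ x, u n t x ∂μ ≤ N)
    (hUI : ∀ δ : ℝ, 0 < δ → ∃ η : ℝ, 0 < η ∧ ∀ n, ∀ t ∈ Set.Icc 0 T, ∀ E, MeasurableSet E →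
      ρ.real E ≤ η → ∫ x in E, u n t x ∂μ ≤ δ)
    (hEC : ∀ δ : ℝ, 0 < δ → ∃ C : ℝ, 0 ≤ C ∧ ∀ n, ∀ s t : ℝ, 0 ≤ s → s ≤ t → t ≤ T →
      ∀ E, MeasurableSet E →
      |∫ x in E, u n t x ∂μ - ∫ x in E, u n s x ∂μ| ≤ C * (t - s) + δ) :
    ∃ g : ℝ → ℝ → ℝ, ∃ sub : ℕ → ℕ, StrictMono sub ∧
      (∀ t ∈ Set.Icc 0 T, ∀ x, 0 ≤ g x t) ∧
      (∀ t ∈ Set.Icc 0 T, Integrable (fun x => g x t) μ ∧ ∫ x, |g x t| ∂μ ≤ N) ∧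
      ∀ φ : ℝ → ℝ, Measurable φ → (∃ B, ∀ x, |φ x| ≤ B) → ∀ δ : ℝ, 0 < δ → ∃ n0, ∀ n, n0 ≤ n →
        ∀ t ∈ Set.Icc 0 T, |∫ x, (u (sub n) t x - g x t) * φ x ∂μ| ≤ δ := by
  have hN0 : 0 ≤ N := le_trans (integral_nonneg (h0 0 0 ⟨le_rfl, hT.le⟩)) (hN 0 0 ⟨le_rfl, hT.le⟩)
  have hI0 : ∀ n, ∀ t ∈ Set.Icc 0 T, ∀ E, MeasurableSet E → 0 ≤ ∫ x in E, u n t x ∂μ :=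
    fun n t ht E _ => integral_nonneg (h0 n t ht)
  have hadd : ∀ n, ∀ t ∈ Set.Icc 0 T, ∀ E E', MeasurableSet E → MeasurableSet E' → Disjoint E E' →
      ∫ x in E ∪ E', u n t x ∂μ = ∫ x in E, u n t x ∂μ + ∫ x in E', u n t x ∂μ :=
    fun n t ht E E' _ hE' hd => setIntegral_union hd hE' (hintg n t ht).integrableOn
      (hintg n t ht).integrableOn
  obtain ⟨sub, hsub, hcau⟩ := rbk_subseq ρ T N hT (fun n t E => ∫ x in E, u n t x ∂μ) hI0
    (fun n t ht E _ => le_trans (setIntegral_le_integral (hintg n t ht)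
      (Filter.Eventually.of_forall (h0 n t ht))) (hN n t ht)) hadd hUI hEC
  have hlim : ∀ t ∈ Set.Icc 0 T, ∀ E, MeasurableSet E → ∃ l, Filter.Tendsto
      (fun n => ∫ x in E, u (sub n) t x ∂μ) Filter.atTop (nhds l) := by
    intro t ht E hE
    refine cauchySeq_tendsto_of_complete (Metric.cauchySeq_iff.2 fun δ hδ => ?_)
    obtain ⟨n0, hn0⟩ := hcau E hE (δ / 2) (by positivity)
    refine ⟨n0, fun n hn n' hn' => ?_⟩
    rw [Real.dist_eq]
    linarith [hn0 n hn n' hn' t ht]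
  choose! L hL using hlim
  have hunif : ∀ E, MeasurableSet E → ∀ δ : ℝ, 0 < δ → ∃ n0, ∀ n, n0 ≤ n → ∀ t ∈ Set.Icc 0 T,
      |∫ x in E, u (sub n) t x ∂μ - L t E| ≤ δ := by
    intro E hE δ hδ
    obtain ⟨n0, hn0⟩ := hcau E hE δ hδ
    refine ⟨n0, fun n hn t ht => ?_⟩
    refine le_of_tendsto ((hL t ht E hE).const_sub (∫ x in E, u (sub n) t x ∂μ)).abs ?_
    filter_upwards [Filter.eventually_ge_atTop n0] with n' hn'
    exact hn0 n hn n' hn' t ht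
  have hden : ∀ t ∈ Set.Icc 0 T, ∃ g : ℝ → ℝ, (∀ x, 0 ≤ g x) ∧ Integrable g μ ∧
      ∀ E, MeasurableSet E → ∫ x in E, g x ∂μ = L t E := by
    intro t ht
    refine rbk_setfn_density μ ρ hρμ (L t) ?_ ?_ ?_
    · intro E hE
      exact ge_of_tendsto' (hL t ht E hE) fun n => hI0 _ t ht E hE
    · intro E E' hE hE' hd
      refine tendsto_nhds_unique (hL t ht _ (hE.union hE')) ?_
      refine ((hL t ht E hE).add (hL t ht E' hE')).congr fun n => ?_
      exact (hadd _ t ht E E' hE hE' hd).symm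
    · intro δ hδ
      obtain ⟨η, hη, hU⟩ := hUI δ hδ
      exact ⟨η, hη, fun E hE hEη => le_of_tendsto' (hL t ht E hE) fun n => hU _ t ht E hE hEη⟩
  choose! g hg0 hgi hgL using hden
  have hgN : ∀ t ∈ Set.Icc 0 T, ∫ x, |g t x| ∂μ ≤ N := by
    intro t ht
    have e : ∫ x, |g t x| ∂μ = L t Set.univ := by
      rw [← hgL t ht _ MeasurableSet.univ, setIntegral_univ]
      exact integral_congr_ae (Filter.Eventually.of_forall fun x => abs_of_nonneg (hg0 t ht x))
    rw [e]
    refine le_of_tendsto' (hL t ht _ MeasurableSet.univ) fun n => ?_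
    rw [setIntegral_univ]; exact hN _ t ht
  refine ⟨fun x t => g t x, sub, hsub, hg0, fun t ht => ⟨hgi t ht, hgN t ht⟩, ?_⟩
  rintro φ hφ ⟨B, hB⟩ δ hδ
  refine rbk_test_fn μ T (N + N) (by positivity) (fun n t x => u (sub n) t x - g t x)
    (fun n t ht => (hintg _ t ht).sub (hgi t ht)) ?_ ?_ φ hφ B hB δ hδ
  · intro n t ht
    calc ∫ x, |u (sub n) t x - g t x| ∂μ ≤ ∫ x, (u (sub n) t x + |g t x|) ∂μ := by
          refine integral_mono ((hintg _ t ht).sub (hgi t ht)).abs ((hintg _ t ht).add (hgi t ht).abs)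
            fun x => ?_
          refine (abs_sub _ _).trans ?_
          rw [abs_of_nonneg (h0 _ t ht x)]
      _ = ∫ x, u (sub n) t x ∂μ + ∫ x, |g t x| ∂μ := integral_add (hintg _ t ht) (hgi t ht).abs
      _ ≤ N + N := add_le_add (hN _ t ht) (hgN t ht)
  · intro E hE d hd
    obtain ⟨n0, hn0⟩ := hunif E hE d hd
    refine ⟨n0, fun n hn t ht => ?_⟩
    rw [integral_sub (hintg _ t ht).integrableOn (hgi t ht).integrableOn, hgL t ht E hE]
    exact hn0 n hn t ht

theorem rbk_cell_floor {ε : ℝ} (hε : 0 < ε) {i : ℕ} (hi : 1 ≤ i) (x : ℝ) :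
    x ∈ cell ε i ↔ ⌊x / ε + 1/2⌋₊ = i := by
  rw [Nat.floor_eq_iff' (by omega), cell, Set.mem_Ico]
  have e : x = (x / ε) * ε := by field_simp
  constructor
  · rintro ⟨h1, h2⟩
    rw [e] at h1 h2
    have h1 := le_of_mul_le_mul_right h1 hε
    have h2 := lt_of_mul_lt_mul_right h2 hε.le
    constructor <;> linarith
  · rintro ⟨h1, h2⟩
    constructor
    · conv_rhs => rw [e]
      exact mul_le_mul_of_nonneg_right (by linarith) hε.le
    · conv_lhs => rw [e]
      exact mul_lt_mul_of_pos_right (by linarith) hε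

theorem rbk_cell_disj {ε : ℝ} (hε : 0 < ε) {i j : ℕ} (hi : 1 ≤ i) (hj : 1 ≤ j) (hij : i ≠ j) :
    Disjoint (cell ε i) (cell ε j) := by
  rw [Set.disjoint_left]
  intro x h1 h2
  rw [rbk_cell_floor hε hi] at h1
  rw [rbk_cell_floor hε hj] at h2
  omega

theorem rbk_cell_meas (ε : ℝ) (i : ℕ) : MeasurableSet (cell ε i) := measurableSet_Ico

theorem rbk_cell_pos {ε : ℝ} (hε : 0 < ε) {i : ℕ} (hi : 1 ≤ i) : cell ε i ⊆ Set.Ioi 0 := by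
  intro x hx
  have : (1:ℝ) ≤ i := by exact_mod_cast hi
  have h := hx.1
  have : 0 < ((i:ℝ) - 1/2) * ε := mul_pos (by linarith) hε
  exact lt_of_lt_of_le this h

theorem rbk_cell_two {ε : ℝ} (hε : 0 < ε) {i : ℕ} (hi : 1 ≤ i) {x : ℝ} (hx : x ∈ cell ε i) :
    ε * i ≤ 2 * x ∧ x ≤ 2 * (ε * i) := by
  have : (1:ℝ) ≤ i := by exact_mod_cast hi
  obtain ⟨h1, h2⟩ := hx
  constructor <;> nlinarith

theorem rbk_cell_vol {ε : ℝ} (hε : 0 < ε) (i : ℕ) : volume (cell ε i) = ENNReal.ofReal ε := by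
  rw [cell, Real.volume_Ico]; congr 1; ring

theorem rbk_step_eq {ε : ℝ} (hε : 0 < ε) (g : ℕ → ℝ) (x : ℝ) :
    stepFn ε g x = if 1 ≤ ⌊x / ε + 1/2⌋₊ then g ⌊x / ε + 1/2⌋₊ else 0 := by
  unfold stepFn
  split_ifs with h
  · obtain ⟨k, hk⟩ : ∃ k, ⌊x / ε + 1/2⌋₊ = k + 1 := ⟨⌊x / ε + 1/2⌋₊ - 1, by omega⟩
    rw [tsum_eq_single k]
    · have : x ∈ cell ε (k+1) := (rbk_cell_floor hε (by omega) x).2 hk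
      rw [Set.indicator_of_mem this, hk, mul_one]
    · intro j hj
      have : x ∉ cell ε (j+1) := by
        rw [rbk_cell_floor hε (by omega) x]; omega
      rw [Set.indicator_of_notMem this, mul_zero]
  · rw [show (fun i : ℕ => g (i + 1) * (cell ε (i + 1)).indicator (fun _ => (1:ℝ)) x) = fun _ => 0 from ?_]
    · exact tsum_zero
    · funext j
      have : x ∉ cell ε (j+1) := by
        rw [rbk_cell_floor hε (by omega) x]; omega
      rw [Set.indicator_of_notMem this, mul_zero]

theorem rbk_step_on {ε : ℝ} (hε : 0 < ε) (g : ℕ → ℝ) {i : ℕ} (hi : 1 ≤ i) {x : ℝ}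
    (hx : x ∈ cell ε i) : stepFn ε g x = g i := by
  rw [rbk_step_eq hε, (rbk_cell_floor hε hi x).1 hx, if_pos hi]

theorem rbk_step_off {ε : ℝ} (hε : 0 < ε) (g : ℕ → ℝ) {x : ℝ}
    (hx : ∀ i : ℕ, x ∉ cell ε (i+1)) : stepFn ε g x = 0 := by
  rw [rbk_step_eq hε, if_neg]
  intro h
  obtain ⟨k, hk⟩ : ∃ k, ⌊x / ε + 1/2⌋₊ = k + 1 := ⟨⌊x / ε + 1/2⌋₊ - 1, by omega⟩
  exact hx k ((rbk_cell_floor hε (by omega) x).2 hk)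

theorem rbk_step_nonneg {ε : ℝ} (hε : 0 < ε) (g : ℕ → ℝ) (hg : ∀ i, 1 ≤ i → 0 ≤ g i) (x : ℝ) :
    0 ≤ stepFn ε g x := by
  rw [rbk_step_eq hε]
  split_ifs with h
  · exact hg _ h
  · exact le_rfl

theorem rbk_step_int0 {ε : ℝ} (hε : 0 < ε) (g : ℕ → ℝ) (hg : ∀ i, 1 ≤ i → 0 ≤ g i)
    (hs : Summable (fun i : ℕ => g (i+1))) (E : Set ℝ) (hE : MeasurableSet E) :
    IntegrableOn (stepFn ε g) E ∧
    HasSum (fun i : ℕ => g (i+1) * volume.real (E ∩ cell ε (i+1))) (∫ x in E, stepFn ε g x) := by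
  have hm : ∀ i : ℕ, MeasurableSet (E ∩ cell ε (i+1)) := fun i => hE.inter (rbk_cell_meas _ _)
  have hfin : ∀ i : ℕ, volume (E ∩ cell ε (i+1)) ≠ ⊤ := by
    intro i
    refine ne_top_of_le_ne_top ?_ (measure_mono Set.inter_subset_right)
    rw [rbk_cell_vol hε]; exact ENNReal.ofReal_ne_top
  have hle : ∀ i : ℕ, volume.real (E ∩ cell ε (i+1)) ≤ ε := by
    intro i
    have : volume (E ∩ cell ε (i+1)) ≤ ENNReal.ofReal ε := by
      rw [← rbk_cell_vol hε (i+1)]; exact measure_mono Set.inter_subset_right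
    exact ENNReal.toReal_le_of_le_ofReal hε.le this
  have heq : ∀ i : ℕ, Set.EqOn (stepFn ε g) (fun _ => g (i+1)) (E ∩ cell ε (i+1)) :=
    fun i x hx => rbk_step_on hε g (by omega) hx.2
  have hval : ∀ i : ℕ, ∫ x in E ∩ cell ε (i+1), stepFn ε g x
      = g (i+1) * volume.real (E ∩ cell ε (i+1)) := by
    intro i
    rw [setIntegral_congr_fun (hm i) (heq i), setIntegral_const, smul_eq_mul, mul_comm]
  have hI : IntegrableOn (stepFn ε g) (⋃ i : ℕ, E ∩ cell ε (i+1)) := by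
    apply integrableOn_iUnion_of_summable_integral_norm
    · intro i
      exact (integrableOn_const (hfin i)).congr_fun (heq i).symm (hm i)
    · have : ∀ i : ℕ, ∫ x in E ∩ cell ε (i+1), ‖stepFn ε g x‖
          = g (i+1) * volume.real (E ∩ cell ε (i+1)) := by
        intro i
        rw [← hval]
        apply setIntegral_congr_fun (hm i)
        intro x _
        exact Real.norm_of_nonneg (rbk_step_nonneg hε g hg x)
      simp_rw [this]
      refine Summable.of_nonneg_of_le (fun i => mul_nonneg (hg _ (by omega)) measureReal_nonneg)
        (fun i => mul_le_mul_of_nonneg_left (hle i) (hg _ (by omega))) (hs.mul_right ε)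
  have hoff : ∀ x ∈ E \ (⋃ i : ℕ, E ∩ cell ε (i+1)), stepFn ε g x = 0 := by
    intro x hx
    apply rbk_step_off hε
    intro i hi
    exact hx.2 (Set.mem_iUnion.2 ⟨i, hx.1, hi⟩)
  refine ⟨hI.of_forall_sdiff_eq_zero hE hoff, ?_⟩
  have h := hasSum_integral_iUnion hm ?_ hI
  · rw [setIntegral_eq_of_subset_of_forall_sdiff_eq_zero hE ?_ hoff]
    · simp_rw [hval] at h; exact h
    · exact Set.iUnion_subset fun i => Set.inter_subset_left
  · intro i j hij
    exact (rbk_cell_disj hε (by omega) (by omega) (by omega : i+1 ≠ j+1)).mono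
      Set.inter_subset_right Set.inter_subset_right

theorem rbk_step_int {ε : ℝ} (hε : 0 < ε) (g : ℕ → ℝ) (hg : ∀ i, 1 ≤ i → 0 ≤ g i)
    (hs : Summable (fun i : ℕ => g (i+1))) :
    Integrable (stepFn ε g) (volume.restrict (Set.Ioi 0)) ∧ ∀ E : Set ℝ, MeasurableSet E →
    HasSum (fun i : ℕ => g (i+1) * volume.real (E ∩ cell ε (i+1)))
      (∫ x in E, stepFn ε g x ∂(volume.restrict (Set.Ioi 0))) := by
  refine ⟨(rbk_step_int0 hε g hg hs _ measurableSet_Ioi).1, ?_⟩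
  intro E hE
  rw [Measure.restrict_restrict hE]
  have h := (rbk_step_int0 hε g hg hs (E ∩ Set.Ioi 0) (hE.inter measurableSet_Ioi)).2
  have : ∀ i : ℕ, E ∩ Set.Ioi 0 ∩ cell ε (i+1) = E ∩ cell ε (i+1) := by
    intro i
    rw [Set.inter_assoc, Set.inter_eq_self_of_subset_right (rbk_cell_pos hε (by omega))]
  simp_rw [this] at h
  exact h

theorem rbk_ref : ∃ ρ : Measure ℝ, IsFiniteMeasure ρ ∧ ρ ≪ volume.restrict (Set.Ioi (0:ℝ)) ∧
    ∀ R : ℝ, ∀ E : Set ℝ, MeasurableSet E →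
      volume.real (E ∩ Set.Ioc 0 R) ≤ Real.exp R * ρ.real E := by
  have hfin := isFiniteMeasure_withDensity_ofReal (integrableOn_exp_neg_Ioi 0).2
  refine ⟨_, hfin, withDensity_absolutelyContinuous _ _, ?_⟩
  intro R E hE
  set ρ := (volume.restrict (Set.Ioi (0:ℝ))).withDensity fun x => ENNReal.ofReal (Real.exp (-x)) with hρ
  have h1 : ENNReal.ofReal (Real.exp (-R)) * volume (E ∩ Set.Ioc 0 R) ≤ ρ E := by
    rw [hρ, withDensity_apply _ hE, Measure.restrict_restrict hE, ← setLIntegral_const]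
    refine (setLIntegral_mono' (hE.inter measurableSet_Ioc) ?_).trans
      (lintegral_mono_set (Set.inter_subset_inter_right E (fun x hx => hx.1)))
    intro x hx
    exact ENNReal.ofReal_le_ofReal (Real.exp_le_exp.2 (by linarith [hx.2.2]))
  have h2 := ENNReal.toReal_mono (measure_ne_top ρ E) h1
  rw [ENNReal.toReal_mul, ENNReal.toReal_ofReal (Real.exp_pos _).le] at h2
  change Real.exp (-R) * volume.real (E ∩ Set.Ioc 0 R) ≤ ρ.real E at h2
  calc _ = Real.exp R * (Real.exp (-R) * volume.real (E ∩ Set.Ioc 0 R)) := by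
        rw [← mul_assoc, ← Real.exp_add]; simp
    _ ≤ _ := mul_le_mul_of_nonneg_left h2 (Real.exp_pos _).le

theorem rbk_sum_shift (h : ℕ → ℝ) (m : ℕ) :
    ∑ i ∈ Finset.range m, h (i+1) = ∑ i ∈ Finset.Icc 1 m, h i := by
  induction m with
  | zero => simp
  | succ m ih => rw [Finset.sum_range_succ, ih, Finset.sum_Icc_succ_top (by omega)]

theorem rbk_cellE_le {ε : ℝ} (hε : 0 < ε) (E : Set ℝ) (i : ℕ) :
    volume.real (E ∩ cell ε i) ≤ ε := by
  have : volume (E ∩ cell ε i) ≤ ENNReal.ofReal ε := by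
    rw [← rbk_cell_vol hε i]; exact measure_mono Set.inter_subset_right
  exact ENNReal.toReal_le_of_le_ofReal hε.le this

theorem rbk_cellE_sum {ε : ℝ} (hε : 0 < ε) (E : Set ℝ) (hE : MeasurableSet E) (R : ℝ) (m : ℕ) :
    ∑ i ∈ Finset.Icc 1 m, (if ε * (i:ℝ) ≤ R then volume.real (E ∩ cell ε i) else 0)
      ≤ volume.real (E ∩ Set.Ioc 0 (2*R)) := by
  rw [← Finset.sum_filter]
  have hfin : volume (E ∩ Set.Ioc 0 (2*R)) ≠ ⊤ :=
    ne_top_of_le_ne_top (by rw [Real.volume_Ioc]; exact ENNReal.ofReal_ne_top) (measure_mono (Set.inter_subset_right (s := E) (t := Set.Ioc 0 (2*R))))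
  have hft : ∀ i ∈ (Finset.Icc 1 m).filter (fun i : ℕ => ε * (i:ℝ) ≤ R),
      volume (E ∩ cell ε i) ≠ ⊤ := by
    intro i _
    refine ne_top_of_le_ne_top ?_ (measure_mono Set.inter_subset_right)
    rw [rbk_cell_vol hε]; exact ENNReal.ofReal_ne_top
  rw [← measureReal_biUnion_finset (h := hft)]
  · apply measureReal_mono _ hfin
    apply Set.iUnion₂_subset
    intro i hi
    rw [Finset.mem_filter, Finset.mem_Icc] at hi
    intro x hx
    refine ⟨hx.1, rbk_cell_pos hε hi.1.1 hx.2, ?_⟩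
    have := (rbk_cell_two hε hi.1.1 hx.2).2
    linarith [hi.2]
  · intro i hi j hj hij
    rw [Finset.mem_coe, Finset.mem_filter, Finset.mem_Icc] at hi hj
    exact (rbk_cell_disj hε hi.1.1 hj.1.1 hij).mono Set.inter_subset_right Set.inter_subset_right
  · intro i _
    exact hE.inter (rbk_cell_meas _ _)

theorem rbk_step_UI {ε A R δ : ℝ} (hε : 0 < ε) (hA : 0 ≤ A) (g : ℕ → ℝ)
    (hg : ∀ i, 1 ≤ i → 0 ≤ g i)
    (hs : Summable (fun i : ℕ => g (i+1)))
    (h : ∀ m : ℕ, ∑ i ∈ Finset.Icc 1 m,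
      max (ε * g i - (if ε*(i:ℝ) ≤ R then ε*A else 0)) 0 ≤ δ)
    (E : Set ℝ) (hE : MeasurableSet E) :
    ∫ x in E, stepFn ε g x ∂(volume.restrict (Set.Ioi 0))
      ≤ δ + A * volume.real (E ∩ Set.Ioc 0 (2*R)) := by
  have hS := ((rbk_step_int hε g hg hs).2 E hE).tendsto_sum_nat
  refine le_of_tendsto' hS fun m => ?_
  rw [rbk_sum_shift (fun i => g i * volume.real (E ∩ cell ε i))]
  have h2 := mul_le_mul_of_nonneg_left (rbk_cellE_sum hε E hE R m) hA
  refine le_trans ?_ (add_le_add (h m) h2)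
  rw [Finset.mul_sum, ← Finset.sum_add_distrib]
  apply Finset.sum_le_sum
  intro i hi
  have hv := rbk_cellE_le hε E i
  have hv0 : 0 ≤ volume.real (E ∩ cell ε i) := measureReal_nonneg
  set v := volume.real (E ∩ cell ε i)
  have hgi := hg i (Finset.mem_Icc.1 hi).1
  split_ifs with hc
  · by_cases hga : g i ≤ A
    · have := le_max_right (ε * g i - ε * A) 0
      nlinarith [mul_le_mul_of_nonneg_right hga hv0]
    · push Not at hga
      have := le_max_left (ε * g i - ε * A) 0
      nlinarith [mul_le_mul_of_nonneg_left hv (sub_nonneg.2 hga.le)]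
  · have := le_max_left (ε * g i - 0) 0
    nlinarith [mul_le_mul_of_nonneg_left hv hgi]

theorem rbk_step_EC {ε B : ℝ} (hε : 0 < ε) (g g' : ℕ → ℝ)
    (hg : ∀ i, 1 ≤ i → 0 ≤ g i) (hs : Summable (fun i : ℕ => g (i+1)))
    (hg' : ∀ i, 1 ≤ i → 0 ≤ g' i) (hs' : Summable (fun i : ℕ => g' (i+1)))
    (M0 : ℕ) (h : ∀ M : ℕ, M0 ≤ M → ∀ φ : ℕ → ℝ, (∀ i, |φ i| ≤ 1) →
      |∑ i ∈ Finset.Icc 1 M, φ i * (ε * g i - ε * g' i)| ≤ B)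
    (E : Set ℝ) (hE : MeasurableSet E) :
    |∫ x in E, stepFn ε g x ∂(volume.restrict (Set.Ioi 0)) -
      ∫ x in E, stepFn ε g' x ∂(volume.restrict (Set.Ioi 0))| ≤ B := by
  have hS := (((rbk_step_int hε g hg hs).2 E hE).sub
    ((rbk_step_int hε g' hg' hs').2 E hE)).tendsto_sum_nat.abs
  refine le_of_tendsto hS ?_
  filter_upwards [Filter.eventually_ge_atTop M0] with m hm
  rw [rbk_sum_shift (fun i => g i * volume.real (E ∩ cell ε i) - g' i * volume.real (E ∩ cell ε i))]
  have h2 := h m hm (fun i => volume.real (E ∩ cell ε i) / ε) (fun i => by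
    rw [abs_of_nonneg (div_nonneg measureReal_nonneg hε.le)]
    exact (div_le_one hε).2 (rbk_cellE_le hε E i))
  refine le_trans (le_of_eq ?_) h2
  congr 1
  apply Finset.sum_congr rfl
  intro i _
  field_simp

theorem rbk_cell_int_sum {ε : ℝ} (hε : 0 < ε) (h : ℝ → ℝ) (h0 : ∀ x, 0 < x → 0 ≤ h x)
    (hi : IntegrableOn h (Set.Ioi 0)) (m : ℕ) :
    ∑ i ∈ Finset.Icc 1 m, ∫ x in cell ε i, h x ≤ ∫ x in Set.Ioi (0:ℝ), h x := by
  have hsub : (⋃ i ∈ Finset.Icc 1 m, cell ε i) ⊆ Set.Ioi 0 := by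
    apply Set.iUnion₂_subset
    intro i hi
    exact rbk_cell_pos hε (Finset.mem_Icc.1 hi).1
  rw [← integral_biUnion_finset]
  · apply setIntegral_mono_set hi
    · filter_upwards [ae_restrict_mem measurableSet_Ioi] with x hx
      exact h0 x hx
    · exact hsub.eventuallyLE
  · intro i _
    exact rbk_cell_meas _ _
  · intro i hi j hj hij
    rw [Finset.mem_coe, Finset.mem_Icc] at hi hj
    exact rbk_cell_disj hε hi.1 hj.1 hij
  · intro i hi'
    exact hi.mono_set (rbk_cell_pos hε (Finset.mem_Icc.1 hi').1)

theorem rbk_fin_int (fin : ℝ → ℝ) (h : IntegrableOn (fun x => (1 + x) * fin x) (Set.Ioi 0)) :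
    IntegrableOn fin (Set.Ioi 0) := by
  have h2 : IntegrableOn (fun x => ((1 + x) * fin x) * (1+x)⁻¹) (Set.Ioi 0) := by
    apply Integrable.mul_bdd (c := 1) h
    · exact (by fun_prop : Measurable fun x : ℝ => (1+x)⁻¹).aestronglyMeasurable
    · filter_upwards [ae_restrict_mem measurableSet_Ioi] with x hx
      have hx : 0 < x := hx
      rw [Real.norm_of_nonneg (by positivity)]
      exact inv_le_one_of_one_le₀ (by linarith)
  refine h2.congr_fun ?_ measurableSet_Ioi
  intro x hx
  have hx : 0 < x := hx
  have : 1 + x ≠ 0 := by linarith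
  field_simp

theorem rbk_init (fin : ℝ → ℝ) (h0 : ∀ x, 0 < x → 0 ≤ fin x) (hi : IntegrableOn fin (Set.Ioi 0))
    (κ : ℝ) (hκ : 0 < κ) : ∃ k0 : ℝ, 1 ≤ k0 ∧ ∀ η, 0 < η → η ≤ 1/k0 → ∀ ε, 0 < ε → ∀ M : ℕ,
      ∑ i ∈ Finset.Icc 1 M, max ((∫ x in cell ε i, fin x) -
        (if η ≤ ε * (i:ℝ) ∧ ε * (i:ℝ) ≤ k0 then ε * k0 else 0)) 0 ≤ κ := by
  set S : ℝ → Set ℝ := fun k => Set.Icc (2/k) (k/2) with hS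
  have hSm : ∀ k, MeasurableSet (S k) := fun k => measurableSet_Icc
  set G : ℝ → ℝ → ℝ := fun k x => max (fin x - (S k).indicator (fun _ => k) x) 0 with hG
  have hGi : ∀ k : ℝ, 0 ≤ k → IntegrableOn (G k) (Set.Ioi 0) := by
    intro k hk
    refine Integrable.mono' hi ?_ ?_
    · exact (hi.1.sub ((measurable_const.indicator (hSm k)).aestronglyMeasurable)).sup
        aestronglyMeasurable_const
    · filter_upwards [ae_restrict_mem measurableSet_Ioi] with x hx
      rw [Real.norm_of_nonneg (le_max_right _ _)]
      refine max_le ?_ (h0 x hx)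
      have : 0 ≤ (S k).indicator (fun _ => k) x := Set.indicator_nonneg (fun _ _ => hk) x
      linarith
  have hlim : Filter.Tendsto (fun n : ℕ => ∫ x in Set.Ioi (0:ℝ), G n x) Filter.atTop
      (nhds (∫ x in Set.Ioi (0:ℝ), (0:ℝ))) := by
    apply tendsto_integral_of_dominated_convergence fin
    · intro n; exact (hGi n (Nat.cast_nonneg n)).1
    · exact hi
    · intro n
      filter_upwards [ae_restrict_mem measurableSet_Ioi] with x hx
      rw [Real.norm_of_nonneg (le_max_right _ _)]
      refine max_le ?_ (h0 x hx)
      have : 0 ≤ (S n).indicator (fun _ => (n:ℝ)) x :=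
        Set.indicator_nonneg (fun _ _ => Nat.cast_nonneg n) x
      linarith
    · filter_upwards [ae_restrict_mem measurableSet_Ioi] with x hx
      have hx : 0 < x := hx
      apply tendsto_const_nhds.congr'
      filter_upwards [Filter.eventually_ge_atTop (⌈fin x⌉₊ + ⌈2*x⌉₊ + ⌈2/x⌉₊ + 1)] with n hn
      have hn' : ((⌈fin x⌉₊ + ⌈2*x⌉₊ + ⌈2/x⌉₊ + 1 : ℕ) : ℝ) ≤ n := by exact_mod_cast hn
      push_cast at hn'
      have a1 := Nat.le_ceil (fin x)
      have a2 := Nat.le_ceil (2*x)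
      have a3 := Nat.le_ceil (2/x)
      have b1 : (0:ℝ) ≤ ⌈fin x⌉₊ := Nat.cast_nonneg _
      have b2 : (0:ℝ) ≤ ⌈2*x⌉₊ := Nat.cast_nonneg _
      have b3 : (0:ℝ) ≤ ⌈2/x⌉₊ := Nat.cast_nonneg _
      have hnp : (0:ℝ) < n := by linarith
      have hxS : x ∈ S n := by
        refine ⟨?_, by linarith⟩
        rw [div_le_iff₀ hnp]
        have : 2 / x ≤ n := by linarith
        rw [div_le_iff₀ hx] at this
        linarith
      simp only [hG]
      rw [Set.indicator_of_mem hxS, max_eq_right]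
      linarith
  rw [integral_zero] at hlim
  obtain ⟨k, hk, hk1⟩ := ((hlim.eventually (ge_mem_nhds hκ)).and
    (Filter.eventually_ge_atTop 1)).exists
  have hk1 : (1:ℝ) ≤ k := by exact_mod_cast hk1
  refine ⟨k, hk1, ?_⟩
  intro η hη hηk ε hε M
  refine le_trans ?_ hk
  refine le_trans ?_ (rbk_cell_int_sum hε (G k) (fun x _ => le_max_right _ _)
    (hGi k (by linarith)) M)
  apply Finset.sum_le_sum
  intro i hi'
  have hi1 := (Finset.mem_Icc.1 hi').1
  have hGc := (hGi k (by linarith)).mono_set (rbk_cell_pos hε hi1)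
  have hfc := hi.mono_set (rbk_cell_pos hε hi1)
  refine max_le ?_ (integral_nonneg fun x => le_max_right _ _)
  have hcv : volume (cell ε i) ≠ ⊤ := by rw [rbk_cell_vol hε]; exact ENNReal.ofReal_ne_top
  have hcr : volume.real (cell ε i) = ε := by
    rw [Measure.real, rbk_cell_vol hε, ENNReal.toReal_ofReal hε.le]
  set c : ℝ := if η ≤ ε * (i:ℝ) ∧ ε * (i:ℝ) ≤ k then (k:ℝ) else 0 with hc
  have e1 : (if η ≤ ε * (i:ℝ) ∧ ε * (i:ℝ) ≤ k then ε * (k:ℝ) else 0)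
      = ∫ x in cell ε i, c := by
    rw [setIntegral_const, hcr, hc, smul_eq_mul]
    split_ifs <;> simp
  rw [e1, ← integral_sub hfc (integrableOn_const hcv)]
  apply setIntegral_mono_on (hfc.sub (integrableOn_const hcv)) hGc (rbk_cell_meas _ _)
  intro x hx
  refine le_trans ?_ (le_max_left _ _)
  have : (S k).indicator (fun _ => (k:ℝ)) x ≤ c := by
    by_cases hxS : x ∈ S k
    · rw [Set.indicator_of_mem hxS, hc, if_pos]
      obtain ⟨t1, t2⟩ := rbk_cell_two hε hi1 hx
      obtain ⟨s1, s2⟩ := hxS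
      constructor
      · have : (2:ℝ)/k = 2 * (1/k) := by ring
        rw [this] at s1
        linarith
      · linarith
    · rw [Set.indicator_of_notMem hxS, hc]
      split_ifs
      · linarith
      · exact le_rfl
  exact sub_le_sub_left this (fin x)

theorem rbk_w_sum {ε : ℝ} (hε : 0 < ε) (fin : ℝ → ℝ) (h0 : ∀ x, 0 < x → 0 ≤ fin x)
    (hi : IntegrableOn (fun x => (1 + x) * fin x) (Set.Ioi 0)) (w : ℕ → ℝ)
    (hw : ∀ i, 1 ≤ i → ∀ x ∈ cell ε i, w i ≤ 2 * (1 + x)) (L : ℕ) :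
    ∑ i ∈ Finset.Icc 1 L, w i * ∫ x in cell ε i, fin x
      ≤ 2 * ∫ x in Set.Ioi (0:ℝ), (1 + x) * fin x := by
  rw [← integral_const_mul]
  refine le_trans ?_ (rbk_cell_int_sum hε (fun x => 2 * ((1 + x) * fin x)) (fun x hx => ?_)
    (hi.const_mul 2) L)
  · apply Finset.sum_le_sum
    intro i hi'
    have hi1 := (Finset.mem_Icc.1 hi').1
    rw [← integral_const_mul]
    have hf := (rbk_fin_int fin hi).mono_set (rbk_cell_pos hε hi1)
    apply setIntegral_mono_on (hf.const_mul _)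
      (IntegrableOn.mono_set (hi.const_mul 2) (rbk_cell_pos hε hi1)) (rbk_cell_meas _ _)
    intro x hx
    have := mul_le_mul_of_nonneg_right (hw i hi1 x hx) (h0 x (rbk_cell_pos hε hi1 hx))
    linarith
  · have := h0 x hx
    positivity

theorem rbk_sol_summable {a : ℕ → ℕ → ℝ} {g0 : ℕ → ℝ} {g : ℕ → ℝ → ℝ}
    (h : IsDRBKSol a g0 g) (t : ℝ) (ht : 0 ≤ t) : Summable (fun i : ℕ => g (i+1) t) := by
  refine Summable.of_nonneg_of_le (fun i => h.1 _ (by omega) t ht) (fun i => ?_)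
    (h.2.2.2.2.1 t ht)
  have := h.1 (i+1) (by omega) t ht
  have : (0:ℝ) ≤ i := Nat.cast_nonneg i
  nlinarith

theorem rbk_sol_RSol {K : ℝ → ℝ → ℝ} {ε : ℝ} (hε : 0 < ε) (fin : ℝ → ℝ)
    (h0 : ∀ x, 0 < x → 0 ≤ fin x)
    (hi : IntegrableOn (fun x => (1 + x) * fin x) (Set.Ioi 0)) (f : ℕ → ℝ → ℝ)
    (h : IsDRBKSol (fun i j => ε * K (ε * i) (ε * j))
        (fun i => ε⁻¹ * ∫ x in cell ε i, fin x) f) (hε1 : ε < 1) :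
    RSol K ε (2 * ∫ x in Set.Ioi (0:ℝ), (1 + x) * fin x) (fun i t => ε * f i t) := by
  have hsum := fun t ht => rbk_sol_summable h t ht
  obtain ⟨hnn, hin, heq, hs0, hst, hmass, hnum, -⟩ := h
  have hg0 : ∀ i : ℕ, 0 ≤ ∫ x in cell ε (i+1), fin x := fun i =>
    setIntegral_nonneg (rbk_cell_meas _ _) fun x hx => h0 x (rbk_cell_pos hε (by omega) hx)
  set N := 2 * ∫ x in Set.Ioi (0:ℝ), (1 + x) * fin x with hN
  refine ⟨fun i hi t ht => mul_nonneg hε.le (hnn i hi t ht), ?_, ?_, ?_⟩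
  · intro t ht L
    rw [← Finset.mul_sum, ← rbk_sum_shift (fun i => f i t)]
    have h1 := (hsum t ht).sum_le_tsum (Finset.range L) (fun i _ => hnn _ (by omega) t ht)
    have h2 : ∑' i : ℕ, ε⁻¹ * ∫ x in cell ε (i+1), fin x ≤ ε⁻¹ * N := by
      apply Real.tsum_le_of_sum_range_le
      · intro i; exact mul_nonneg (inv_nonneg.2 hε.le) (hg0 i)
      · intro n
        rw [← Finset.mul_sum, rbk_sum_shift (fun i => ∫ x in cell ε i, fin x)]
        refine mul_le_mul_of_nonneg_left ?_ (inv_nonneg.2 hε.le)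
        have := rbk_w_sum hε fin h0 hi (fun _ => 1) (fun i hi x hx => by
          have : 0 < x := rbk_cell_pos hε hi hx
          linarith) n
        simpa using this
    have h3 := (h1.trans (hnum t ht)).trans h2
    calc _ ≤ ε * (ε⁻¹ * N) := mul_le_mul_of_nonneg_left h3 hε.le
      _ = N := by field_simp
  · intro t ht L
    have e : ∑ i ∈ Finset.Icc 1 L, ε * ((i:ℕ):ℝ) * (ε * f i t)
        = ε^2 * ∑ i ∈ Finset.range L, ((i:ℝ)+1) * f (i+1) t := by
      have := rbk_sum_shift (fun i => (i:ℝ) * f i t) L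
      push_cast at this
      rw [this, Finset.mul_sum]
      apply Finset.sum_congr rfl
      intro i _
      ring
    rw [e]
    have h1 := (hst t ht).sum_le_tsum (Finset.range L)
      (fun i _ => mul_nonneg (by positivity) (hnn _ (by omega) t ht))
    have h2 : ∑' i : ℕ, ((i:ℝ)+1) * (ε⁻¹ * ∫ x in cell ε (i+1), fin x) ≤ (ε^2)⁻¹ * N := by
      apply Real.tsum_le_of_sum_range_le
      · intro i
        exact mul_nonneg (by positivity) (mul_nonneg (inv_nonneg.2 hε.le) (hg0 i))
      · intro n
        have hw := rbk_w_sum hε fin h0 hi (fun i => ε * (i:ℝ)) (fun i hi x hx => by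
          have := (rbk_cell_two hε hi hx).1
          linarith) n
        have := rbk_sum_shift (fun i => (i:ℝ) * (ε⁻¹ * ∫ x in cell ε i, fin x)) n
        push_cast at this
        rw [this]
        refine le_trans (le_of_eq ?_) (mul_le_mul_of_nonneg_left hw (by positivity : 0 ≤ (ε^2)⁻¹))
        rw [Finset.mul_sum]
        apply Finset.sum_congr rfl
        intro i _
        field_simp
    have h3 := (h1.trans (hmass t ht)).trans h2
    calc _ ≤ ε^2 * ((ε^2)⁻¹ * N) := mul_le_mul_of_nonneg_left h3 (by positivity)
      _ = N := by field_simp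
  · intro i hi t ht
    obtain ⟨s1, s2, hd⟩ := heq i hi t ht
    have hd2 := hd.const_mul ε
    rw [mul_sub] at hd2
    refine ⟨_, _, ?_, ?_, hd2⟩
    · have hh := s1.hasSum.mul_left ε
      refine (congrArg (fun q => HasSum q _) (funext fun j => ?_)).mp hh
      ring
    · have hh := s2.hasSum.mul_left ε
      refine (congrArg (fun q => HasSum q _) (funext fun j => ?_)).mp hh
      ring

/-- weak `L¹`-compactness: along a sequence `ε_n → 0` the step functions
`f_{ε_n}` converge in `C([0,T]; w-L¹(0,∞))` to a nonnegative `f ∈ L^∞(0,T; L¹(0,∞))`,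
i.e. uniformly in `t ∈ [0,T]` when tested against any `φ ∈ L^∞(0,∞)`. -/
theorem stmt10
    (K : ℝ → ℝ → ℝ) (r : ℝ → ℝ) (α : ℝ → ℝ → ℝ) (A : ℝ) (hA : 0 < A)
    (hK_cont : ContinuousOn (fun p : ℝ × ℝ => K p.1 p.2) (Set.Ioi 0 ×ˢ Set.Ioi 0))
    (hK_symm : ∀ x y : ℝ, 0 < x → 0 < y → K x y = K y x)
    (hK_nonneg : ∀ x y : ℝ, 0 < x → 0 < y → 0 ≤ K x y)
    (hr_cont : ContinuousOn r (Set.Ioi 0))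
    (hr_nonneg : ∀ x : ℝ, 0 < x → 0 ≤ r x)
    (hα_cont : ContinuousOn (fun p : ℝ × ℝ => α p.1 p.2) (Set.Ioi 0 ×ˢ Set.Ioi 0))
    (hα_nonneg : ∀ x y : ℝ, 0 < x → 0 < y → 0 ≤ α x y)
    (hα_symm : ∀ x y : ℝ, 0 < x → 0 < y → α x y = α y x)
    (hK_form : ∀ x y : ℝ, 0 < x → 0 < y → K x y = r x * r y + α x y)
    (hα_bound : ∀ x y : ℝ, 1 ≤ x → 1 ≤ y → α x y ≤ A * r x * r y)
    (ω : ℝ → ℝ → ℝ)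
    (hω_bound : ∀ R : ℝ, 1 ≤ R → ∀ y : ℝ, 0 < y → ∀ x : ℝ, 0 < x → x ≤ R → K x y / y ≤ ω R y)
    (hω_lim : ∀ R : ℝ, 1 ≤ R → Filter.Tendsto (ω R) Filter.atTop (nhds 0))
    (Ω : ℝ → ℝ)
    (hΩ_bound : ∀ R : ℝ, 1 ≤ R → ∀ x : ℝ, R ≤ x → r x / x ≤ Ω R)
    (hΩ_lim : Filter.Tendsto Ω Filter.atTop (nhds 0))
    (fin : ℝ → ℝ)
    (hfin_nonneg : ∀ x : ℝ, 0 < x → 0 ≤ fin x)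
    (hfin_int : IntegrableOn (fun x => (1 + x) * fin x) (Set.Ioi 0))
    (f : ℝ → ℕ → ℝ → ℝ)
    (hsol : ∀ ε : ℝ, 0 < ε → ε < 1 →
      IsDRBKSol (fun i j => ε * K (ε * i) (ε * j))
        (fun i => ε⁻¹ * ∫ x in cell ε i, fin x) (f ε)) :
    ∀ T : ℝ, 0 < T →
      ∃ flim : ℝ → ℝ → ℝ, ∃ seq : ℕ → ℝ,
        (∀ n : ℕ, seq n ∈ Set.Ioo (0:ℝ) 1) ∧
        Filter.Tendsto seq Filter.atTop (nhds 0) ∧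
        (∀ t ∈ Set.Icc (0:ℝ) T, ∀ x : ℝ, 0 < x → 0 ≤ flim x t) ∧
        (∃ M : ℝ, ∀ t ∈ Set.Icc (0:ℝ) T,
          IntegrableOn (fun x => flim x t) (Set.Ioi 0) ∧
          (∫ x in Set.Ioi (0:ℝ), |flim x t|) ≤ M) ∧
        (∀ φ : ℝ → ℝ, Measurable φ → (∃ M : ℝ, ∀ x : ℝ, |φ x| ≤ M) →
          ∀ δ : ℝ, 0 < δ → ∃ N : ℕ, ∀ n : ℕ, N ≤ n → ∀ t ∈ Set.Icc (0:ℝ) T,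
            |∫ x in Set.Ioi (0:ℝ),
                (stepFn (seq n) (fun i => f (seq n) i t) x - flim x t) * φ x| ≤ δ) := by
  intro T hT
  set N := 2 * ∫ x in Set.Ioi (0:ℝ), (1 + x) * fin x with hN
  have hF : ∀ ε, 0 < ε → ε < 1 → RSol K ε N (fun i t => ε * f ε i t) := fun ε hε hε1 =>
    rbk_sol_RSol hε fin hfin_nonneg hfin_int (f ε) (hsol ε hε hε1) hε1
  have htail := rbk_kernel_tail K r α A hA hK_symm hr_nonneg hK_form hα_bound ω hω_bound hω_lim
    Ω hΩ_bound hΩ_lim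
  have hinit : ∀ κ : ℝ, 0 < κ → ∃ k0 : ℝ, 1 ≤ k0 ∧ ∀ η, 0 < η → η ≤ 1 / k0 → ∀ ε, 0 < ε → ε < 1 →
      ∀ M : ℕ, ∑ i ∈ Finset.Icc 1 M,
        max (ε * f ε i 0 - (if η ≤ ε * (i:ℝ) ∧ ε * (i:ℝ) ≤ k0 then ε * k0 else 0)) 0 ≤ κ := by
    intro κ hκ
    obtain ⟨k0, hk0, h⟩ := rbk_init fin hfin_nonneg (rbk_fin_int fin hfin_int) κ hκ
    refine ⟨k0, hk0, fun η hη hηk ε hε hε1 M => ?_⟩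
    refine le_trans (le_of_eq ?_) (h η hη hηk ε hε M)
    apply Finset.sum_congr rfl
    intro i hi
    rw [(hsol ε hε hε1).2.1 i (Finset.mem_Icc.1 hi).1, mul_inv_cancel_left₀ hε.ne']
  have hUI := rbk_UI (F := fun ε i t => ε * f ε i t) hF hK_cont hK_symm hK_nonneg htail hinit T hT
  have hEC := rbk_EC (F := fun ε i t => ε * f ε i t) hF hK_cont hK_symm hK_nonneg htail T hUI
  obtain ⟨ρ, hρfin, hρμ, hρ⟩ := rbk_ref
  have hq0 : ∀ n : ℕ, (0:ℝ) < 1 / ((n:ℝ) + 2) := fun n => by positivity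
  have hq1 : ∀ n : ℕ, 1 / ((n:ℝ) + 2) < 1 := fun n => by
    rw [div_lt_one (by positivity)]
    have : (0:ℝ) ≤ n := Nat.cast_nonneg n
    linarith
  have hnn : ∀ n : ℕ, ∀ t, 0 ≤ t → ∀ i, 1 ≤ i → 0 ≤ f (1 / ((n:ℝ) + 2)) i t :=
    fun n t ht i hi => (hsol _ (hq0 n) (hq1 n)).1 i hi t ht
  have hsm : ∀ n : ℕ, ∀ t, 0 ≤ t → Summable fun i : ℕ => f (1 / ((n:ℝ) + 2)) (i+1) t :=
    fun n t ht => rbk_sol_summable (hsol _ (hq0 n) (hq1 n)) t ht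
  obtain ⟨g, sub, hsub, hg0, hgi, hconv⟩ := rbk_compact (volume.restrict (Set.Ioi (0:ℝ))) ρ hρμ T N hT
    (fun n t x => stepFn (1 / ((n:ℝ) + 2)) (fun i => f (1 / ((n:ℝ) + 2)) i t) x)
    (fun n t ht x => rbk_step_nonneg (hq0 n) _ (hnn n t ht.1) x)
    (fun n t ht => (rbk_step_int (hq0 n) _ (hnn n t ht.1) (hsm n t ht.1)).1)
    (by
      intro n t ht
      have h := (rbk_step_int (hq0 n) _ (hnn n t ht.1) (hsm n t ht.1)).2 Set.univ MeasurableSet.univ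
      rw [Measure.restrict_univ] at h
      refine le_of_tendsto' h.tendsto_sum_nat fun m => ?_
      rw [rbk_sum_shift (fun i => f (1 / ((n:ℝ) + 2)) i t *
        volume.real (Set.univ ∩ cell (1 / ((n:ℝ) + 2)) i))]
      refine le_trans (Finset.sum_le_sum fun i hi => ?_) ((hF _ (hq0 n) (hq1 n)).num t ht.1 m)
      rw [mul_comm]
      exact mul_le_mul_of_nonneg_right (rbk_cellE_le (hq0 n) _ i)
        (hnn n t ht.1 i (Finset.mem_Icc.1 hi).1))
    (by
      intro δ hδ
      obtain ⟨B, R, hB, hR, h⟩ := hUI (δ/2) (by positivity)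
      refine ⟨δ / 2 / ((B + 1) * Real.exp (2*R)), by positivity, ?_⟩
      intro n t ht E hE hEη
      have h1 := rbk_step_UI (hq0 n) hB _ (hnn n t ht.1) (hsm n t ht.1)
        (h _ (hq0 n) (hq1 n) t ht) E hE
      rw [le_div_iff₀ (by positivity)] at hEη
      have h2 := hρ (2*R) E hE
      have h3 : B * volume.real (E ∩ Set.Ioc 0 (2*R)) ≤ δ/2 := by
        have h4 : (0:ℝ) ≤ volume.real (E ∩ Set.Ioc 0 (2*R)) := measureReal_nonneg
        have h5 := mul_le_mul_of_nonneg_left h2 (by linarith : 0 ≤ B + 1)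
        nlinarith
      linarith)
    (by
      intro δ hδ
      obtain ⟨C, hC, h⟩ := hEC δ hδ
      refine ⟨C, hC, ?_⟩
      intro n s t hs hst htT E hE
      obtain ⟨M0, hM⟩ := h _ (hq0 n) (hq1 n)
      exact rbk_step_EC (hq0 n) _ _ (hnn n t (hs.trans hst)) (hsm n t (hs.trans hst))
        (hnn n s hs) (hsm n s hs) M0 (fun M hMM φ hφ => hM M hMM s t hs hst htT φ hφ) E hE)
  refine ⟨g, fun n => 1 / ((sub n : ℝ) + 2), fun n => ⟨hq0 _, hq1 _⟩, ?_,
    fun t ht x _ => hg0 t ht x, ⟨N, hgi⟩, hconv⟩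
  have hl : Filter.Tendsto (fun n : ℕ => 1 / ((n:ℝ) + 2)) Filter.atTop (nhds 0) := by
    have := (tendsto_one_div_add_atTop_nhds_zero_nat (𝕜 := ℝ)).comp (Filter.tendsto_add_atTop_nat 1)
    refine this.congr fun n => ?_
    simp only [Function.comp]
    push_cast
    ring_nf
  exact hl.comp hsub.tendsto_atTop
end

section
/- Let U be an open subset of ℝ^m (m ≥ 1), let (ρ_n)_{n≥1} be a sequence in L¹(U) and (ϑ_n)_{n≥1} a sequence in L^∞(U). Assume there exist ρ ∈ L¹(U), ϑ ∈ L^∞(U), and c > 0 such that ρ_n ⇀ ρ weakly in L¹(U), ‖ϑ_n‖_{L^∞(U)} ≤ c for all n, and ϑ_n → ϑ almost everywhere in U. Then ‖ρ_n(ϑ_n − ϑ)‖_{L¹(U)} → 0 as n → ∞, and ρ_n ϑ_n ⇀ ρϑ weakly in L¹(U). -/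
section Aux
open MeasureTheory Filter Topology

variable {α : Type*} [MeasurableSpace α] {μ : Measure α}

/-- A measurable sign. -/
lemma exists_sign {f : α → ℝ} (hf : Integrable f μ) :
    ∃ σ : α → ℝ, Measurable σ ∧ (∀ x, |σ x| ≤ 1) ∧ ∀ᵐ x ∂μ, f x * σ x = |f x| := by
  have hm := hf.aestronglyMeasurable
  refine ⟨fun x => if 0 ≤ hm.mk f x then 1 else -1, ?_, ?_, ?_⟩
  · exact Measurable.ite (measurableSet_le measurable_const hm.stronglyMeasurable_mk.measurable)
      measurable_const measurable_const
  · intro x; dsimp only; split_ifs <;> simp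
  · filter_upwards [hm.ae_eq_mk] with x hx
    rw [← hx]
    split_ifs with h
    · rw [abs_of_nonneg h, mul_one]
    · rw [abs_of_neg (not_le.1 h)]; ring

lemma int_mul {f g : α → ℝ} (hf : Integrable f μ) (hg : Measurable g) {M : ℝ}
    (h : ∀ x, |g x| ≤ M) : Integrable (fun x => f x * g x) μ :=
  hf.mul_bdd (c := M) hg.aestronglyMeasurable (Eventually.of_forall h)

lemma hump_step {f : ℕ → α → ℝ} (hf : ∀ n, Integrable (f n) μ)
    (hw : ∀ g : α → ℝ, Measurable g → (∃ M : ℝ, ∀ x, |g x| ≤ M) →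
      Tendsto (fun n => ∫ x, f n x * g x ∂μ) atTop (𝓝 0))
    {E : ℕ → Set α} (hE : ∀ n, MeasurableSet (E n)) (hanti : Antitone E)
    (hnull : μ (⋂ n, E n) = 0) {ε : ℝ} (hε : 0 < ε)
    (hfreq : ∃ᶠ n in atTop, ε ≤ ∫ x in E n, |f n x| ∂μ)
    (n : ℕ) (G : α → ℝ) (hG : Measurable G) (hG1 : ∀ x, |G x| ≤ 1) (hG0 : ∀ x ∈ E n, G x = 0)
    (hn : ε ≤ ∫ x in E n, |f n x| ∂μ) (hs : |∫ x, f n x * G x ∂μ| ≤ ε / 8) :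
    ∃ (n' : ℕ) (G' : α → ℝ), (Measurable G' ∧ (∀ x, |G' x| ≤ 1) ∧ (∀ x ∈ E n', G' x = 0) ∧
      (ε ≤ ∫ x in E n', |f n' x| ∂μ) ∧ |∫ x, f n' x * G' x ∂μ| ≤ ε / 8) ∧
      n < n' ∧ (∀ x, x ∉ E n → G' x = G x) ∧ (∫ x in E n', |f n x| ∂μ) ≤ ε / 8 ∧
      3 * ε / 4 ≤ ∫ x, f n x * G' x ∂μ := by
  obtain ⟨σ, hσm, hσ1, hσ⟩ := exists_sign (hf n)
  have hlim : Tendsto (fun p => ∫ x in E p, |f n x| ∂μ) atTop (𝓝 0) := by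
    have := tendsto_setIntegral_of_antitone (μ := μ) (f := fun x => |f n x|) hE hanti
      ⟨0, (hf n).abs.integrableOn⟩
    rwa [setIntegral_measure_zero _ hnull] at this
  obtain ⟨p, hp, hnp⟩ := ((hlim.eventually (ge_mem_nhds (show (0:ℝ) < ε / 8 by positivity))).and
    (eventually_ge_atTop (n+1))).exists
  set G' : α → ℝ := fun x => G x + (E n \ E p).indicator σ x with hG'
  have hsm : Measurable ((E n \ E p).indicator σ) := hσm.indicator ((hE n).diff (hE p))
  have hs1 : ∀ x, |(E n \ E p).indicator σ x| ≤ 1 := by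
    intro x
    by_cases hx : x ∈ E n \ E p
    · simpa [hx] using hσ1 x
    · simp [Set.indicator_of_notMem hx]
  have hG'm : Measurable G' := hG.add hsm
  have hoff : ∀ x, x ∉ E n → G' x = G x := fun x hx => by simp [hG', hx]
  have hG'1 : ∀ x, |G' x| ≤ 1 := by
    intro x
    by_cases hx : x ∈ E n
    · simp only [hG', hG0 x hx, zero_add]; exact hs1 x
    · rw [hoff x hx]; exact hG1 x
  have hev := (hw G' hG'm ⟨1, hG'1⟩).abs
  rw [abs_zero] at hev
  obtain ⟨n', hn', hev', hpn'⟩ := (hfreq.and_eventually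
    ((hev.eventually (ge_mem_nhds (show (0:ℝ) < ε / 8 by positivity))).and
    (eventually_ge_atTop p))).exists
  have hsub : E n' ⊆ E p := hanti hpn'
  have hpn : E p ⊆ E n := hanti (by omega)
  refine ⟨n', G', ⟨hG'm, hG'1, ?_, hn', hev'⟩, by omega, hoff, ?_, ?_⟩
  · intro x hx
    simp [hG', hG0 x (hpn (hsub hx)), hsub hx]
  · refine le_trans ?_ hp
    exact setIntegral_mono_set (hf n).abs.integrableOn (Eventually.of_forall fun x => abs_nonneg _)
      hsub.eventuallyLE
  · have e1 : ∫ x, f n x * G' x ∂μ = ∫ x, f n x * G x ∂μ + ∫ x in E n \ E p, |f n x| ∂μ := by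
      rw [← integral_indicator ((hE n).diff (hE p)), ← integral_add (int_mul (hf n) hG hG1)
        ((hf n).abs.indicator ((hE n).diff (hE p)))]
      refine integral_congr_ae ?_
      filter_upwards [hσ] with x hx
      simp only [hG']
      by_cases h : x ∈ E n \ E p
      · simp only [Set.indicator_of_mem h, mul_add, hx]
      · simp only [Set.indicator_of_notMem h, add_zero]
    have e2 := setIntegral_sdiff (hE p) (hf n).abs.integrableOn hpn (μ := μ)
    rw [e1, e2]
    have := (abs_le.1 hs).1
    linarith

lemma hump {f : ℕ → α → ℝ} (hf : ∀ n, Integrable (f n) μ)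
    (hw : ∀ g : α → ℝ, Measurable g → (∃ M : ℝ, ∀ x, |g x| ≤ M) →
      Tendsto (fun n => ∫ x, f n x * g x ∂μ) atTop (𝓝 0))
    {E : ℕ → Set α} (hE : ∀ n, MeasurableSet (E n)) (hanti : Antitone E)
    (hnull : μ (⋂ n, E n) = 0) :
    Tendsto (fun n => ∫ x in E n, |f n x| ∂μ) atTop (𝓝 0) := by
  by_contra hcon
  have hpos : ∀ n, 0 ≤ ∫ x in E n, |f n x| ∂μ := fun n => integral_nonneg fun x => abs_nonneg _
  have : ∃ ε : ℝ, 0 < ε ∧ ∃ᶠ n in atTop, ε ≤ ∫ x in E n, |f n x| ∂μ := by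
    by_contra! h
    apply hcon
    rw [Metric.tendsto_nhds]
    intro ε hε
    have := h ε hε
    filter_upwards [this] with n hn
    rw [Real.dist_eq, sub_zero, abs_of_nonneg (hpos n)]
    exact hn
  obtain ⟨ε, hε, hfreq⟩ := this
  obtain ⟨n0, hn0⟩ := hfreq.exists
  let P : ℕ × (α → ℝ) → Prop := fun s => Measurable s.2 ∧ (∀ x, |s.2 x| ≤ 1) ∧
    (∀ x ∈ E s.1, s.2 x = 0) ∧ (ε ≤ ∫ x in E s.1, |f s.1 x| ∂μ) ∧
    |∫ x, f s.1 x * s.2 x ∂μ| ≤ ε / 8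
  have step : ∀ s : {s // P s}, ∃ t : {s // P s}, s.1.1 < t.1.1 ∧
      (∀ x, x ∉ E s.1.1 → t.1.2 x = s.1.2 x) ∧ (∫ x in E t.1.1, |f s.1.1 x| ∂μ) ≤ ε / 8 ∧
      3 * ε / 4 ≤ ∫ x, f s.1.1 x * t.1.2 x ∂μ := by
    rintro ⟨⟨n, G⟩, h1, h2, h3, h4, h5⟩
    obtain ⟨n', G', hP, h⟩ := hump_step hf hw hE hanti hnull hε hfreq n G h1 h2 h3 h4 h5
    exact ⟨⟨(n', G'), hP⟩, h⟩
  choose nx hnx using step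
  let s0 : {s // P s} := ⟨(n0, fun _ => 0), measurable_const, by simp, by simp, hn0, by
    simp; positivity⟩
  let s : ℕ → {s // P s} := fun k => nx^[k] s0
  have hs : ∀ k, s (k+1) = nx (s k) := fun k => Function.iterate_succ_apply' _ _ _
  let N : ℕ → ℕ := fun k => (s k).1.1
  let G : ℕ → α → ℝ := fun k => (s k).1.2
  have hN : StrictMono N := strictMono_nat_of_lt_succ fun k => by
    simp only [N, hs]; exact (hnx (s k)).1
  have hGs : ∀ k x, x ∉ E (N k) → G (k+1) x = G k x := fun k => by
    simp only [N, G, hs]; exact (hnx (s k)).2.1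
  have hsm : ∀ k, (∫ x in E (N (k+1)), |f (N k) x| ∂μ) ≤ ε / 8 := fun k => by
    simp only [N, hs]; exact (hnx (s k)).2.2.1
  have hbig : ∀ k, 3 * ε / 4 ≤ ∫ x, f (N k) x * G (k+1) x ∂μ := fun k => by
    simp only [N, G, hs]; exact (hnx (s k)).2.2.2
  have hGm : ∀ k, Measurable (G k) := fun k => (s k).2.1
  have hG1 : ∀ k x, |G k x| ≤ 1 := fun k => (s k).2.2.1
  have hG0 : ∀ k, ∀ x ∈ E (N k), G k x = 0 := fun k => (s k).2.2.2.1
  have hstab : ∀ k x, x ∉ E (N k) → ∀ j, k ≤ j → G j x = G k x := by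
    intro k x hx j hj
    induction j, hj using Nat.le_induction with
    | base => rfl
    | succ j hj ih =>
      rw [hGs j x (fun h => hx (hanti (hN.monotone hj) h)), ih]
  have hlim : ∀ x, ∃ y, Tendsto (fun k => G k x) atTop (𝓝 y) ∧ |y| ≤ 1 ∧
      ∀ k, x ∉ E (N k) → y = G k x := by
    intro x
    by_cases h : ∃ k, x ∉ E (N k)
    · obtain ⟨k, hk⟩ := h
      have ht : Tendsto (fun k => G k x) atTop (𝓝 (G k x)) :=
        tendsto_atTop_of_eventually_const (i₀ := k) (fun j hj => hstab k x hk j hj)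
      refine ⟨G k x, ht, hG1 k x, fun j hj => ?_⟩
      rcases le_total k j with h | h
      · exact (hstab k x hk j h).symm
      · exact hstab j x hj k h
    · push Not at h
      refine ⟨0, ?_, by simp, fun k hk => absurd (h k) hk⟩
      exact tendsto_const_nhds.congr fun k => (hG0 k x (h k)).symm
  choose g hgt hg1 hgeq using hlim
  have hgm : Measurable g := measurable_of_tendsto_metrizable hGm (tendsto_pi_nhds.2 hgt)
  have hlb : ∀ k, ε / 2 ≤ ∫ x, f (N k) x * g x ∂μ := by
    intro k
    have i1 := int_mul (hf (N k)) (hGm (k+1)) (hG1 (k+1))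
    have i2 := int_mul (hf (N k)) hgm hg1
    have : ∫ x, f (N k) x * G (k+1) x ∂μ - ∫ x, f (N k) x * g x ∂μ
        ≤ ∫ x in E (N (k+1)), |f (N k) x| ∂μ := by
      rw [← integral_sub i1 i2, ← integral_indicator (hE _)]
      refine integral_mono (i1.sub i2) ((hf (N k)).abs.indicator (hE _)) fun x => ?_
      by_cases h : x ∈ E (N (k+1))
      · simp only [Set.indicator_of_mem h, hG0 (k+1) x h, mul_zero, zero_sub]
        refine (neg_le_abs _).trans ?_
        rw [abs_mul]
        exact mul_le_of_le_one_right (abs_nonneg _) (hg1 x)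
      · simp only [Set.indicator_of_notMem h, hgeq x _ h, sub_self, le_refl]
    have h1 := hbig k
    have h2 := hsm k
    linarith
  have := ge_of_tendsto' ((hw g hgm ⟨1, hg1⟩).comp hN.tendsto_atTop) hlb
  linarith

lemma bdd_rep {g : α → ℝ} (hg : AEStronglyMeasurable g μ) {M : ℝ} (hM : ∀ᵐ x ∂μ, |g x| ≤ M) :
    ∃ g' : α → ℝ, Measurable g' ∧ (∀ x, |g' x| ≤ |M|) ∧ g =ᵐ[μ] g' := by
  refine ⟨fun x => max (-|M|) (min |M| (hg.mk g x)),
    measurable_const.max (measurable_const.min hg.stronglyMeasurable_mk.measurable), ?_, ?_⟩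
  · intro x
    have := abs_nonneg M
    exact abs_le.2 ⟨le_max_left _ _, max_le (by linarith) (min_le_left _ _)⟩
  · filter_upwards [hM, hg.ae_eq_mk] with x h1 h2
    rw [← h2]
    have := abs_le.1 (h1.trans (le_abs_self M))
    rw [min_eq_right this.2, max_eq_right this.1]

lemma l1_bdd {f : ℕ → α → ℝ} (hf : ∀ n, Integrable (f n) μ)
    (hw : ∀ g : α → ℝ, Measurable g → (∃ M : ℝ, ∀ x, |g x| ≤ M) →
      Tendsto (fun n => ∫ x, f n x * g x ∂μ) atTop (𝓝 0)) :
    ∃ K : ℝ, ∀ n, ∫ x, |f n x| ∂μ ≤ K := by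
  let φ : ℕ → (Lp ℝ ⊤ μ →L[ℝ] ℝ) := fun n =>
    (ContinuousLinearMap.mul ℝ ℝ).lpPairing μ 1 ⊤ ((hf n).toL1 (f n))
  have hφ : ∀ n (g : Lp ℝ ⊤ μ), φ n g = ∫ x, f n x * g x ∂μ := by
    intro n g
    simp only [φ, ContinuousLinearMap.lpPairing_eq_integral]
    refine integral_congr_ae ?_
    filter_upwards [(hf n).coeFn_toL1] with x hx
    rw [hx]; rfl
  obtain ⟨K, hK⟩ := banach_steinhaus (g := φ) (by
    intro g
    have hb : ∀ᵐ x ∂μ, |g x| ≤ ‖g‖ := by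
      filter_upwards [ae_le_eLpNormEssSup (f := g) (μ := μ)] with x hx
      rw [Lp.norm_def, eLpNorm_exponent_top, ← Real.norm_eq_abs, ← toReal_enorm]
      refine ENNReal.toReal_mono ?_ hx
      rw [← eLpNorm_exponent_top]
      exact Lp.eLpNorm_ne_top g
    obtain ⟨g', hg'm, hg'b, hg'⟩ := bdd_rep (Lp.aestronglyMeasurable g) hb
    have ht := hw g' hg'm ⟨_, hg'b⟩
    obtain ⟨C, hC⟩ := ht.norm.bddAbove_range
    refine ⟨C, fun n => ?_⟩
    have : φ n g = ∫ x, f n x * g' x ∂μ := by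
      rw [hφ]
      refine integral_congr_ae ?_
      filter_upwards [hg'] with x hx
      rw [hx]
    rw [this]
    exact hC ⟨n, rfl⟩)
  refine ⟨K, fun n => ?_⟩
  obtain ⟨σ, hσm, hσ1, hσ⟩ := exists_sign (hf n)
  have hmem : MemLp σ ⊤ μ := memLp_top_of_bound hσm.aestronglyMeasurable 1
    (Eventually.of_forall hσ1)
  have hnorm : ‖hmem.toLp σ‖ ≤ 1 := by
    rw [Lp.norm_toLp]
    refine ENNReal.toReal_le_of_le_ofReal zero_le_one ?_
    rw [eLpNorm_exponent_top]
    exact eLpNormEssSup_le_of_ae_bound (Eventually.of_forall hσ1)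
  have e : φ n (hmem.toLp σ) = ∫ x, |f n x| ∂μ := by
    rw [hφ]
    refine integral_congr_ae ?_
    filter_upwards [hσ, hmem.coeFn_toLp] with x h1 h2
    rw [h2, h1]
  rw [← e]
  calc φ n (hmem.toLp σ) ≤ ‖φ n (hmem.toLp σ)‖ := le_abs_self _
    _ ≤ ‖φ n‖ * ‖hmem.toLp σ‖ := (φ n).le_opNorm _
    _ ≤ ‖φ n‖ * 1 := by gcongr
    _ ≤ K := by rw [mul_one]; exact hK n

lemma key {f h : ℕ → α → ℝ} (hf : ∀ n, Integrable (f n) μ)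
    (hw : ∀ g : α → ℝ, Measurable g → (∃ M : ℝ, ∀ x, |g x| ≤ M) →
      Tendsto (fun n => ∫ x, f n x * g x ∂μ) atTop (𝓝 0))
    (hm : ∀ n, Measurable (h n)) {C : ℝ} (hC : ∀ n x, |h n x| ≤ C) (hC0 : 0 ≤ C)
    (hae : ∀ᵐ x ∂μ, Tendsto (fun n => h n x) atTop (𝓝 0)) :
    Tendsto (fun n => ∫ x, |f n x * h n x| ∂μ) atTop (𝓝 0) := by
  obtain ⟨K, hK⟩ := l1_bdd hf hw
  have hK0 : 0 ≤ K := (integral_nonneg fun x => abs_nonneg _).trans (hK 0)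
  rw [Metric.tendsto_nhds]
  intro ε hε
  set δ := ε / (2 * (K + 1)) with hδ
  have hδ0 : 0 < δ := by positivity
  have hδK : δ * K < ε / 2 + 0 := by
    have : δ * (K+1) = ε / 2 := by rw [hδ]; field_simp
    nlinarith
  let E : ℕ → Set α := fun n => ⋃ k ≥ n, {x | δ < |h k x|}
  have hE : ∀ n, MeasurableSet (E n) := fun n =>
    MeasurableSet.iUnion fun k => MeasurableSet.iUnion fun _ =>
      measurableSet_lt measurable_const (hm k).abs
  have hanti : Antitone E := fun a b hab x hx => by
    simp only [E, Set.mem_iUnion] at hx ⊢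
    obtain ⟨k, hk, hx⟩ := hx
    exact ⟨k, le_trans hab hk, hx⟩
  have hnull : μ (⋂ n, E n) = 0 := by
    refine measure_mono_null (t := {x | ¬ Tendsto (fun n => h n x) atTop (𝓝 0)}) ?_ hae
    intro x hx ht
    have ht' := ht.abs
    rw [abs_zero] at ht'
    obtain ⟨n, hn⟩ := eventually_atTop.1 (ht'.eventually (ge_mem_nhds hδ0))
    have := Set.mem_iInter.1 hx n
    simp only [E, Set.mem_iUnion] at this
    obtain ⟨k, hk, hx⟩ := this
    exact absurd (hn k hk) (not_le.2 hx)
  have hh := (hump hf hw hE hanti hnull).const_mul C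
  rw [mul_zero] at hh
  filter_upwards [hh.eventually (gt_mem_nhds (show (0:ℝ) < ε / 2 by positivity))] with n hn
  rw [Real.dist_eq, sub_zero, abs_of_nonneg (integral_nonneg fun x => abs_nonneg _)]
  have i1 := ((hf n).abs.indicator (hE n)).const_mul C
  have i2 := (hf n).abs.const_mul δ
  calc ∫ x, |f n x * h n x| ∂μ
      ≤ ∫ x, (C * (E n).indicator (fun x => |f n x|) x + δ * |f n x|) ∂μ := by
        refine integral_mono (int_mul (hf n) (hm n) (hC n)).abs (i1.add i2) fun x => ?_
        simp only [abs_mul]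
        have hfx := abs_nonneg (f n x)
        by_cases hx : x ∈ E n
        · simp only [Set.indicator_of_mem hx]
          nlinarith [hC n x, mul_nonneg hδ0.le hfx, mul_le_mul_of_nonneg_left (hC n x) hfx]
        · have : |h n x| ≤ δ := by
            by_contra hlt
            refine hx ?_
            simp only [E, Set.mem_iUnion]
            exact ⟨n, le_refl n, not_le.1 hlt⟩
          simp only [Set.indicator_of_notMem hx]
          nlinarith [mul_le_mul_of_nonneg_left this hfx]
    _ = C * ∫ x in E n, |f n x| ∂μ + δ * ∫ x, |f n x| ∂μ := by
        rw [integral_add i1 i2, integral_const_mul, integral_const_mul, integral_indicator (hE n)]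
    _ < ε := by
        have := mul_le_mul_of_nonneg_left (hK n) hδ0.le
        linarith

lemma main_aux {ρn ϑn : ℕ → α → ℝ} {ρ ϑ : α → ℝ} {c : ℝ} (hc : 0 < c)
    (hρn : ∀ n, Integrable (ρn n) μ) (hρ : Integrable ρ μ)
    (hϑn_meas : ∀ n : ℕ, AEStronglyMeasurable (ϑn n) μ)
    (hϑ_meas : AEStronglyMeasurable ϑ μ)
    (hϑn_bdd : ∀ n : ℕ, ∀ᵐ x ∂μ, |ϑn n x| ≤ c)
    (hϑ_bdd : ∃ M : ℝ, ∀ᵐ x ∂μ, |ϑ x| ≤ M)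
    (hweak : ∀ g : α → ℝ, Measurable g → (∃ M : ℝ, ∀ x, |g x| ≤ M) →
      Tendsto (fun n => ∫ x, ρn n x * g x ∂μ) atTop (𝓝 (∫ x, ρ x * g x ∂μ)))
    (hae : ∀ᵐ x ∂μ, Tendsto (fun n => ϑn n x) atTop (𝓝 (ϑ x))) :
    Tendsto (fun n => ∫ x, |ρn n x * (ϑn n x - ϑ x)| ∂μ) atTop (𝓝 0) ∧
    ∀ g : α → ℝ, Measurable g → (∃ M : ℝ, ∀ x, |g x| ≤ M) →
      Tendsto (fun n => ∫ x, ρn n x * ϑn n x * g x ∂μ) atTop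
        (𝓝 (∫ x, ρ x * ϑ x * g x ∂μ)) := by
  obtain ⟨M, hM⟩ := hϑ_bdd
  obtain ⟨T, hTm, hTb, hT⟩ := bdd_rep hϑ_meas hM
  choose t htm htb ht using fun n => bdd_rep (hϑn_meas n) (hϑn_bdd n)
  have hdm : ∀ n, Measurable (fun x => t n x - T x) := fun n => (htm n).sub hTm
  have hdb : ∀ n x, |t n x - T x| ≤ |c| + |M| := fun n x =>
    (abs_sub _ _).trans (add_le_add (htb n x) (hTb x))
  have hd0 : ∀ᵐ x ∂μ, Tendsto (fun n => t n x - T x) atTop (𝓝 0) := by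
    filter_upwards [hae, hT, ae_all_iff.2 ht] with x h1 h2 h3
    have := h1.sub_const (ϑ x)
    rw [sub_self] at this
    exact this.congr fun n => by rw [h3 n, h2]
  have hf : ∀ n, Integrable (fun x => ρn n x - ρ x) μ := fun n => (hρn n).sub hρ
  have k1 := key (f := fun n x => ρn n x - ρ x) hf (by
    intro g hg ⟨B, hB⟩
    have := (hweak g hg ⟨B, hB⟩).sub_const (∫ x, ρ x * g x ∂μ)
    rw [sub_self] at this
    refine this.congr fun n => ?_
    rw [← integral_sub (int_mul (hρn n) hg hB) (int_mul hρ hg hB)]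
    simp only [sub_mul]) hdm hdb (by positivity) hd0
  have k2 : Tendsto (fun n => ∫ x, |ρ x * (t n x - T x)| ∂μ) atTop (𝓝 0) := by
    have := tendsto_integral_of_dominated_convergence (μ := μ)
      (F := fun n x => |ρ x * (t n x - T x)|) (f := fun _ => 0)
      (fun x => |ρ x| * (|c| + |M|))
      (fun n => (int_mul hρ (hdm n) (hdb n)).abs.aestronglyMeasurable)
      (hρ.abs.mul_const _) (fun n => Eventually.of_forall fun x => by
        rw [Real.norm_eq_abs, abs_abs, abs_mul]
        exact mul_le_mul_of_nonneg_left (hdb n x) (abs_nonneg _)) (by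
        filter_upwards [hd0] with x hx
        simpa using (hx.const_mul (ρ x)).abs)
    simpa using this
  have k3 : Tendsto (fun n => ∫ x, |ρn n x * (t n x - T x)| ∂μ) atTop (𝓝 0) := by
    have k12 := k1.add k2
    rw [add_zero] at k12
    refine squeeze_zero (fun n => integral_nonneg fun x => abs_nonneg _) (fun n => ?_) k12
    have j1 := (int_mul (hf n) (hdm n) (hdb n)).abs
    have j2 := (int_mul hρ (hdm n) (hdb n)).abs
    rw [← integral_add j1 j2]
    refine integral_mono (int_mul (hρn n) (hdm n) (hdb n)).abs (j1.add j2) fun x => ?_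
    refine le_trans (le_of_eq ?_) (abs_add_le _ _)
    congr 1; ring
  refine ⟨k3.congr fun n => ?_, ?_⟩
  · refine integral_congr_ae ?_
    filter_upwards [hT, ht n] with x h1 h2
    rw [h1, h2]
  · rintro g hg ⟨B, hB⟩
    have hTg : ∀ x, |T x * g x| ≤ |M| * B := fun x => by
      rw [abs_mul]; exact mul_le_mul (hTb x) (hB x) (abs_nonneg _) (abs_nonneg _)
    have l1 := hweak (fun x => T x * g x) (hTm.mul hg) ⟨_, hTg⟩
    have l2 : Tendsto (fun n => ∫ x, ρn n x * (t n x - T x) * g x ∂μ) atTop (𝓝 0) := by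
      have k4 := k3.mul_const B
      rw [zero_mul] at k4
      refine squeeze_zero_norm (fun n => ?_) k4
      have j := int_mul (hρn n) (hdm n) (hdb n)
      refine (norm_integral_le_integral_norm _).trans ?_
      rw [← integral_mul_const]
      refine integral_mono (int_mul j hg hB).norm (j.abs.mul_const B) fun x => ?_
      simp only [Real.norm_eq_abs]
      rw [abs_mul _ (g x)]
      exact mul_le_mul_of_nonneg_left (hB x) (abs_nonneg _)
    have l3 := l1.add l2
    rw [add_zero] at l3
    have e : ∫ x, ρ x * ϑ x * g x ∂μ = ∫ x, ρ x * (T x * g x) ∂μ := by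
      refine integral_congr_ae ?_
      filter_upwards [hT] with x h1
      rw [h1, mul_assoc]
    rw [e]
    refine l3.congr fun n => ?_
    rw [← integral_add (int_mul (g := fun x => T x * g x) (hρn n) (hTm.mul hg) hTg)
      (int_mul (int_mul (hρn n) (hdm n) (hdb n)) hg hB)]
    refine integral_congr_ae ?_
    filter_upwards [ht n] with x h1
    simp only [h1]
    ring

end Aux

open MeasureTheory

/-- if `ρ_n ⇀ ρ` weakly in `L¹(U)`, `‖ϑ_n‖_{L^∞(U)} ≤ c`, and `ϑ_n → ϑ`
a.e. in `U` with `ϑ ∈ L^∞(U)`, then `‖ρ_n(ϑ_n − ϑ)‖_{L¹(U)} → 0` and `ρ_n ϑ_n ⇀ ρϑ`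
weakly in `L¹(U)`. -/
theorem stmt14 {m : ℕ} (hm : 1 ≤ m) (U : Set (Fin m → ℝ)) (hU : IsOpen U)
    (ρn : ℕ → (Fin m → ℝ) → ℝ) (ϑn : ℕ → (Fin m → ℝ) → ℝ)
    (ρ : (Fin m → ℝ) → ℝ) (ϑ : (Fin m → ℝ) → ℝ) (c : ℝ) (hc : 0 < c)
    (hρn_int : ∀ n : ℕ, IntegrableOn (ρn n) U)
    (hρ_int : IntegrableOn ρ U)
    (hϑn_meas : ∀ n : ℕ, AEStronglyMeasurable (ϑn n) (volume.restrict U))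
    (hϑ_meas : AEStronglyMeasurable ϑ (volume.restrict U))
    (hϑn_bdd : ∀ n : ℕ, ∀ᵐ x ∂(volume.restrict U), |ϑn n x| ≤ c)
    (hϑ_bdd : ∃ M : ℝ, ∀ᵐ x ∂(volume.restrict U), |ϑ x| ≤ M)
    (hweak : ∀ g : (Fin m → ℝ) → ℝ, Measurable g → (∃ M : ℝ, ∀ x, |g x| ≤ M) →
      Filter.Tendsto (fun n => ∫ x in U, ρn n x * g x) Filter.atTop
        (nhds (∫ x in U, ρ x * g x)))
    (hae : ∀ᵐ x ∂(volume.restrict U),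
      Filter.Tendsto (fun n => ϑn n x) Filter.atTop (nhds (ϑ x))) :
    Filter.Tendsto (fun n => ∫ x in U, |ρn n x * (ϑn n x - ϑ x)|) Filter.atTop (nhds 0) ∧
    ∀ g : (Fin m → ℝ) → ℝ, Measurable g → (∃ M : ℝ, ∀ x, |g x| ≤ M) →
      Filter.Tendsto (fun n => ∫ x in U, ρn n x * ϑn n x * g x) Filter.atTop
        (nhds (∫ x in U, ρ x * ϑ x * g x)) := by
  exact main_aux hc hρn_int hρ_int hϑn_meas hϑ_meas hϑn_bdd hϑ_bdd hweak hae
end
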